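/- arXiv:2412.07047 — 2 statements merged into one kernel-verified Lean document; each statement's English description precedes it below -/
import Mathlib

section
/- Let (X, μ) be a standard measure space with μ σ-finite, let G ⊆ X² − Δ be a locally countable directed Borel graph whose connectedness relation E_G (generated by the symmetrization of G) is an ergodic mcp CBER of type III, and let H ⊆ G be a Borel subgraph such that E_H is an ergodic mcp CBER of type III and E_H ≠ E_G on a positive measure set. Let d_i, d_o : X → ℕ ∪ {∞} be Borel functions with d_i(x) ≥ indeg_H(x) and d_o(x) ≥ outdeg_H(x) for all x ∈ X, where each inequality is strict on some non-null set. Then there exists a directed Borel graph G' ⊇ H such that: (1) E_{G'} = E_G almost everywhere; (2) indeg_{G'}(x) = d_i(x) for almost every x; (3) outdeg_{G'}(x) = d_o(x) for almost every x. Furthermore, if the symmetrization of G is acyclic, then G' can be chosen so that its symmetrization is acyclic. -/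
open MeasureTheory Set Filter
open scoped ENNReal ENat Topology

noncomputable section

variable {X : Type*}

/-- The integral of `f` over the set of edges `A` against the "left" measure `ν_l`
determined by `μ`:  `∫ₐ f dν_l = ∫ₓ Σ_{y : (x,y) ∈ A} f(x,y) dμ(x)`. -/
def lintL [MeasurableSpace X] (μ : Measure X) (f : X × X → ℝ≥0∞) (A : Set (X × X)) : ℝ≥0∞ :=
  ∫⁻ x, ∑' y : {y : X // (x, y) ∈ A}, f (x, (y : X)) ∂μ

/-- The integral of `f` over the set of edges `A` against the "right" measure `ν_r`
determined by `μ`:  `∫ₐ f dν_r = ∫ₓ Σ_{y : (y,x) ∈ A} f(y,x) dμ(x)`. -/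
def lintR [MeasurableSpace X] (μ : Measure X) (f : X × X → ℝ≥0∞) (A : Set (X × X)) : ℝ≥0∞ :=
  ∫⁻ x, ∑' y : {y : X // (y, x) ∈ A}, f ((y : X), x) ∂μ

/-- `ν_l(A) = ∫ₓ |{y : (x,y) ∈ A}| dμ(x)`. -/
def nuL [MeasurableSpace X] (μ : Measure X) (A : Set (X × X)) : ℝ≥0∞ :=
  lintL μ (fun _ => 1) A

/-- `ν_r(A) = ∫ₓ |{y : (y,x) ∈ A}| dμ(x)`. -/
def nuR [MeasurableSpace X] (μ : Measure X) (A : Set (X × X)) : ℝ≥0∞ :=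
  lintR μ (fun _ => 1) A

/-- `E` is measure-class-preserving w.r.t. `μ`: `ν_l` and `ν_r` are mutually absolutely
continuous on Borel subsets of `E`. -/
def MCP [MeasurableSpace X] (μ : Measure X) (E : Set (X × X)) : Prop :=
  ∀ A : Set (X × X), A ⊆ E → MeasurableSet A → (nuL μ A = 0 ↔ nuR μ A = 0)

/-- `E` is measure-preserving w.r.t. `μ`: `ν_l = ν_r` on Borel subsets of `E`. -/
def MPrel [MeasurableSpace X] (μ : Measure X) (E : Set (X × X)) : Prop :=
  ∀ A : Set (X × X), A ⊆ E → MeasurableSet A → nuL μ A = nuR μ A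

/-- A countable Borel equivalence relation: a Borel equivalence relation all of whose
classes are countable. -/
def IsCBER [MeasurableSpace X] (E : Set (X × X)) : Prop :=
  MeasurableSet E ∧ Equivalence (fun x y => (x, y) ∈ E) ∧
    ∀ x : X, {y | (x, y) ∈ E}.Countable

/-- The `E`-saturation of a set `A`. -/
def ESat (E : Set (X × X)) (A : Set X) : Set X :=
  {x | ∃ y ∈ A, (x, y) ∈ E}

/-- `E` is ergodic w.r.t. `μ`: every non-null Borel set is a complete section. -/
def ErgodicRel [MeasurableSpace X] (μ : Measure X) (E : Set (X × X)) : Prop :=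
  ∀ A : Set X, MeasurableSet A → μ A ≠ 0 → μ (ESat E A)ᶜ = 0

/-- `E` is properly ergodic: ergodic, and `μ` is not concentrated on a single `E`-class. -/
def ProperlyErgodicRel [MeasurableSpace X] (μ : Measure X) (E : Set (X × X)) : Prop :=
  ErgodicRel μ E ∧ ∀ x : X, μ {y | (x, y) ∉ E} ≠ 0

/-- `μ'` is `E`-invariant: every Borel bijection between Borel subsets whose graph is
contained in `E` pushes the restricted measure forward to the restricted measure. -/
def InvariantUnder [MeasurableSpace X] (μ' : Measure X) (E : Set (X × X)) : Prop :=
  ∀ (f : X → X) (A : Set X), Measurable f → MeasurableSet A → Set.InjOn f A →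
    (∀ x ∈ A, (x, f x) ∈ E) →
    Measure.map f (μ'.restrict A) = μ'.restrict (f '' A)

/-- Mutual absolute continuity of measures. -/
def EquivMeasure [MeasurableSpace X] (μ' μ : Measure X) : Prop :=
  μ' ≪ μ ∧ μ ≪ μ'

/-- Type II: `μ` is non-atomic and some σ-finite measure equivalent to `μ` is `E`-invariant. -/
def IsTypeII [MeasurableSpace X] (μ : Measure X) (E : Set (X × X)) : Prop :=
  NoAtoms μ ∧
    ∃ μ' : Measure X, SigmaFinite μ' ∧ EquivMeasure μ' μ ∧ InvariantUnder μ' E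

/-- Type III: no σ-finite measure equivalent to `μ` is `E`-invariant. -/
def IsTypeIII [MeasurableSpace X] (μ : Measure X) (E : Set (X × X)) : Prop :=
  ¬ ∃ μ' : Measure X, SigmaFinite μ' ∧ EquivMeasure μ' μ ∧ InvariantUnder μ' E

/-- `w` is (a pointwise-cocycle version of) the Radon–Nikodym cocycle `𝔴 = dν_l/dν_r` of the
mcp relation `E`: it is Borel, takes values in `(0,∞)` on `E`, satisfies the cocycle identity,
and `ν_l(A) = ∫_A w dν_r` for every Borel `A ⊆ E`. -/
def IsRNCocycle [MeasurableSpace X] (μ : Measure X) (E : Set (X × X))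
    (w : X × X → ℝ≥0∞) : Prop :=
  Measurable w ∧
  (∀ e ∈ E, w e ≠ 0 ∧ w e ≠ ∞) ∧
  (∀ x y z : X, (y, x) ∈ E → (z, y) ∈ E → w (z, y) * w (y, x) = w (z, x)) ∧
  (∀ x : X, w (x, x) = 1) ∧
  ∀ A : Set (X × X), A ⊆ E → MeasurableSet A → nuL μ A = lintR μ w A

/-- The connectedness relation of a graph `G`: `x` and `y` are related iff they are joined
by a path of edges of `G`. -/
def connRel (G : Set (X × X)) : Set (X × X) :=
  {p | Relation.ReflTransGen (fun a b => (a, b) ∈ G) p.1 p.2}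

/-- The symmetrization of a directed graph. -/
def symmCl (G : Set (X × X)) : Set (X × X) :=
  {p | p ∈ G ∨ (p.2, p.1) ∈ G}

/-- The graph distance in `G` (with value `⊤` between distinct components). -/
def gdist (G : Set (X × X)) (x y : X) : ℕ∞ :=
  sInf ((fun m : ℕ => (m : ℕ∞)) ''
    {m : ℕ | ∃ c : ℕ → X, c 0 = x ∧ c m = y ∧ ∀ i < m, (c i, c (i + 1)) ∈ G})

/-- For a directed edge `(x,y)` of an acyclic graph `G`, the half-space
`N_{(x,y)} = {z : d_G(y,z) < d_G(x,z)}`. -/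
def halfSpace (G : Set (X × X)) (x y : X) : Set X :=
  {z | gdist G y z < gdist G x z}

/-- A geodesic ray in `G`. -/
def IsGeodesicRay (G : Set (X × X)) (r : ℕ → X) : Prop :=
  (∀ i : ℕ, (r i, r (i + 1)) ∈ G) ∧
    ∀ i j : ℕ, i ≤ j → gdist G (r i) (r j) = ((j - i : ℕ) : ℕ∞)

/-- The end represented by the geodesic ray `r` is vanishing w.r.t. the cocycle `w`:
`sup {w(y, r 0) : y ∈ N_{(r i, r (i+1))}} → 0` as `i → ∞`. -/
def VanishingEnd (w : X × X → ℝ≥0∞) (G : Set (X × X)) (r : ℕ → X) : Prop :=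
  Tendsto (fun i : ℕ => ⨆ y ∈ halfSpace G (r i) (r (i + 1)), w (y, r 0))
    atTop (nhds 0)

/-- A (symmetric) graph is acyclic if it has no injective cycle of length `≥ 3`. -/
def AcyclicGraph (G : Set (X × X)) : Prop :=
  ∀ (n : ℕ) (c : ℕ → X), 2 < n → (∀ i < n, (c i, c ((i + 1) % n)) ∈ G) →
    ¬ Function.Injective fun i : Fin n => c (i : ℕ)

/-- Amenability of a locally countable Borel graph `G` (w.r.t. the measure `μ`):
there are Borel a.e.-averaging functions `λ_n` on the connectedness relation of `G`. -/
def AmenableGraph [MeasurableSpace X] (μ : Measure X) (G : Set (X × X)) : Prop :=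
  ∃ lam : ℕ → X × X → ℝ,
    (∀ n, Measurable (lam n)) ∧
    (∀ n e, 0 ≤ lam n e) ∧
    (∀ᵐ x ∂μ, ∀ n : ℕ, ∑' y : {y : X // (x, y) ∈ connRel G}, lam n (x, (y : X)) = 1) ∧
    nuL μ {e ∈ G | ¬ Tendsto
        (fun n : ℕ => ∑' z : {z : X // (e.1, z) ∈ connRel G},
          |lam n (e.1, (z : X)) - lam n (e.2, (z : X))|)
        atTop (nhds 0)} = 0

/-- The Schreier graph of an action of a free group, with respect to the free basis. -/
def schreier {ι : Type*} [MeasurableSpace X] (φ : FreeGroup ι →* Equiv.Perm X) :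
    Set (X × X) :=
  {p | p.1 ≠ p.2 ∧ ∃ s : ι,
    φ (FreeGroup.of s) p.1 = p.2 ∨ φ (FreeGroup.of s) p.2 = p.1}

namespace ESl

/-- compact approximation from inside -/
theorem range_approx {X : Type*} [TopologicalSpace X] [PolishSpace X] [MeasurableSpace X]
    [BorelSpace X] (μ : Measure X) [IsFiniteMeasure μ] (k : (ℕ → ℕ) → X) (hk : Continuous k)
    (ε : ℝ≥0∞) (hε : ε ≠ 0) :
    ∃ K : Set (ℕ → ℕ), IsCompact K ∧ μ (range k) ≤ μ (k '' K) + ε := by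
  obtain ⟨δ, hδ, hδs⟩ := ENNReal.exists_pos_sum_of_countable hε ℕ
  have step : ∀ (m : ℕ) (S : Set (ℕ → ℕ)), ∃ a : ℕ,
      μ (k '' S) ≤ μ (k '' (S ∩ {z | z m ≤ a})) + δ m := by
    intro m S
    by_contra hcon
    push Not at hcon
    have hU : k '' S = ⋃ a : ℕ, k '' (S ∩ {z | z m ≤ a}) := by
      rw [← image_iUnion, ← inter_iUnion]
      congr 1
      ext z; simp only [mem_inter_iff, mem_iUnion, mem_ofPred_eq]
      exact ⟨fun h => ⟨h, z m, le_rfl⟩, fun h => h.1⟩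
    have hmono : Monotone fun a : ℕ => k '' (S ∩ {z | z m ≤ a}) := by
      intro a b hab
      apply image_mono
      rintro z ⟨h1, h2⟩
      exact ⟨h1, le_trans h2 hab⟩
    have h1 := hmono.measure_iUnion (μ := μ)
    rw [← hU] at h1
    have h2 : μ (k '' S) + δ m ≤ μ (k '' S) := by
      conv_lhs => rw [h1]
      rw [ENNReal.iSup_add]
      exact iSup_le fun a => (hcon a).le
    have h3 : (δ m : ℝ≥0∞) = 0 := by
      have h4 : μ (k '' S) + δ m ≤ μ (k '' S) + 0 := by simpa using h2
      simpa using (ENNReal.add_le_add_iff_left (measure_ne_top μ (k '' S))).1 h4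
    exact (hδ m).ne' (by exact_mod_cast h3)
  choose a ha using step
  let S : ℕ → Set (ℕ → ℕ) := fun m => Nat.rec univ (fun m S => S ∩ {z | z m ≤ a m S}) m
  have hS0 : S 0 = univ := rfl
  have hSs : ∀ m, S (m+1) = S m ∩ {z | z m ≤ a m (S m)} := fun m => rfl
  let n : ℕ → ℕ := fun m => a m (S m)
  have hSn : ∀ m, S m = {z | ∀ i < m, z i ≤ n i} := by
    intro m
    induction m with
    | zero => rw [hS0]; ext z; simp
    | succ m ih =>
      rw [hSs, ih]
      ext z
      simp only [mem_inter_iff, mem_ofPred_eq, Nat.lt_succ_iff_lt_or_eq]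
      constructor
      · rintro ⟨h1, h2⟩ i (hi | rfl)
        · exact h1 i hi
        · rw [← ih] at h2; exact h2
      · intro h
        refine ⟨fun i hi => h i (Or.inl hi), ?_⟩
        rw [← ih]; exact h m (Or.inr rfl)
  have hsum : ∀ m, μ (range k) ≤ μ (k '' S m) + ∑ i ∈ Finset.range m, (δ i : ℝ≥0∞) := by
    intro m
    induction m with
    | zero => rw [hS0, image_univ]; simp
    | succ m ih =>
      refine ih.trans ?_
      rw [Finset.sum_range_succ, hSs, add_comm _ (δ m : ℝ≥0∞), ← add_assoc]
      gcongr
      exact ha m (S m)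
  have hsum' : ∀ m, μ (range k) ≤ μ (k '' S m) + ε := by
    intro m
    refine (hsum m).trans ?_
    gcongr
    exact (ENNReal.sum_le_tsum _).trans hδs.le
  refine ⟨Set.pi univ fun i => Iic (n i), isCompact_univ_pi fun i => (finite_Iic _).isCompact, ?_⟩
  set K : Set (ℕ → ℕ) := Set.pi univ fun i => Iic (n i) with hK
  have hKc : IsCompact K := isCompact_univ_pi fun i => (finite_Iic _).isCompact
  have key : ∀ U, IsOpen U → k '' K ⊆ U → μ (range k) ≤ μ U + ε := by
    intro U hU hKU
    have hV : IsOpen (k ⁻¹' U) := hU.preimage hk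
    let W : ℕ → Set (ℕ → ℕ) := fun m => {z | PiNat.cylinder z m ⊆ k ⁻¹' U}
    have hWo : ∀ m, IsOpen (W m) := by
      intro m
      rw [isOpen_iff_mem_nhds]
      intro z hz
      have : PiNat.cylinder z m ∈ 𝓝 z :=
        (PiNat.isOpen_cylinder _ z m).mem_nhds (PiNat.self_mem_cylinder z m)
      filter_upwards [this] with y hy
      have : PiNat.cylinder y m = PiNat.cylinder z m := PiNat.mem_cylinder_iff_eq.1 hy
      show PiNat.cylinder y m ⊆ _
      rw [this]; exact hz
    have hcov : K ⊆ ⋃ m, W m := by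
      intro z hz
      have hzV : k ⁻¹' U ∈ 𝓝 z := hV.mem_nhds (hKU ⟨z, hz, rfl⟩)
      obtain ⟨y, m, h1, h2⟩ := (PiNat.isTopologicalBasis_cylinders (fun _ : ℕ => ℕ)).mem_nhds_iff.1 hzV |>.imp
        (fun s hs => hs) |> fun ⟨s, ⟨y, m, hs⟩, h1, h2⟩ => (⟨y, m, hs ▸ h1, hs ▸ h2⟩ :
          ∃ y m, z ∈ PiNat.cylinder y m ∧ PiNat.cylinder y m ⊆ k ⁻¹' U)
      rw [mem_iUnion]
      refine ⟨m, ?_⟩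
      show PiNat.cylinder z m ⊆ _
      rw [PiNat.mem_cylinder_iff_eq.1 h1]; exact h2
    have hdir : Directed (· ⊆ ·) W := by
      apply Monotone.directed_le
      intro m m' hmm z hz
      exact (PiNat.cylinder_anti z hmm).trans hz
    obtain ⟨m, hm⟩ := hKc.elim_directed_cover W hWo hcov hdir
    have hSm : S m ⊆ k ⁻¹' U := by
      intro z hz
      rw [hSn] at hz
      have hz' : (fun i => min (z i) (n i)) ∈ K := by
        intro i _; exact mem_Iic.2 (min_le_right _ _)
      apply hm hz'
      rw [PiNat.mem_cylinder_iff]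
      intro i hi
      exact (min_eq_left (hz i hi)).symm
    refine (hsum' m).trans ?_
    gcongr
    exact image_subset_iff.2 hSm
  by_contra hcon
  push Not at hcon
  obtain ⟨U, hKU, hU, hlt⟩ := (k '' K).exists_isOpen_lt_of_lt _ (lt_tsub_iff_right.2 hcon)
  exact absurd (lt_tsub_iff_right.1 hlt) (not_lt.2 (key U hU hKU))

theorem nullMeas_image {Z X : Type*} [MeasurableSpace Z] [StandardBorelSpace Z]
    [MeasurableSpace X] [StandardBorelSpace X] (μ : Measure X) [IsFiniteMeasure μ]
    {f : Z → X} (hf : Measurable f) {C : Set Z} (hC : MeasurableSet C) :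
    NullMeasurableSet (f '' C) μ := by
  let := upgradeStandardBorel X
  have hA : AnalyticSet (f '' C) := hC.analyticSet_image hf
  rw [AnalyticSet] at hA
  rcases hA with hA | ⟨k, hk, hr⟩
  · rw [hA]; exact nullMeasurableSet_empty
  rw [← hr]
  have := fun j : ℕ => range_approx μ k hk ((j : ℝ≥0∞) + 1)⁻¹ (by simp)
  choose K hKc hK using this
  have hm : MeasurableSet (⋃ j, k '' K j) :=
    MeasurableSet.iUnion fun j => ((hKc j).image hk).measurableSet
  have hle : μ (range k) ≤ μ (⋃ j, k '' K j) := by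
    refine ENNReal.le_of_forall_pos_le_add fun ε hε _ => ?_
    obtain ⟨j, hj⟩ := ENNReal.exists_inv_nat_lt (a := (ε : ℝ≥0∞)) (by exact_mod_cast hε.ne')
    refine (hK j).trans ?_
    gcongr
    · exact subset_iUnion (fun j => k '' K j) j
    · refine le_trans ?_ hj.le
      simp
  have := ae_eq_of_subset_of_measure_ge (iUnion_subset fun j => image_subset_range _ _) hle
    hm.nullMeasurableSet (measure_ne_top _ _)
  exact hm.nullMeasurableSet.congr this

/-- exhaustion -/
theorem exhaust {X : Type*} [MeasurableSpace X] (μ : Measure X) [IsFiniteMeasure μ]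
    (P : Set X → Prop) :
    ∃ F : Set (Set X), F.Countable ∧ F.PairwiseDisjoint id ∧
      (∀ S ∈ F, MeasurableSet S ∧ P S) ∧
      ∀ S, MeasurableSet S → P S → Disjoint S (⋃₀ F) → μ S = 0 := by
  let Q : Set (Set (Set X)) := {F | F.PairwiseDisjoint id ∧ ∀ S ∈ F, MeasurableSet S ∧ P S ∧ μ S ≠ 0}
  obtain ⟨F, hF⟩ := zorn_subset Q (by
    intro c hc hchain
    refine ⟨⋃₀ c, ⟨?_, ?_⟩, fun s hs => subset_sUnion_of_mem hs⟩
    · rw [pairwiseDisjoint_sUnion hchain.directedOn]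
      exact fun s hs => (hc hs).1
    · rintro S ⟨F, hF, hS⟩
      exact (hc hF).2 S hS)
  have hFQ : F ∈ Q := hF.prop
  have hcount : F.Countable := by
    have h := Measure.countable_meas_pos_of_disjoint_iUnion (μ := μ) (As := fun S : F => (S : Set X))
      (fun S => (hFQ.2 S S.2).1) (fun S T hST => hFQ.1 S.2 T.2 (fun h => hST (Subtype.ext h)))
    have h2 : {i : F | 0 < μ (i : Set X)} = univ := by
      ext i; simp [pos_iff_ne_zero, (hFQ.2 i i.2).2.2]
    rw [h2] at h
    exact countable_coe_iff.1 (countable_univ_iff.1 h)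
  refine ⟨F, hcount, hFQ.1, fun S hS => ⟨(hFQ.2 S hS).1, (hFQ.2 S hS).2.1⟩, ?_⟩
  intro S hSm hSP hd
  by_contra hne
  have hins : insert S F ∈ Q := by
    refine ⟨hFQ.1.insert fun T hT _ => hd.mono_right (subset_sUnion_of_mem hT), ?_⟩
    intro T hT
    rcases mem_insert_iff.1 hT with rfl | hT
    · exact ⟨hSm, hSP, hne⟩
    · exact hFQ.2 T hT
  have hSF : S ∈ F := hF.le_of_ge hins (subset_insert _ _) (mem_insert _ _)
  have : Disjoint S S := hd.mono_right (subset_sUnion_of_mem hSF)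
  rw [disjoint_self] at this
  apply hne; rw [this]; simp

end ESl

namespace ESl

/-- `S` is covered, up to a null set of fibres, by countably many sections -/
def Small {Z X : Type*} [MeasurableSpace Z] [MeasurableSpace X] (μ : Measure X) (f : Z → X)
    (S : Set Z) : Prop :=
  ∃ C : ℕ → Set Z, (∀ n, MeasurableSet (C n)) ∧ (∀ n, InjOn f (C n)) ∧
    μ (f '' (S \ ⋃ n, C n)) = 0

theorem Small.mono {Z X : Type*} [MeasurableSpace Z] [MeasurableSpace X] {μ : Measure X} {f : Z → X}
    {S T : Set Z} (h : Small μ f T) (hST : S ⊆ T) : Small μ f S := by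
  obtain ⟨C, h1, h2, h3⟩ := h
  exact ⟨C, h1, h2, measure_mono_null (image_mono (sdiff_subset_sdiff_left hST)) h3⟩

theorem Small.iUnion {Z X : Type*} [MeasurableSpace Z] [MeasurableSpace X] {μ : Measure X}
    {f : Z → X} {S : ℕ → Set Z} (h : ∀ n, Small μ f (S n)) : Small μ f (⋃ n, S n) := by
  choose C h1 h2 h3 using h
  refine ⟨fun k => C k.unpair.1 k.unpair.2, fun k => h1 _ _, fun k => h2 _ _, ?_⟩
  refine measure_mono_null ?_ (measure_iUnion_null h3)
  rintro _ ⟨z, ⟨hz, hz'⟩, rfl⟩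
  obtain ⟨n, hn⟩ := mem_iUnion.1 hz
  refine mem_iUnion.2 ⟨n, z, ⟨hn, ?_⟩, rfl⟩
  intro hc
  obtain ⟨m, hm⟩ := mem_iUnion.1 hc
  apply hz'
  refine mem_iUnion.2 ⟨Nat.pair n m, ?_⟩
  simpa using hm

theorem Small.of_injOn {Z X : Type*} [MeasurableSpace Z] [MeasurableSpace X] {μ : Measure X}
    {f : Z → X} {S : Set Z} (hS : MeasurableSet S) (h : InjOn f S) : Small μ f S :=
  ⟨fun _ => S, fun _ => hS, fun _ => h, by simp [iUnion_const]⟩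

theorem Small.empty {Z X : Type*} [MeasurableSpace Z] [MeasurableSpace X] {μ : Measure X}
    {f : Z → X} : Small μ f ∅ := Small.of_injOn MeasurableSet.empty (by simp)

theorem Small.union {Z X : Type*} [MeasurableSpace Z] [MeasurableSpace X] {μ : Measure X}
    {f : Z → X} {S T : Set Z} (h : Small μ f S) (h' : Small μ f T) : Small μ f (S ∪ T) := by
  have := Small.iUnion (S := fun n : ℕ => if n = 0 then S else T) (μ := μ) (f := f)
    (by intro n; split_ifs; exacts [h, h'])
  refine this.mono ?_
  rintro z (hz | hz)
  · exact mem_iUnion.2 ⟨0, by simpa using hz⟩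
  · exact mem_iUnion.2 ⟨1, by simpa using hz⟩

theorem Small.sUnion {Z X : Type*} [MeasurableSpace Z] [MeasurableSpace X] {μ : Measure X}
    {f : Z → X} {F : Set (Set Z)} (hF : F.Countable) (h : ∀ S ∈ F, Small μ f S) :
    Small μ f (⋃₀ F) := by
  rcases F.eq_empty_or_nonempty with rfl | hne
  · simpa using Small.empty
  obtain ⟨g, rfl⟩ := hF.exists_eq_range hne
  rw [sUnion_range]
  exact Small.iUnion fun n => h _ ⟨n, rfl⟩

theorem exists_isolated {Z : Type*} [TopologicalSpace Z] [PolishSpace Z] {F : Set Z}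
    (hF : IsClosed F) (hc : F.Countable) (hne : F.Nonempty) :
    ∃ z ∈ F, ∃ U : Set Z, IsOpen U ∧ z ∈ U ∧ F ∩ U ⊆ {z} := by
  have : PolishSpace F := hF.polishSpace
  have : Nonempty F := hne.to_subtype
  have : Countable F := hc.to_subtype
  obtain ⟨z, hz⟩ := nonempty_interior_of_iUnion_of_closed (ι := F) (f := fun z : F => {z})
    (fun z => isClosed_singleton) (by ext z; simp)
  have hsub : interior ({z} : Set F) = {z} := by
    apply Subset.antisymm interior_subset
    intro y hy
    rw [mem_singleton_iff] at hy
    subst hy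
    obtain ⟨w, hw⟩ := hz
    have := interior_subset hw
    rw [mem_singleton_iff] at this
    rw [this] at hw; exact hw
  have ho : IsOpen ({z} : Set F) := by rw [← hsub]; exact isOpen_interior
  obtain ⟨U, hU, hUz⟩ := isOpen_induced_iff.1 ho
  refine ⟨z, z.2, U, hU, ?_, ?_⟩
  · have : z ∈ (Subtype.val ⁻¹' U : Set F) := by rw [hUz]; rfl
    exact this
  · rintro y ⟨hy, hyU⟩
    have : (⟨y, hy⟩ : F) ∈ (Subtype.val ⁻¹' U : Set F) := hyU
    rw [hUz, mem_singleton_iff] at this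
    rw [mem_singleton_iff, ← this]

theorem ln_cont {Z X : Type*} [MeasurableSpace Z] [TopologicalSpace Z] [PolishSpace Z]
    [BorelSpace Z] [MeasurableSpace X] [TopologicalSpace X] [PolishSpace X] [BorelSpace X]
    (μ : Measure X) [IsFiniteMeasure μ]
    {f : Z → X} (hf : Continuous f) (hc : ∀ x, (f ⁻¹' {x}).Countable) :
    Small μ f univ := by
  obtain ⟨bs, hbc, hbe, hbb⟩ := TopologicalSpace.exists_countable_basis Z
  rcases bs.eq_empty_or_nonempty with hbse | hbne
  · have : IsEmpty Z := by
      refine ⟨fun z => ?_⟩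
      obtain ⟨u, hu, -⟩ := hbb.exists_subset_of_mem_open (mem_univ z) isOpen_univ
      rw [hbse] at hu; exact hu
    have : (univ : Set Z) = ∅ := by ext z; exact this.elim z
    rw [this]; exact Small.empty
  obtain ⟨b, rfl⟩ := hbc.exists_eq_range hbne
  have hbo : ∀ s, IsOpen (b s) := fun s => hbb.isOpen ⟨s, rfl⟩
  have hbas : ∀ (z : Z) (U : Set Z), IsOpen U → z ∈ U → ∃ s, z ∈ b s ∧ b s ⊆ U := by
    intro z U hU hz
    obtain ⟨_, ⟨s, rfl⟩, h1, h2⟩ := hbb.exists_subset_of_mem_open hz hU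
    exact ⟨s, h1, h2⟩
  have hfm : Measurable f := hf.measurable
  have hex := fun s : ℕ => exhaust μ (fun B => Small μ f (b s ∩ f ⁻¹' B))
  choose F hFc hFd hFP hFmax using hex
  let B : ℕ → Set X := fun s => ⋃₀ F s
  have hBm : ∀ s, MeasurableSet (B s) := fun s =>
    MeasurableSet.sUnion (hFc s) fun S hS => (hFP s S hS).1
  have hBsmall : ∀ s, Small μ f (b s ∩ f ⁻¹' B s) := by
    intro s
    have : b s ∩ f ⁻¹' B s = ⋃₀ ((fun S => b s ∩ f ⁻¹' S) '' F s) := by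
      ext z
      simp only [B, mem_inter_iff, mem_preimage, mem_sUnion, exists_mem_image]
      constructor
      · rintro ⟨h1, S, hS, h2⟩; exact ⟨S, hS, h1, h2⟩
      · rintro ⟨S, hS, h1, h2⟩; exact ⟨h1, S, hS, h2⟩
    rw [this]
    refine Small.sUnion ((hFc s).image _) ?_
    rintro _ ⟨S, hS, rfl⟩
    exact (hFP s S hS).2
  let O : Set Z := ⋃ s, (b s ∩ f ⁻¹' B s)
  have hOsmall : Small μ f O := Small.iUnion hBsmall
  have hOm : MeasurableSet O := MeasurableSet.iUnion fun s =>
    (hbo s).measurableSet.inter (hfm (hBm s))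
  -- the null set of points with an isolated point
  let V : ℕ → Set X := fun s => {x | ∃ z ∈ Oᶜ ∩ b s, f z = x ∧ ∀ z' ∈ Oᶜ ∩ b s, f z' = x → z' = z}
  have hVnull : ∀ s, μ (V s) = 0 := by
    intro s
    let two : Set X := ⋃ p : {p : ℕ × ℕ // Disjoint (b p.1) (b p.2)},
      (f '' ((Oᶜ ∩ b s) ∩ b p.1.1) ∩ f '' ((Oᶜ ∩ b s) ∩ b p.1.2))
    have hVeq : V s = f '' (Oᶜ ∩ b s) \ two := by
      ext x
      constructor
      · rintro ⟨z, hz, rfl, hu⟩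
        refine ⟨⟨z, hz, rfl⟩, ?_⟩
        intro h
        obtain ⟨⟨⟨p, q⟩, hpq⟩, ⟨z1, ⟨hz1, hz1p⟩, e1⟩, ⟨z2, ⟨hz2, hz2p⟩, e2⟩⟩ := mem_iUnion.1 h
        have h1 := hu z1 hz1 e1
        have h2 := hu z2 hz2 e2
        subst h1
        subst h2
        exact Set.disjoint_left.1 hpq hz1p hz2p
      · rintro ⟨⟨z, hz, rfl⟩, hn⟩
        refine ⟨z, hz, rfl, ?_⟩
        intro z' hz' he
        by_contra hne
        obtain ⟨U, U', hU, hU', hzU, hzU', hd⟩ := t2_separation hne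
        obtain ⟨p, hp1, hp2⟩ := hbas z' U hU hzU
        obtain ⟨q, hq1, hq2⟩ := hbas z U' hU' hzU'
        apply hn
        exact mem_iUnion.2 ⟨⟨(p, q), hd.mono hp2 hq2⟩, ⟨z', ⟨hz', hp1⟩, he⟩, ⟨z, ⟨hz, hq1⟩, rfl⟩⟩
    have hOb : MeasurableSet (Oᶜ ∩ b s) := hOm.compl.inter (hbo s).measurableSet
    have hVm : NullMeasurableSet (V s) μ := by
      rw [hVeq]
      refine (nullMeas_image μ hfm hOb).diff ?_
      refine NullMeasurableSet.iUnion fun p => ?_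
      exact (nullMeas_image μ hfm (hOb.inter (hbo _).measurableSet)).inter
        (nullMeas_image μ hfm (hOb.inter (hbo _).measurableSet))
    obtain ⟨T, hTV, hTm, hTe⟩ := hVm.exists_measurable_subset_ae_eq
    rw [← measure_congr hTe]
    apply hFmax s T hTm
    · have : Small μ f ((Oᶜ ∩ b s) ∩ f ⁻¹' T) := by
        refine Small.of_injOn (hOb.inter (hfm hTm)) ?_
        rintro z1 ⟨hz1, hz1T⟩ z2 ⟨hz2, hz2T⟩ he
        obtain ⟨z, hz, h1, h2⟩ := hTV hz1T
        rw [h2 z1 hz1 rfl, h2 z2 hz2 he.symm]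
      refine (this.union hOsmall).mono ?_
      rintro z ⟨hz, hzT⟩
      by_cases hO : z ∈ O
      · exact Or.inr hO
      · exact Or.inl ⟨⟨hO, hz⟩, hzT⟩
    · rw [Set.disjoint_left]
      intro x hxT hxB
      obtain ⟨z, ⟨hzO, hzs⟩, rfl, -⟩ := hTV hxT
      exact hzO (mem_iUnion.2 ⟨s, hzs, hxB⟩)
  have hsub : f '' Oᶜ ⊆ ⋃ s, V s := by
    rintro _ ⟨z0, hz0, rfl⟩
    set x := f z0
    have hcl : IsClosed (f ⁻¹' {x} ∩ Oᶜ) := by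
      have : f ⁻¹' {x} ∩ Oᶜ = f ⁻¹' {x} ∩ (⋃ s : {s // x ∈ B s}, b s)ᶜ := by
        ext z
        simp only [O, mem_inter_iff, mem_preimage, mem_singleton_iff, mem_compl_iff, mem_iUnion,
          Subtype.exists, not_exists, not_and, exists_prop]
        constructor
        · rintro ⟨h1, h2⟩
          exact ⟨h1, fun s hs hz => h2 s hz (by rw [h1]; exact hs)⟩
        · rintro ⟨h1, h2⟩
          exact ⟨h1, fun s hz hs => h2 s (by rw [← h1]; exact hs) hz⟩
      rw [this]
      exact (isClosed_singleton.preimage hf).inter (isOpen_iUnion fun s => hbo _).isClosed_compl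
    obtain ⟨z, hz, U, hU, hzU, hs⟩ := exists_isolated hcl ((hc x).mono inter_subset_left)
      ⟨z0, rfl, hz0⟩
    obtain ⟨s, hs1, hs2⟩ := hbas z U hU hzU
    refine mem_iUnion.2 ⟨s, z, ⟨hz.2, hs1⟩, hz.1, ?_⟩
    rintro z' ⟨h1, h2⟩ h3
    exact hs ⟨⟨h3, h1⟩, hs2 h2⟩
  obtain ⟨C, h1, h2, h3⟩ := hOsmall
  refine ⟨C, h1, h2, ?_⟩
  refine measure_mono_null ?_ (measure_union_null h3 (measure_mono_null hsub (measure_iUnion_null hVnull)))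
  rintro _ ⟨z, ⟨-, hz⟩, rfl⟩
  by_cases hO : z ∈ O
  · exact Or.inl ⟨z, ⟨hO, hz⟩, rfl⟩
  · exact Or.inr ⟨z, hO, rfl⟩

theorem ln_ae {Z X : Type*} [MeasurableSpace Z] [StandardBorelSpace Z]
    [MeasurableSpace X] [StandardBorelSpace X] (μ : Measure X) [IsFiniteMeasure μ]
    {f : Z → X} (hf : Measurable f) (hc : ∀ x, (f ⁻¹' {x}).Countable) :
    Small μ f univ := by
  let := upgradeStandardBorel X
  let uZ := upgradeStandardBorel Z
  obtain ⟨t', hle, hcont, hpol⟩ := hf.exists_continuous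
  have hB : @BorelSpace Z t' _ := by
    refine @BorelSpace.mk Z t' _ ?_
    rw [borel_eq_borel_of_le hpol uZ.toPolishSpace hle]
    exact uZ.toBorelSpace.measurable_eq
  exact @ln_cont Z X _ t' hpol hB _ _ _ _ μ _ f hcont hc

end ESl

namespace ESl

/-- Borel partial injections with graph in `E` -/
structure PInj {X : Type*} [MeasurableSpace X] (E : Set (X × X)) (A : Set X) (f : X → X) : Prop where
  mf : Measurable f
  mA : MeasurableSet A
  inj : InjOn f A
  gr : ∀ x ∈ A, (x, f x) ∈ E

section
variable {X : Type*} [MeasurableSpace X] [StandardBorelSpace X] {E : Set (X × X)}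

theorem PInj.mono {A A' : Set X} {f : X → X} (h : PInj E A f) (hA' : MeasurableSet A')
    (hs : A' ⊆ A) : PInj E A' f :=
  ⟨h.mf, hA', h.inj.mono hs, fun x hx => h.gr x (hs hx)⟩

theorem PInj.image {A : Set X} {f : X → X} (h : PInj E A f) : MeasurableSet (f '' A) :=
  h.mA.image_of_measurable_injOn h.mf h.inj

theorem PInj.exists_inv {A : Set X} {f : X → X} (h : PInj E A f) :
    ∃ g : X → X, Measurable g ∧ ∀ x ∈ A, g (f x) = x := by
  have : StandardBorelSpace A := h.mA.standardBorel
  have hm : Measurable fun a : A => f a := h.mf.comp measurable_subtype_coe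
  have hi : Function.Injective fun a : A => f a := fun a b hab => Subtype.ext (h.inj a.2 b.2 hab)
  obtain ⟨g, hg, hgf⟩ := (hm.measurableEmbedding hi).exists_measurable_extend
    (g := fun a : A => (a : X)) measurable_subtype_coe (fun x => ⟨x⟩)
  exact ⟨g, hg, fun x hx => congrFun hgf ⟨x, hx⟩⟩

theorem exists_fun {D : Set (X × X)} (hD : MeasurableSet D) (hi : InjOn Prod.fst D) :
    ∃ g : X → X, Measurable g ∧ ∀ p ∈ D, g p.1 = p.2 := by
  have : StandardBorelSpace D := hD.standardBorel
  have hm : Measurable fun a : D => (a : X × X).1 := measurable_fst.comp measurable_subtype_coe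
  have hi : Function.Injective fun a : D => (a : X × X).1 :=
    fun a b hab => Subtype.ext (hi a.2 b.2 hab)
  obtain ⟨g, hg, hgf⟩ := (hm.measurableEmbedding hi).exists_measurable_extend
    (g := fun a : D => (a : X × X).2) (measurable_snd.comp measurable_subtype_coe) (fun x => ⟨x⟩)
  exact ⟨g, hg, fun x hx => congrFun hgf ⟨x, hx⟩⟩

theorem meas_graph {A : Set X} {f : X → X} (hf : Measurable f) (hA : MeasurableSet A) :
    MeasurableSet {p : X × X | p.1 ∈ A ∧ p.2 = f p.1} :=
  (measurable_fst hA).inter (measurableSet_eq_fun measurable_snd (hf.comp measurable_fst))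

theorem mcp1 {μ : Measure X} (h : MCP μ E) {A N : Set X} {f : X → X} (hf : Measurable f)
    (hA : MeasurableSet A) (hE : ∀ x ∈ A, (x, f x) ∈ E) (hN : μ N = 0) (hAN : ∀ x ∈ A, f x ∈ N) :
    μ A = 0 := by
  let S : Set (X × X) := {p | p.1 ∈ A ∧ p.2 = f p.1}
  have hS : S ⊆ E := by
    rintro ⟨x, y⟩ ⟨h1, h2⟩
    have h2 : y = f x := h2
    subst h2; exact hE x h1
  have h1 : nuR μ S = 0 := by
    unfold nuR lintR
    rw [← lintegral_zero (μ := μ)]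
    apply lintegral_congr_ae
    have : ∀ᵐ x ∂μ, x ∉ N := measure_eq_zero_iff_ae_notMem.1 hN
    filter_upwards [this] with x hx
    have : IsEmpty {y : X // (y, x) ∈ S} := by
      refine ⟨?_⟩
      rintro ⟨y, h1, h2⟩
      have h2 : x = f y := h2
      exact hx (h2 ▸ hAN y h1)
    simp
  have h2 := (h S hS (meas_graph hf hA)).2 h1
  have h3 : μ A ≤ nuL μ S := by
    rw [← lintegral_indicator_one hA]
    unfold nuL lintL
    apply lintegral_mono
    intro x
    by_cases hx : x ∈ A
    · simp only [indicator_of_mem hx, Pi.one_apply]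
      exact ENNReal.le_tsum (f := fun _ : {y : X // (x, y) ∈ S} => (1 : ℝ≥0∞)) ⟨f x, hx, rfl⟩
    · simp [indicator_of_notMem hx]
  exact le_antisymm (h3.trans h2.le) bot_le

theorem mcp2 {μ : Measure X} (h : MCP μ E) {A : Set X} {f : X → X} (hP : PInj E A f)
    (hA : μ A = 0) : μ (f '' A) = 0 := by
  let S : Set (X × X) := {p | p.1 ∈ A ∧ p.2 = f p.1}
  have hS : S ⊆ E := by
    rintro ⟨x, y⟩ ⟨h1, h2⟩
    have h2 : y = f x := h2
    subst h2; exact hP.gr x h1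
  have h1 : nuL μ S = 0 := by
    unfold nuL lintL
    rw [← lintegral_zero (μ := μ)]
    apply lintegral_congr_ae
    have : ∀ᵐ x ∂μ, x ∉ A := measure_eq_zero_iff_ae_notMem.1 hA
    filter_upwards [this] with x hx
    have : IsEmpty {y : X // (x, y) ∈ S} := ⟨fun ⟨y, h1, h2⟩ => hx h1⟩
    simp
  have h2 := (h S hS (meas_graph hP.mf hP.mA)).1 h1
  have h3 : μ (f '' A) ≤ nuR μ S := by
    rw [← lintegral_indicator_one hP.image]
    unfold nuR lintR
    apply lintegral_mono
    intro x
    by_cases hx : x ∈ f '' A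
    · simp only [indicator_of_mem hx, Pi.one_apply]
      obtain ⟨a, ha, rfl⟩ := hx
      exact ENNReal.le_tsum (f := fun _ : {y : X // (y, f a) ∈ S} => (1 : ℝ≥0∞)) ⟨a, ha, rfl⟩
    · simp [indicator_of_notMem hx]
  exact le_antisymm (h3.trans h2.le) bot_le

/-- a generating family of partial injections on a conull invariant set -/
structure GenD (μ : Measure X) (E : Set (X × X)) (Y : Set X) (A : ℕ → Set X) (f : ℕ → X → X) :
    Prop where
  mY : MeasurableSet Y
  nY : μ Yᶜ = 0
  inv : ∀ x ∈ Y, ∀ y, (x, y) ∈ E → y ∈ Y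
  pinj : ∀ n, PInj E (A n) (f n)
  sub : ∀ n, A n ⊆ Y
  cov : ∀ x ∈ Y, ∀ y, (x, y) ∈ E → ∃ n, x ∈ A n ∧ f n x = y

theorem gen (μ : Measure X) [SigmaFinite μ] (hE : IsCBER E) (hmcp : MCP μ E) :
    ∃ Y A f, GenD μ E Y A f := by
  obtain ⟨m, hm, hm1, hm2⟩ := exists_isFiniteMeasure_absolutelyContinuous μ
  obtain ⟨hEm, heq, hcount⟩ := hE
  have : StandardBorelSpace E := hEm.standardBorel
  have hfst : Measurable fun e : E => (e : X × X).1 := measurable_fst.comp measurable_subtype_coe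
  obtain ⟨C, hC, hCi, hCn⟩ := ln_ae m hfst (by
    intro x
    refine ((hcount x).image fun y => (x, y)).preimage_of_injOn
      (f := fun e : E => (e : X × X)) Subtype.val_injective.injOn |>.mono ?_
    rintro ⟨⟨a, b⟩, he⟩ (rfl : a = x)
    exact ⟨b, he, rfl⟩)
  set N0 : Set X := (fun e : E => (e : X × X).1) '' (univ \ ⋃ n, C n)
  let N := toMeasurable μ N0
  have hN : μ N = 0 := by rw [measure_toMeasurable]; exact hm1 hCn
  have hNm : MeasurableSet N := measurableSet_toMeasurable _ _
  let D : ℕ → Set (X × X) := fun n => Subtype.val '' (C n)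
  have hDm : ∀ n, MeasurableSet (D n) := fun n =>
    (MeasurableEmbedding.subtype_coe hEm).measurableSet_image.2 (hC n)
  have hDE : ∀ n, D n ⊆ E := by rintro n _ ⟨e, he, rfl⟩; exact e.2
  have hDi : ∀ n, InjOn Prod.fst (D n) := by
    rintro n _ ⟨e, he, rfl⟩ _ ⟨e', he', rfl⟩ h
    rw [hCi n he he' h]
  have hDc : ∀ x ∉ N, ∀ y, (x, y) ∈ E → ∃ n, (x, y) ∈ D n := by
    intro x hx y hxy
    by_contra hcon
    push Not at hcon
    apply hx
    apply subset_toMeasurable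
    refine ⟨⟨(x, y), hxy⟩, ⟨trivial, ?_⟩, rfl⟩
    intro h
    obtain ⟨n, hn⟩ := mem_iUnion.1 h
    exact hcon n ⟨_, hn, rfl⟩
  choose g hg hgD using fun n => exists_fun (hDm n) (hDi n)
  let dom : ℕ → Set X := fun n => Prod.fst '' D n
  have hdom : ∀ n, MeasurableSet (dom n) := fun n =>
    (hDm n).image_of_measurable_injOn measurable_fst (hDi n)
  have hgE : ∀ n, ∀ x ∈ dom n, (x, g n x) ∈ D n := by
    rintro n _ ⟨⟨x, y⟩, hp, rfl⟩
    rw [hgD n _ hp]; exact hp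
  let Q : ℕ → Set X := fun n => dom n ∩ g n ⁻¹' N
  have hQm : ∀ n, MeasurableSet (Q n) := fun n => (hdom n).inter (hg n hNm)
  have hQn : ∀ n, μ (Q n) = 0 := fun n =>
    mcp1 hmcp (hg n) (hQm n) (fun x hx => hDE n (hgE n x hx.1)) hN (fun x hx => hx.2)
  let Y : Set X := (N ∪ ⋃ n, Q n)ᶜ
  have hYm : MeasurableSet Y := (hNm.union (MeasurableSet.iUnion hQm)).compl
  have hYN : ∀ x ∈ Y, x ∉ N := fun x hx h => hx (Or.inl h)
  have hYE : ∀ x ∈ Y, ∀ y, (x, y) ∈ E → y ∉ N := by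
    intro x hx y hxy hy
    obtain ⟨n, hn⟩ := hDc x (hYN x hx) y hxy
    apply hx
    refine Or.inr (mem_iUnion.2 ⟨n, ⟨_, hn, rfl⟩, ?_⟩)
    show g n x ∈ N
    rw [hgD n _ hn]; exact hy
  have hinv : ∀ x ∈ Y, ∀ y, (x, y) ∈ E → y ∈ Y := by
    intro x hx y hxy h
    rcases h with h | h
    · exact hYE x hx y hxy h
    · obtain ⟨n, h1, h2⟩ := mem_iUnion.1 h
      exact hYE x hx _ (heq.trans hxy (hDE n (hgE n y h1))) h2
  let A : ℕ → Set X := fun k => Y ∩ (dom k.unpair.1 ∩ {x | g k.unpair.1 x ∈ dom k.unpair.2 ∧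
    g k.unpair.2 (g k.unpair.1 x) = x})
  have hcov : ∀ x ∈ Y, ∀ y, (x, y) ∈ E → ∃ n, x ∈ A n ∧ g n.unpair.1 x = y := by
    intro x hx y hxy
    obtain ⟨n, hn⟩ := hDc x (hYN x hx) y hxy
    obtain ⟨k, hk⟩ := hDc y (hYE x hx y hxy) x (heq.symm hxy)
    refine ⟨Nat.pair n k, ?_⟩
    have h1 : g n x = y := hgD n _ hn
    have h2 : g k y = x := hgD k _ hk
    simp only [A, Nat.unpair_pair]
    refine ⟨⟨hx, ⟨_, hn, rfl⟩, ?_, ?_⟩, h1⟩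
    · rw [h1]; exact ⟨_, hk, rfl⟩
    · rw [h1, h2]
  refine ⟨Y, A, fun k => g k.unpair.1, hYm, ?_, hinv, ?_, fun n => inter_subset_left, hcov⟩
  · rw [compl_compl]
    exact measure_union_null hN (measure_iUnion_null hQn)
  · intro n
    refine ⟨hg _, ?_, ?_, ?_⟩
    · refine hYm.inter ((hdom _).inter ?_)
      exact (hg _ (hdom _)).inter (measurableSet_eq_fun ((hg _).comp (hg _)) measurable_id)
    · rintro x ⟨-, -, -, h1⟩ x' ⟨-, -, -, h2⟩ he
      rw [← h1, ← h2]
      exact congrArg _ he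
    · rintro x ⟨-, hx, -⟩
      exact hDE _ (hgE _ x hx)

theorem GenD.restrict {μ : Measure X} {Y Y' : Set X} {A : ℕ → Set X} {f : ℕ → X → X}
    (h : GenD μ E Y A f) (hs : Y' ⊆ Y) (hm : MeasurableSet Y') (hn : μ Y'ᶜ = 0)
    (hinv : ∀ x ∈ Y', ∀ y, (x, y) ∈ E → y ∈ Y') : GenD μ E Y' (fun n => A n ∩ Y') f where
  mY := hm
  nY := hn
  inv := hinv
  pinj n := (h.pinj n).mono ((h.pinj n).mA.inter hm) inter_subset_left
  sub n := inter_subset_right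
  cov x hx y hxy := by
    obtain ⟨n, h1, h2⟩ := h.cov x (hs hx) y hxy
    exact ⟨n, ⟨h1, hx⟩, h2⟩

theorem GenD.shrink {μ : Measure X} {Y : Set X} {A : ℕ → Set X} {f : ℕ → X → X}
    (h : GenD μ E Y A f) (hmcp : MCP μ E) (heq : Equivalence fun x y => (x, y) ∈ E)
    {N : Set X} (hN : μ N = 0) :
    ∃ Y' ⊆ Y, MeasurableSet Y' ∧ μ Y'ᶜ = 0 ∧ (∀ x ∈ Y', ∀ y, (x, y) ∈ E → y ∈ Y') ∧
      Disjoint Y' N := by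
  let M := toMeasurable μ N
  have hM : μ M = 0 := by rw [measure_toMeasurable]; exact hN
  have hMm : MeasurableSet M := measurableSet_toMeasurable _ _
  let Q : ℕ → Set X := fun n => A n ∩ f n ⁻¹' M
  have hQm : ∀ n, MeasurableSet (Q n) := fun n => (h.pinj n).mA.inter ((h.pinj n).mf hMm)
  have hQn : ∀ n, μ (Q n) = 0 := fun n =>
    mcp1 hmcp (h.pinj n).mf (hQm n) (fun x hx => (h.pinj n).gr x hx.1) hM (fun x hx => hx.2)
  have hmem : ∀ x ∈ Y \ ⋃ n, Q n, ∀ y, (x, y) ∈ E → y ∉ M := by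
    rintro x ⟨hx, hx'⟩ y hxy hy
    obtain ⟨n, h1, h2⟩ := h.cov x hx y hxy
    exact hx' (mem_iUnion.2 ⟨n, h1, by show f n x ∈ M; rw [h2]; exact hy⟩)
  refine ⟨Y \ ⋃ n, Q n, sdiff_subset, h.mY.diff (MeasurableSet.iUnion hQm), ?_, ?_, ?_⟩
  · refine measure_mono_null ?_ (measure_union_null h.nY (measure_iUnion_null hQn))
    intro x hx
    by_cases hxY : x ∈ Y
    · right; by_contra h'; exact hx ⟨hxY, h'⟩
    · exact Or.inl hxY
  · intro x hx y hxy
    refine ⟨h.inv x hx.1 y hxy, ?_⟩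
    intro h'
    obtain ⟨n, h1, h2⟩ := mem_iUnion.1 h'
    exact hmem x hx _ (heq.trans hxy ((h.pinj n).gr y h1)) h2
  · rw [Set.disjoint_left]
    intro x hx hxN
    exact hmem x hx x (heq.refl x) (subset_toMeasurable _ _ hxN)

end
end ESl

namespace ESl

/-- working context for compression -/
structure QI {X : Type*} [MeasurableSpace X] [StandardBorelSpace X] (m : Measure X)
    (E : Set (X × X)) (Y : Set X) (A : ℕ → Set X) (f : ℕ → X → X) : Prop where
  heq : Equivalence fun x y => (x, y) ∈ E
  nul : ∀ B g, PInj E B g → (m B = 0 ↔ m (g '' B) = 0)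
  gen : GenD m E Y A f
  erg : ErgodicRel m E
  III : IsTypeIII m E

section
variable {X : Type*} [MeasurableSpace X] [StandardBorelSpace X] {E : Set (X × X)}

theorem PInj.inv {A : Set X} {f g : X → X} (heq : Equivalence fun x y => (x, y) ∈ E)
    (h : PInj E A f) (hg : Measurable g) (hgf : ∀ x ∈ A, g (f x) = x) : PInj E (f '' A) g where
  mf := hg
  mA := h.image
  inj := by
    rintro _ ⟨a, ha, rfl⟩ _ ⟨b, hb, rfl⟩ hab
    rw [hgf a ha, hgf b hb] at hab
    rw [hab]
  gr := by
    rintro _ ⟨a, ha, rfl⟩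
    rw [hgf a ha]
    exact heq.symm (h.gr a ha)

theorem PInj.comp {A B : Set X} {f g : X → X} (heq : Equivalence fun x y => (x, y) ∈ E)
    (h : PInj E A f) (h' : PInj E B g) (hs : ∀ x ∈ A, f x ∈ B) : PInj E A (fun x => g (f x)) where
  mf := h'.mf.comp h.mf
  mA := h.mA
  inj := fun a ha b hb hab => h.inj ha hb (h'.inj (hs a ha) (hs b hb) hab)
  gr := fun a ha => heq.trans (h.gr a ha) (h'.gr _ (hs a ha))

variable {m : Measure X} {Y : Set X} {A : ℕ → Set X} {f : ℕ → X → X}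

/-- supremum measure -/
def supM (m : Measure X) (A : ℕ → Set X) (f : ℕ → X → X) (B : Set X) : Measure X :=
  ⨆ n, Measure.map (f n) (m.restrict (A n ∩ B))

theorem supM_le_of {q : QI m E Y A f} {B : Set X} (hB : MeasurableSet B) {l : Measure X}
    (h : ∀ n S, MeasurableSet S → m (f n ⁻¹' S ∩ (A n ∩ B)) ≤ l S) : supM m A f B ≤ l := by
  refine iSup_le fun n => Measure.le_iff.2 fun S hS => ?_
  rw [Measure.map_apply (q.gen.pinj n).mf hS, Measure.restrict_apply ((q.gen.pinj n).mf hS)]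
  exact h n S hS

theorem supM_ge0 {q : QI m E Y A f} {B : Set X} {n : ℕ} {S : Set X} (hS : MeasurableSet S) :
    m (f n ⁻¹' S ∩ (A n ∩ B)) ≤ supM m A f B S := by
  have := (le_iSup (fun n => Measure.map (f n) (m.restrict (A n ∩ B))) n) S
  rw [Measure.map_apply (q.gen.pinj n).mf hS, Measure.restrict_apply ((q.gen.pinj n).mf hS)] at this
  exact this

theorem supM_ge {q : QI m E Y A f} {B : Set X} {C : Set X} {g : X → X}
    (hC : PInj E C g) (hCB : C ⊆ B) (hCY : C ⊆ Y) {S : Set X} (hS : MeasurableSet S) :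
    m (g ⁻¹' S ∩ C) ≤ supM m A f B S := by
  let En : ℕ → Set X := fun n => C ∩ (A n ∩ {x | f n x = g x})
  have hEn : ∀ n, MeasurableSet (En n) := fun n =>
    hC.mA.inter ((q.gen.pinj n).mA.inter (measurableSet_eq_fun (q.gen.pinj n).mf hC.mf))
  let Cn := disjointed En
  have hCn : ∀ n, MeasurableSet (Cn n) := fun n => MeasurableSet.disjointed hEn n
  have hCs : ∀ n, Cn n ⊆ En n := fun n => disjointed_subset En n
  have hU : C = ⋃ n, Cn n := by
    rw [iUnion_disjointed]
    refine subset_antisymm (fun x hx => ?_) (iUnion_subset fun n => inter_subset_left)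
    obtain ⟨n, h1, h2⟩ := q.gen.cov x (hCY hx) (g x) (hC.gr x hx)
    exact mem_iUnion.2 ⟨n, hx, h1, h2⟩
  have hdis : Pairwise (Function.onFun Disjoint Cn) := disjoint_disjointed En
  let T : ℕ → Set X := fun n => g '' Cn n
  have hT : ∀ n, MeasurableSet (T n) := fun n =>
    (hC.mono (hCn n) ((hCs n).trans inter_subset_left)).image
  have hTd : Pairwise (Function.onFun Disjoint fun n => S ∩ T n) := by
    intro i j hij
    rw [Function.onFun, Set.disjoint_left]
    rintro _ ⟨-, a, ha, rfl⟩ ⟨-, b, hb, hab⟩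
    have := hC.inj (hCs _ hb).1 (hCs _ ha).1 hab
    subst this
    exact Set.disjoint_left.1 (hdis hij) ha hb
  calc m (g ⁻¹' S ∩ C) ≤ m (⋃ n, g ⁻¹' S ∩ Cn n) := by rw [← inter_iUnion, ← hU]
    _ ≤ ∑' n, m (g ⁻¹' S ∩ Cn n) := measure_iUnion_le _
    _ ≤ ∑' n, supM m A f B (S ∩ T n) := by
        refine ENNReal.tsum_le_tsum fun n => ?_
        refine le_trans (measure_mono ?_) (supM_ge0 (q := q) (n := n) (hS.inter (hT n)))
        rintro x ⟨h1, h2⟩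
        have h3 := hCs n h2
        have h4 : f n x = g x := h3.2.2
        refine ⟨?_, h3.2.1, hCB h3.1⟩
        show f n x ∈ S ∩ T n
        rw [h4]
        exact ⟨h1, x, h2, rfl⟩
    _ = supM m A f B (⋃ n, S ∩ T n) := (measure_iUnion hTd fun n => hS.inter (hT n)).symm
    _ ≤ _ := measure_mono (iUnion_subset fun n => inter_subset_left)

theorem supM_inv1 {q : QI m E Y A f} {B : Set X} (hB : MeasurableSet B) {C : Set X} {g : X → X}
    (hC : PInj E C g) {S : Set X} (hS : MeasurableSet S) :
    supM m A f B (S ∩ g '' C) ≤ supM m A f B (g ⁻¹' S ∩ C) := by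
  obtain ⟨k, hk, hkg⟩ := hC.exists_inv
  have hk' := hC.inv q.heq hk hkg
  set M := supM m A f B with hM
  have key : M ≤ M.restrict (g '' C)ᶜ + Measure.map g (M.restrict C) := by
    refine supM_le_of (q := q) hB fun n S hS => ?_
    rw [Measure.add_apply, Measure.restrict_apply hS, Measure.map_apply hC.mf hS,
      Measure.restrict_apply (hC.mf hS)]
    have h1 : f n ⁻¹' S ∩ (A n ∩ B) ⊆ (f n ⁻¹' (S ∩ (g '' C)ᶜ) ∩ (A n ∩ B)) ∪
        ((fun x => k (f n x)) ⁻¹' (g ⁻¹' S ∩ C) ∩ (A n ∩ B ∩ f n ⁻¹' (g '' C))) := by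
      rintro x ⟨hx1, hx2⟩
      by_cases hx : f n x ∈ g '' C
      · right
        refine ⟨?_, hx2, hx⟩
        obtain ⟨c, hc, hcx⟩ := hx
        show g (k (f n x)) ∈ S ∧ k (f n x) ∈ C
        rw [← hcx, hkg c hc]
        exact ⟨by rw [hcx]; exact hx1, hc⟩
      · exact Or.inl ⟨⟨hx1, hx⟩, hx2⟩
    refine (measure_mono h1).trans ((measure_union_le _ _).trans (add_le_add ?_ ?_))
    · exact supM_ge0 (q := q) (hS.inter hC.image.compl)
    · refine supM_ge (q := q) (g := fun x => k (f n x)) ?_ ?_ ?_ ((hC.mf hS).inter hC.mA)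
      · refine PInj.comp q.heq ((q.gen.pinj n).mono ?_ ?_) hk' ?_
        · exact ((q.gen.pinj n).mA.inter hB).inter ((q.gen.pinj n).mf hC.image)
        · exact inter_subset_left.trans inter_subset_left
        · exact fun x hx => hx.2
      · exact inter_subset_left.trans inter_subset_right
      · exact (inter_subset_left.trans inter_subset_left).trans (q.gen.sub n)
  have h2 := key (S ∩ g '' C)
  have hSm := hS.inter hC.image
  rw [Measure.add_apply, Measure.restrict_apply hSm, Measure.map_apply hC.mf hSm,
      Measure.restrict_apply (hC.mf hSm)] at h2
  have h3 : S ∩ g '' C ∩ (g '' C)ᶜ = ∅ := by ext x; simp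
  rw [h3, measure_empty, zero_add] at h2
  exact h2.trans (measure_mono fun x hx => ⟨hx.1.1, hx.2⟩)

theorem supM_inv {q : QI m E Y A f} {B : Set X} (hB : MeasurableSet B) :
    InvariantUnder (supM m A f B) E := by
  intro g C h1 h2 h3 h4
  have hC : PInj E C g := ⟨h1, h2, h3, h4⟩
  obtain ⟨k, hk, hkg⟩ := hC.exists_inv
  have hk' := hC.inv q.heq hk hkg
  ext S hS
  rw [Measure.map_apply h1 hS, Measure.restrict_apply (h1 hS), Measure.restrict_apply hS]
  refine le_antisymm ?_ (supM_inv1 (q := q) hB hC hS)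
  have := supM_inv1 (q := q) hB hk' (S := g ⁻¹' S ∩ C) ((h1 hS).inter h2)
  refine (measure_mono ?_).trans (this.trans (measure_mono ?_))
  · rintro x ⟨hx1, hx2⟩
    exact ⟨⟨hx1, hx2⟩, g x, ⟨x, hx2, rfl⟩, hkg x hx2⟩
  · rintro _ ⟨hx1, x, hx2, rfl⟩
    refine ⟨?_, x, hx2, rfl⟩
    have := hx1.1
    rwa [hkg x hx2] at this

theorem s1 [IsFiniteMeasure m] (q : QI m E Y A f) {B : Set X} (hB : MeasurableSet B)
    (hB0 : m B ≠ 0) (K : ℝ≥0∞) (hK : K ≠ ∞)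
    (h : ∀ C g, PInj E C g → C ⊆ B → g '' C ⊆ B → m C ≤ K * m (g '' C)) : False := by
  have hinv := supM_inv (q := q) hB
  set M := supM m A f B with hM
  have hpi : ∀ n, PInj E (A n ∩ B) (f n) := fun n =>
    (q.gen.pinj n).mono ((q.gen.pinj n).mA.inter hB) inter_subset_left
  have hMB : M B < ∞ := by
    have key : M ≤ M.restrict Bᶜ + K • m := by
      refine supM_le_of (q := q) hB fun n S hS => ?_
      rw [Measure.add_apply, Measure.restrict_apply hS, Measure.smul_apply]
      have h1 : f n ⁻¹' S ∩ (A n ∩ B) ⊆ (f n ⁻¹' (S ∩ Bᶜ) ∩ (A n ∩ B)) ∪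
          (f n ⁻¹' (S ∩ B) ∩ (A n ∩ B)) := by
        rintro x ⟨hx1, hx2⟩
        by_cases hx : f n x ∈ B
        · exact Or.inr ⟨⟨hx1, hx⟩, hx2⟩
        · exact Or.inl ⟨⟨hx1, hx⟩, hx2⟩
      refine (measure_mono h1).trans ((measure_union_le _ _).trans (add_le_add ?_ ?_))
      · exact supM_ge0 (q := q) (hS.inter hB.compl)
      · have hs : f n '' (f n ⁻¹' (S ∩ B) ∩ (A n ∩ B)) ⊆ S ∩ B := by
          rintro _ ⟨x, hx, rfl⟩; exact hx.1
        refine (h _ (f n) ((hpi n).mono ?_ inter_subset_right) (fun x hx => hx.2.2)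
          (hs.trans inter_subset_right)).trans ?_
        · exact ((hpi n).mf (hS.inter hB)).inter (hpi n).mA
        · exact mul_le_mul_right (measure_mono (hs.trans inter_subset_left)) K
    have h2 := key B
    rw [Measure.add_apply, Measure.restrict_apply hB, Measure.smul_apply, inter_compl_self,
      measure_empty, zero_add] at h2
    exact h2.trans_lt (ENNReal.mul_lt_top hK.lt_top (measure_lt_top m B))
  have hcover : m (⋃ n, f n '' (A n ∩ B))ᶜ = 0 := by
    refine measure_mono_null ?_ (measure_union_null (q.erg B hB hB0) q.gen.nY)
    intro x hx
    by_contra hcon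
    simp only [mem_union, not_or, mem_compl_iff, not_not] at hcon
    obtain ⟨⟨y, hy, hxy⟩, hxY⟩ := hcon
    obtain ⟨n, h1, h2⟩ := q.gen.cov y (q.gen.inv x hxY y hxy) x (q.heq.symm hxy)
    exact hx (mem_iUnion.2 ⟨n, y, ⟨h1, hy⟩, h2⟩)
  have hac : M ≪ m := by
    refine Measure.AbsolutelyContinuous.mk fun S hS hS0 => ?_
    have : M ≤ Measure.sum fun n => Measure.map (f n) (m.restrict (A n ∩ B)) :=
      iSup_le fun n => Measure.le_sum _ n
    refine le_antisymm ((this S).trans ?_) bot_le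
    rw [Measure.sum_apply _ hS]
    refine le_of_eq (ENNReal.tsum_eq_zero.2 fun n => ?_)
    rw [Measure.map_apply (hpi n).mf hS, Measure.restrict_apply ((hpi n).mf hS)]
    refine (q.nul _ (f n) ((hpi n).mono (((hpi n).mf hS).inter (hpi n).mA)
      inter_subset_right)).2 (measure_mono_null ?_ hS0)
    rintro _ ⟨x, hx, rfl⟩; exact hx.1
  have hca : m ≪ M := by
    refine Measure.AbsolutelyContinuous.mk fun S hS hS0 => ?_
    have h1 : ∀ n, m (f n '' (f n ⁻¹' S ∩ (A n ∩ B))) = 0 := fun n => by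
      refine (q.nul _ (f n) ((hpi n).mono (((hpi n).mf hS).inter (hpi n).mA)
        inter_subset_right)).1 ?_
      exact le_antisymm ((supM_ge0 (q := q) hS).trans hS0.le) bot_le
    refine measure_mono_null ?_ (measure_union_null hcover (measure_iUnion_null h1))
    intro x hx
    by_cases hx' : x ∈ ⋃ n, f n '' (A n ∩ B)
    · obtain ⟨n, y, hy, rfl⟩ := mem_iUnion.1 hx'
      exact Or.inr (mem_iUnion.2 ⟨n, y, ⟨hx, hy⟩, rfl⟩)
    · exact Or.inl hx'
  have hsf : SigmaFinite M := by
    refine Measure.sigmaFinite_of_countable (S := insert (⋃ n, f n '' (A n ∩ B))ᶜ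
      (range fun n => f n '' (A n ∩ B))) ((countable_range _).insert _) ?_ ?_
    · rintro s (rfl | ⟨n, rfl⟩)
      · rw [hac hcover]; exact ENNReal.zero_lt_top
      · have := supM_inv1 (q := q) hB (hpi n) (S := univ) MeasurableSet.univ
        refine lt_of_le_of_lt ?_ hMB
        simp only [univ_inter, preimage_univ] at this
        exact this.trans (measure_mono inter_subset_right)
    · rw [sUnion_insert, sUnion_range]
      exact compl_union_self _
  exact q.III ⟨M, hsf, ⟨hac, hca⟩, hinv⟩

end
end ESl

namespace ESl

section
variable {X : Type*} [MeasurableSpace X] [StandardBorelSpace X] {E : Set (X × X)}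
variable {m : Measure X} {Y : Set X} {A : ℕ → Set X} {f : ℕ → X → X}

theorem s2 [IsFiniteMeasure m] (q : QI m E Y A f) {B : Set X} (hB : MeasurableSet B)
    (hB0 : m B ≠ 0) (K : ℝ≥0∞) (hK : K ≠ ∞) :
    ∃ C g, PInj E C g ∧ C ⊆ B ∧ g '' C ⊆ B ∧ Disjoint C (g '' C) ∧ K * m (g '' C) ≤ m C ∧
      m C ≠ 0 := by
  have h1 : ¬ ∀ C g, PInj E C g → C ⊆ B → g '' C ⊆ B → m C ≤ (K + 1) * m (g '' C) :=
    fun h => s1 q hB hB0 (K + 1) (by simp [hK]) h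
  push Not at h1
  obtain ⟨C, g, hC, hCB, hgB, hlt⟩ := h1
  have hfin : m (g '' C) ≠ ∞ := measure_ne_top _ _
  have hle : m C ≤ m (C \ g '' C) + m (g '' C) := by
    refine (measure_mono ?_).trans (measure_union_le _ _)
    intro x hx
    by_cases h : x ∈ g '' C
    · exact Or.inr h
    · exact Or.inl ⟨hx, h⟩
  have hlt2 : K * m (g '' C) < m (C \ g '' C) := by
    rw [add_mul, one_mul] at hlt
    exact (ENNReal.add_lt_add_iff_right hfin).1 (hlt.trans_le hle)
  have hsub : g '' (C \ g '' C) ⊆ g '' C := image_mono sdiff_subset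
  refine ⟨C \ g '' C, g, hC.mono (hC.mA.diff hC.image) sdiff_subset, sdiff_subset.trans hCB,
    hsub.trans hgB, ?_, ?_, ?_⟩
  · rw [Set.disjoint_left]
    intro x hx hx'
    exact hx.2 (hsub hx')
  · exact (mul_le_mul_right (measure_mono hsub) K).trans hlt2.le
  · exact (bot_le.trans_lt hlt2).ne'

theorem s3 [IsFiniteMeasure m] (q : QI m E Y A f) {B : Set X} (hB : MeasurableSet B)
    (K : ℝ≥0∞) (hK : K ≠ ∞) :
    ∃ C g, PInj E C g ∧ C ⊆ B ∧ g '' C ⊆ B ∧ Disjoint C (g '' C) ∧ K * m (g '' C) ≤ m C ∧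
      m (B \ (C ∪ g '' C)) = 0 := by
  obtain ⟨F, hFc, hFd, hF, hmax⟩ := exhaust m (fun S => S ⊆ B ∧ ∃ C g, PInj E C g ∧
    Disjoint C (g '' C) ∧ S = C ∪ g '' C ∧ K * m (g '' C) ≤ m C)
  have hFct : Countable F := hFc
  have hUm : MeasurableSet (⋃₀ F) := MeasurableSet.sUnion hFc fun S hS => (hF S hS).1
  have hrem : m (B \ ⋃₀ F) = 0 := by
    by_contra h0
    obtain ⟨C, g, hC, h1, h2, h3, h4, h5⟩ := s2 q (hB.diff hUm) h0 K hK
    have := hmax (C ∪ g '' C) (hC.mA.union hC.image)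
      ⟨(union_subset h1 h2).trans sdiff_subset, C, g, hC, h3, rfl, h4⟩
      (disjoint_sdiff_left.mono_left (union_subset h1 h2))
    exact h5 (measure_mono_null subset_union_left this)
  choose C g hC hCd hS hCK using fun S : F => (hF S S.2).2.2
  have hdisj : ∀ S T : F, S ≠ T → Disjoint (C S ∪ g S '' C S) (C T ∪ g T '' C T) := by
    intro S T hST
    rw [← hS, ← hS]
    exact hFd S.2 T.2 (fun h => hST (Subtype.ext h))
  have hSB : ∀ S : F, C S ∪ g S '' C S ⊆ B := fun S => by rw [← hS]; exact (hF S S.2).2.1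
  obtain ⟨f', hf', hff⟩ : ∃ f' : X → X, Measurable f' ∧ ∀ S : F, EqOn f' (g S) (C S) := by
    rcases isEmpty_or_nonempty F with h | h
    · exact ⟨id, measurable_id, fun S => (h.false S).elim⟩
    · refine exists_measurable_piecewise C (fun S => (hC S).mA) g (fun S => (hC S).mf) ?_
      intro S T hST x hx
      exact (Set.disjoint_left.1 (hdisj S T hST) (Or.inl hx.1) (Or.inl hx.2)).elim
  have himg : ∀ S : F, f' '' C S = g S '' C S := fun S => (hff S).image_eq
  have himU : f' '' (⋃ S, C S) = ⋃ S, g S '' C S := by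
    rw [image_iUnion]; exact iUnion_congr himg
  refine ⟨⋃ S, C S, f', ⟨hf', MeasurableSet.iUnion fun S => (hC S).mA, ?_, ?_⟩, ?_, ?_, ?_, ?_, ?_⟩
  · intro x hx y hy hxy
    obtain ⟨S, hx⟩ := mem_iUnion.1 hx
    obtain ⟨T, hy⟩ := mem_iUnion.1 hy
    by_cases hST : S = T
    · subst hST
      rw [hff S hx, hff S hy] at hxy
      exact (hC S).inj hx hy hxy
    · rw [hff S hx, hff T hy] at hxy
      exact (Set.disjoint_left.1 (hdisj S T hST) (Or.inr ⟨x, hx, rfl⟩)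
        (Or.inr ⟨y, hy, hxy.symm⟩)).elim
  · intro x hx
    obtain ⟨S, hx⟩ := mem_iUnion.1 hx
    rw [hff S hx]
    exact (hC S).gr x hx
  · exact iUnion_subset fun S => subset_union_left.trans (hSB S)
  · rw [himU]; exact iUnion_subset fun S => subset_union_right.trans (hSB S)
  · rw [himU, Set.disjoint_left]
    intro x hx hx'
    obtain ⟨S, hx⟩ := mem_iUnion.1 hx
    obtain ⟨T, hx'⟩ := mem_iUnion.1 hx'
    by_cases hST : S = T
    · subst hST
      exact Set.disjoint_left.1 (hCd S) hx hx'
    · exact (Set.disjoint_left.1 (hdisj S T hST) (Or.inl hx) (Or.inr hx')).elim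
  · rw [himU]
    calc K * m (⋃ S, g S '' C S) ≤ K * ∑' S, m (g S '' C S) :=
          mul_le_mul_right (measure_iUnion_le _) K
      _ = ∑' S, K * m (g S '' C S) := ENNReal.tsum_mul_left.symm
      _ ≤ ∑' S, m (C S) := ENNReal.tsum_le_tsum hCK
      _ = m (⋃ S, C S) := by
          refine (measure_iUnion (fun S T hST => ?_) fun S => (hC S).mA).symm
          exact (hdisj S T hST).mono subset_union_left subset_union_left
  · refine measure_mono_null ?_ hrem
    rintro x ⟨hx, hx'⟩
    refine ⟨hx, ?_⟩
    rintro ⟨S, hSF, hxS⟩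
    apply hx'
    rw [himU]
    have := hS ⟨S, hSF⟩
    dsimp only at this
    rw [this] at hxS
    rcases hxS with h | h
    · exact Or.inl (mem_iUnion.2 ⟨⟨S, hSF⟩, h⟩)
    · exact Or.inr (mem_iUnion.2 ⟨⟨S, hSF⟩, h⟩)

theorem QI.congr (q : QI m E Y A f) {l : Measure X} (h1 : l ≪ m) (h2 : m ≪ l) :
    QI l E Y A f where
  heq := q.heq
  nul B g h := ⟨fun h0 => h1 ((q.nul B g h).1 (h2 h0)), fun h0 => h1 ((q.nul B g h).2 (h2 h0))⟩
  gen := { q.gen with nY := h1 q.gen.nY }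
  erg := fun S hS h0 => h1 (q.erg S hS fun h => h0 (h1 h))
  III := fun ⟨M, hM, ⟨h3, h4⟩, h5⟩ => q.III ⟨M, hM, ⟨h3.trans h1, h2.trans h4⟩, h5⟩

theorem s3e [IsFiniteMeasure m] (q : QI m E Y A f) {l : Measure X} [IsFiniteMeasure l]
    (h1 : l ≪ m) (h2 : m ≪ l) {B : Set X} (hB : MeasurableSet B)
    (ε : ℝ≥0∞) (hε : ε ≠ 0) :
    ∃ C g, PInj E C g ∧ C ⊆ B ∧ g '' C ⊆ B ∧ Disjoint C (g '' C) ∧ l (g '' C) ≤ ε ∧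
      m (B \ (C ∪ g '' C)) = 0 := by
  have hM0 : l univ + 1 ≠ 0 := by simp
  have hM1 : l univ + 1 ≠ ∞ := by simp
  obtain ⟨C, g, h3, h4, h5, h6, h7, h8⟩ := s3 (q.congr h1 h2) hB ((l univ + 1) / ε)
    (ENNReal.div_ne_top hM1 hε)
  refine ⟨C, g, h3, h4, h5, h6, ?_, h2 h8⟩
  by_cases hεt : ε = ∞
  · rw [hεt]; exact le_top
  have h9 : (l univ + 1) / ε * l (g '' C) ≤ l univ + 1 :=
    h7.trans ((measure_mono (subset_univ _)).trans le_self_add)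
  rw [mul_comm] at h9
  have := (ENNReal.le_div_iff_mul_le (Or.inl (ENNReal.div_ne_zero.2 ⟨hM0, hεt⟩))
    (Or.inl (ENNReal.div_ne_top hM1 hε))).2 h9
  rwa [ENNReal.div_div_cancel hM0 hM1] at this

theorem s3f [IsFiniteMeasure m] (q : QI m E Y A f) {B : Set X} (hB : MeasurableSet B)
    (hB0 : m B ≠ 0) : ∃ (D : Set X) (g : ℕ → X → X), m D ≠ 0 ∧ (∀ n, PInj E D (g n)) ∧
      (∀ n, g n '' D ⊆ B) ∧ ∀ i j, i < j → Disjoint (g i '' D) (g j '' D) := by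
  obtain ⟨ε, hε, hεs⟩ := ENNReal.exists_pos_sum_of_countable' hB0 ℕ
  let St := {l : Measure X // IsFiniteMeasure l ∧ l ≪ m ∧ m ≪ l}
  have step : ∀ (l : St) (j : ℕ), ∃ (p : Set X × (X → X)), PInj E p.1 p.2 ∧ p.1 ⊆ B ∧
      p.2 '' p.1 ⊆ B ∧ Disjoint p.1 (p.2 '' p.1) ∧ l.1 (p.2 '' p.1) ≤ ε j ∧
      m (B \ (p.1 ∪ p.2 '' p.1)) = 0 := by
    rintro ⟨l, h0, h1, h2⟩ j
    obtain ⟨C, g, h⟩ := s3e q h1 h2 hB (ε j) (hε j).ne'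
    exact ⟨(C, g), h⟩
  choose p hp hpB hpB' hpd hpe hpn using step
  have hfin : ∀ l j, IsFiniteMeasure (Measure.map (p l j).2 (m.restrict (p l j).1)) := by
    intro l j; infer_instance
  have hac : ∀ l j, Measure.map (p l j).2 (m.restrict (p l j).1) ≪ m := by
    intro l j
    refine Measure.AbsolutelyContinuous.mk fun S hS hS0 => ?_
    have h := hp l j
    rw [Measure.map_apply h.mf hS, Measure.restrict_apply (h.mf hS)]
    refine (q.nul _ _ (h.mono ((h.mf hS).inter h.mA)
      inter_subset_right)).2 (measure_mono_null ?_ hS0)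
    rintro _ ⟨x, hx, rfl⟩; exact hx.1
  let L : ℕ → St := fun j => Nat.rec (motive := fun _ => St)
    ⟨m, inferInstance, Measure.AbsolutelyContinuous.rfl, Measure.AbsolutelyContinuous.rfl⟩
    (fun j l => ⟨l.1 + Measure.map (p l j).2 (m.restrict (p l j).1), by
      have := l.2.1
      have := hfin l j
      refine ⟨inferInstance, ?_, ?_⟩
      · intro S hS
        rw [Measure.add_apply, l.2.2.1 hS, hac l j hS, add_zero]
      · intro S hS
        rw [Measure.add_apply] at hS
        exact l.2.2.2 (add_eq_zero.1 hS).1⟩) j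
  let C : ℕ → Set X := fun j => (p (L j) j).1
  let g : ℕ → X → X := fun j => (p (L j) j).2
  have hL0 : (L 0).1 = m := rfl
  have hL1 : ∀ j, (L (j + 1)).1 = (L j).1 + Measure.map (g j) (m.restrict (C j)) := fun j => rfl
  have hCg : ∀ j, PInj E (C j) (g j) := fun j => hp _ _
  have hb : ∀ j S, MeasurableSet S →
      m (S ∪ ⋃ n, ⋃ (_ : n < j), g n ⁻¹' S ∩ C n) ≤ (L j).1 S := by
    intro j S hS
    induction j with
    | zero => simp [hL0]
    | succ j ih =>
      rw [hL1, Measure.add_apply, Measure.map_apply (hCg j).mf hS,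
        Measure.restrict_apply ((hCg j).mf hS)]
      refine le_trans (measure_mono ?_) ((measure_union_le _ _).trans (add_le_add_left ih _))
      rintro x (hx | hx)
      · exact Or.inl (Or.inl hx)
      · simp only [mem_iUnion] at hx
        obtain ⟨n, hn, hx⟩ := hx
        rcases Nat.lt_succ_iff_lt_or_eq.1 hn with h | h
        · exact Or.inl (Or.inr (by simp only [mem_iUnion]; exact ⟨n, h, hx⟩))
        · subst h; exact Or.inr hx
  let R : ℕ → Set X := fun j => g j '' C j
  have hR : ∀ j, MeasurableSet (R j) := fun j => (hCg j).image
  let bad : ℕ → Set X := fun j => R j ∪ ⋃ n, ⋃ (_ : n < j), g n ⁻¹' (R j) ∩ C n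
  have hbad : ∀ j, MeasurableSet (bad j) := fun j => (hR j).union
    (MeasurableSet.iUnion fun n => MeasurableSet.iUnion fun _ =>
      ((hCg n).mf (hR j)).inter (hCg n).mA)
  let nl : ℕ → Set X := fun j => B \ (C j ∪ R j)
  have hnl : ∀ j, MeasurableSet (nl j) := fun j => hB.diff ((hCg j).mA.union (hR j))
  have hlt : m ((⋃ j, bad j) ∪ ⋃ j, nl j) < m B := by
    refine lt_of_le_of_lt ?_ hεs
    refine (measure_union_le _ _).trans ?_
    rw [measure_iUnion_null fun j => hpn (L j) j, add_zero]
    refine (measure_iUnion_le _).trans (ENNReal.tsum_le_tsum fun j => ?_)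
    exact (hb j _ (hR j)).trans (hpe (L j) j)
  let D := B \ ((⋃ j, bad j) ∪ ⋃ j, nl j)
  have hDC : ∀ j, D ⊆ C j := by
    rintro j x ⟨hx, hx'⟩
    by_contra h
    apply hx'
    by_cases h2 : x ∈ R j
    · exact Or.inl (mem_iUnion.2 ⟨j, Or.inl h2⟩)
    · exact Or.inr (mem_iUnion.2 ⟨j, hx, fun h3 => h3.elim h h2⟩)
  have hDm : MeasurableSet D :=
    hB.diff ((MeasurableSet.iUnion hbad).union (MeasurableSet.iUnion hnl))
  refine ⟨D, g, ?_, fun n => (hCg n).mono hDm (hDC n), fun n => ?_, ?_⟩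
  · intro h0
    have : m B ≤ m D + m ((⋃ j, bad j) ∪ ⋃ j, nl j) := by
      refine (measure_mono ?_).trans (measure_union_le _ _)
      intro x hx
      by_cases h : x ∈ (⋃ j, bad j) ∪ ⋃ j, nl j
      · exact Or.inr h
      · exact Or.inl ⟨hx, h⟩
    rw [h0, zero_add] at this
    exact absurd hlt (not_lt.2 this)
  · exact (image_mono (hDC n)).trans (hpB' (L n) n)
  · intro i j hij
    rw [Set.disjoint_left]
    rintro _ ⟨x, hx, rfl⟩ ⟨y, hy, hxy⟩
    apply hx.2
    refine Or.inl (mem_iUnion.2 ⟨j, Or.inr ?_⟩)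
    simp only [mem_iUnion]
    exact ⟨i, hij, ⟨y, hDC j hy, hxy⟩, hDC i hx⟩

theorem compress0 [IsFiniteMeasure m] (q : QI m E Y A f) {B : Set X} (hB : MeasurableSet B)
    (hB0 : m B ≠ 0) : ∃ (Z : Set X) (θ : ℕ → X → X), MeasurableSet Z ∧ m Zᶜ = 0 ∧
      (∀ n, Measurable (θ n)) ∧ (∀ x ∈ Z, ∀ n, θ n x ∈ B ∧ (x, θ n x) ∈ E) ∧
      ∀ x ∈ Z, ∀ x' ∈ Z, ∀ n n', θ n x = θ n' x' → x = x' ∧ n = n' := by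
  obtain ⟨D, g, hD0, hg, hgB, hgd⟩ := s3f q hB hB0
  have hDm : MeasurableSet D := (hg 0).mA
  let Q : ℕ → Set X := fun k => A k ∩ f k ⁻¹' D
  have hQ : ∀ k, MeasurableSet (Q k) := fun k => (q.gen.pinj k).mA.inter ((q.gen.pinj k).mf hDm)
  let T := disjointed Q
  have hT : ∀ k, MeasurableSet (T k) := fun k => MeasurableSet.disjointed hQ k
  have hTQ : ∀ k, T k ⊆ Q k := fun k => disjointed_subset Q k
  have hTd : Pairwise (Function.onFun Disjoint T) := disjoint_disjointed Q
  have : ∀ n, ∃ t : X → X, Measurable t ∧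
      ∀ k, EqOn t (fun x => g (Nat.pair k n) (f k x)) (T k) := fun n => by
    refine exists_measurable_piecewise T hT _ (fun k => (hg _).mf.comp (q.gen.pinj k).mf) ?_
    intro i j hij x hx
    exact (Set.disjoint_left.1 (hTd hij) hx.1 hx.2).elim
  choose θ hθ hθT using this
  have hgg : ∀ i j, ∀ x ∈ D, ∀ y ∈ D, g i x = g j y → i = j ∧ x = y := by
    intro i j x hx y hy hxy
    rcases lt_trichotomy i j with h | h | h
    · exact (Set.disjoint_left.1 (hgd i j h) ⟨x, hx, rfl⟩ ⟨y, hy, hxy.symm⟩).elim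
    · subst h; exact ⟨rfl, (hg i).inj hx hy hxy⟩
    · exact (Set.disjoint_left.1 (hgd j i h) ⟨y, hy, rfl⟩ ⟨x, hx, hxy⟩).elim
  refine ⟨⋃ k, T k, θ, MeasurableSet.iUnion hT, ?_, hθ, ?_, ?_⟩
  · rw [iUnion_disjointed]
    refine measure_mono_null ?_ (measure_union_null (q.erg D hDm hD0) q.gen.nY)
    intro x hx
    by_contra hcon
    simp only [mem_union, not_or, mem_compl_iff, not_not] at hcon
    obtain ⟨⟨y, hy, hxy⟩, hxY⟩ := hcon
    obtain ⟨n, h1, h2⟩ := q.gen.cov x hxY y hxy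
    exact hx (mem_iUnion.2 ⟨n, h1, by show f n x ∈ D; rw [h2]; exact hy⟩)
  · intro x hx n
    obtain ⟨k, hk⟩ := mem_iUnion.1 hx
    rw [hθT n k hk]
    have h1 := hTQ k hk
    exact ⟨hgB _ ⟨_, h1.2, rfl⟩, q.heq.trans ((q.gen.pinj k).gr x h1.1) ((hg _).gr _ h1.2)⟩
  · intro x hx x' hx' n n' h
    obtain ⟨k, hk⟩ := mem_iUnion.1 hx
    obtain ⟨k', hk'⟩ := mem_iUnion.1 hx'
    rw [hθT n k hk, hθT n' k' hk'] at h
    have h1 := hTQ k hk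
    have h2 := hTQ k' hk'
    obtain ⟨h3, h4⟩ := hgg _ _ _ h1.2 _ h2.2 h
    obtain ⟨rfl, rfl⟩ := Nat.pair_eq_pair.1 h3
    exact ⟨(q.gen.pinj k).inj h1.1 h2.1 h4, rfl⟩

theorem compress (μ : Measure X) [SigmaFinite μ] (hE : IsCBER E) (hmcp : MCP μ E)
    (herg : ErgodicRel μ E) (hIII : IsTypeIII μ E) {B : Set X} (hB : MeasurableSet B)
    (hB0 : μ B ≠ 0) : ∃ (Z : Set X) (θ : ℕ → X → X), MeasurableSet Z ∧ μ Zᶜ = 0 ∧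
      (∀ n, Measurable (θ n)) ∧ (∀ x ∈ Z, ∀ n, θ n x ∈ B ∧ (x, θ n x) ∈ E) ∧
      ∀ x ∈ Z, ∀ x' ∈ Z, ∀ n n', θ n x = θ n' x' → x = x' ∧ n = n' := by
  obtain ⟨m, hm, hm1, hm2⟩ := exists_isFiniteMeasure_absolutelyContinuous μ
  obtain ⟨Y, A, f, hg⟩ := gen μ hE hmcp
  have q : QI μ E Y A f := ⟨hE.2.1, fun C g h => ⟨mcp2 hmcp h, fun h0 =>
    mcp1 hmcp h.mf h.mA h.gr h0 fun x hx => ⟨x, hx, rfl⟩⟩, hg, herg, hIII⟩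
  obtain ⟨Z, θ, h1, h2, h3⟩ := compress0 (q.congr hm2 hm1) hB fun h => hB0 (hm1 h)
  exact ⟨Z, θ, h1, hm1 h2, h3⟩

end
end ESl

namespace ESl

theorem sb {W V : Type*} [MeasurableSpace W] [StandardBorelSpace W] [MeasurableSpace V]
    [StandardBorelSpace V] {θ : W → V} {η : V → W} (hθ : Measurable θ) (hη : Measurable η)
    (iθ : Function.Injective θ) (iη : Function.Injective η) (R : W → V → Prop)
    (rθ : ∀ w, R w (θ w)) (rη : ∀ v, R (η v) v) :
    ∃ φ : W → V, Measurable φ ∧ Function.Bijective φ ∧ ∀ w, R w (φ w) := by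
  classical
  have eη := hη.measurableEmbedding iη
  have eθ := hθ.measurableEmbedding iθ
  let k : W → W := fun w => η (θ w)
  let S : ℕ → Set W := fun n => Nat.rec (range η)ᶜ (fun _ T => k '' T) n
  have hS0 : S 0 = (range η)ᶜ := rfl
  have hS1 : ∀ n, S (n + 1) = k '' S n := fun n => rfl
  have hSm : ∀ n, MeasurableSet (S n) := by
    intro n
    induction n with
    | zero => exact eη.measurableSet_range.compl
    | succ n ih => rw [hS1]; exact (eη.comp eθ).measurableSet_image.2 ih
  let A := ⋃ n, S n
  have hA : MeasurableSet A := MeasurableSet.iUnion hSm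
  have hkA : ∀ w ∈ A, k w ∈ A := by
    intro w hw
    obtain ⟨n, hn⟩ := mem_iUnion.1 hw
    exact mem_iUnion.2 ⟨n + 1, w, hn, rfl⟩
  obtain ⟨inv, hinv, hie⟩ := eη.exists_measurable_extend (g := fun v : V => v) measurable_id
    (fun w => ⟨θ w⟩)
  have hie : ∀ v, inv (η v) = v := fun v => congrFun hie v
  have hoff : ∀ w, w ∉ A → η (inv w) = w := by
    intro w hw
    have : w ∈ range η := by
      by_contra h
      exact hw (mem_iUnion.2 ⟨0, h⟩)
    obtain ⟨v, rfl⟩ := this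
    rw [hie]
  refine ⟨A.piecewise θ inv, hθ.piecewise hA hinv, ⟨?_, ?_⟩, ?_⟩
  · intro w w' h
    by_cases h1 : w ∈ A <;> by_cases h2 : w' ∈ A
    · simp only [piecewise_eq_of_mem, h1, h2] at h
      exact iθ h
    · simp only [piecewise_eq_of_mem, piecewise_eq_of_notMem, h1, h2, not_false_eq_true] at h
      refine (h2 ?_).elim
      rw [← hoff w' h2, ← h]
      exact hkA w h1
    · simp only [piecewise_eq_of_mem, piecewise_eq_of_notMem, h1, h2, not_false_eq_true] at h
      refine (h1 ?_).elim
      rw [← hoff w h1, h]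
      exact hkA w' h2
    · simp only [piecewise_eq_of_notMem, h1, h2, not_false_eq_true] at h
      rw [← hoff w h1, ← hoff w' h2, h]
  · intro v
    by_cases h : η v ∈ A
    · obtain ⟨n, hn⟩ := mem_iUnion.1 h
      cases n with
      | zero => exact (hn ⟨v, rfl⟩).elim
      | succ n =>
        obtain ⟨w, hw, hwv⟩ := hn
        refine ⟨w, ?_⟩
        rw [piecewise_eq_of_mem _ _ _ (mem_iUnion.2 ⟨n, hw⟩)]
        exact iη hwv
    · exact ⟨η v, by rw [piecewise_eq_of_notMem _ _ _ h, hie]⟩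
  · intro w
    by_cases h : w ∈ A
    · rw [piecewise_eq_of_mem _ _ _ h]; exact rθ w
    · rw [piecewise_eq_of_notMem _ _ _ h]
      have := rη (inv w)
      rwa [hoff w h] at this

theorem encard_slots {a b : ℕ∞} (h : a ≤ b) : a + {i : ℕ | a + i < b}.encard = b := by
  cases a with
  | top => simp at h; simp [h]
  | coe a =>
    cases b with
    | top =>
      have : {i : ℕ | (a : ℕ∞) + i < ⊤} = univ := by
        ext i; simp only [mem_ofPred_eq, mem_univ, iff_true]
        exact_mod_cast ENat.coe_lt_top (a + i)
      rw [this]; simp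
    | coe b =>
      have hab : a ≤ b := by exact_mod_cast h
      have : {i : ℕ | (a : ℕ∞) + i < b} = (Finset.range (b - a) : Set ℕ) := by
        ext i
        simp only [mem_ofPred_eq, Finset.coe_range, mem_Iio]
        norm_cast
        omega
      rw [this, Set.encard_coe_eq_coe_finsetCard, Finset.card_range]
      norm_cast
      omega

section
variable {X : Type*} [MeasurableSpace X] [StandardBorelSpace X] {E : Set (X × X)}
variable {μ : Measure X} {Y : Set X} {A : ℕ → Set X} {f : ℕ → X → X}

theorem deg_meas (g : GenD μ E Y A f) {H : Set (X × X)} (hH : MeasurableSet H) (hHE : H ⊆ E) :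
    ∃ d : X → ℕ∞, Measurable d ∧ ∀ x ∈ Y, d x = {y | (x, y) ∈ H}.encard := by
  let U : ℕ → Set X := fun n => (A n ∩ {x | (x, f n x) ∈ H}) \
    ⋃ k, ⋃ (_ : k < n), A k ∩ {x | f k x = f n x}
  have hU : ∀ n, MeasurableSet (U n) := fun n => by
    refine MeasurableSet.diff ?_ ?_
    · exact (g.pinj n).mA.inter ((measurable_id.prodMk (g.pinj n).mf) hH)
    · exact MeasurableSet.iUnion fun k => MeasurableSet.iUnion fun _ =>
        (g.pinj k).mA.inter (measurableSet_eq_fun (g.pinj k).mf (g.pinj n).mf)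
  let d : X → ℕ∞ := fun x => {n | x ∈ U n}.encard
  refine ⟨d, ?_, ?_⟩
  · refine measurable_encard.comp (measurable_set_iff.2 fun n => ?_)
    exact measurableSet_setOf.1 (hU n)
  · intro x hx
    have hinj : InjOn (fun n => f n x) {n | x ∈ U n} := by
      intro n hn k hk hnk
      rcases lt_trichotomy n k with h | h | h
      · refine (hk.2 ?_).elim
        simp only [mem_iUnion]
        exact ⟨n, h, hn.1.1, hnk⟩
      · exact h
      · refine (hn.2 ?_).elim
        simp only [mem_iUnion]
        exact ⟨k, h, hk.1.1, hnk.symm⟩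
    show {n | x ∈ U n}.encard = _
    rw [← hinj.encard_image]
    congr 1
    ext y
    constructor
    · rintro ⟨n, hn, rfl⟩
      exact hn.1.2
    · intro hy
      have hex := g.cov x hx y (hHE hy)
      classical
      let n := Nat.find hex
      have hn : x ∈ A n ∧ f n x = y := Nat.find_spec hex
      refine ⟨n, ⟨⟨hn.1, ?_⟩, ?_⟩, hn.2⟩
      · show (x, f n x) ∈ H
        rw [hn.2]; exact hy
      · intro h
        simp only [mem_iUnion] at h
        obtain ⟨k, hk, h1, h2⟩ := h
        have h2 : f k x = f n x := h2
        exact Nat.find_min hex hk ⟨h1, h2.trans hn.2⟩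

theorem index_meas (g : GenD μ E Y A f) :
    ∃ ι : X × X → ℕ, Measurable ι ∧ ∀ x ∈ Y, ∀ y, (x, y) ∈ E → f (ι (x, y)) x = y := by
  let Q : ℕ → Set (X × X) := fun n => {p | p.1 ∈ A n ∧ p.2 = f n p.1}
  have hQ : ∀ n, MeasurableSet (Q n) := fun n => meas_graph (g.pinj n).mf (g.pinj n).mA
  obtain ⟨ι, h1, h2⟩ := exists_measurable_piecewise (disjointed Q)
    (fun n => MeasurableSet.disjointed hQ n) (fun n _ => n) (fun n => measurable_const) (by
      intro i j hij x hx
      exact (Set.disjoint_left.1 (disjoint_disjointed Q hij) hx.1 hx.2).elim)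
  refine ⟨ι, h1, fun x hx y hxy => ?_⟩
  have : (x, y) ∈ ⋃ n, disjointed Q n := by
    rw [iUnion_disjointed]
    obtain ⟨n, h3, h4⟩ := g.cov x hx y hxy
    exact mem_iUnion.2 ⟨n, h3, h4.symm⟩
  obtain ⟨n, hn⟩ := mem_iUnion.1 this
  rw [h2 n hn]
  exact (disjointed_subset Q n hn).2.symm

/-- colouring of the compressed copies -/
theorem color_meas {Z : Set X} {θ : ℕ → X → X} (hZ : MeasurableSet Z) (hθ : ∀ n, Measurable (θ n))
    (hinj : ∀ x ∈ Z, ∀ x' ∈ Z, ∀ n n', θ n x = θ n' x' → x = x' ∧ n = n') :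
    ∃ c : X → ℕ, Measurable c ∧ ∀ x ∈ Z, ∀ k n, c (θ (Nat.pair k n) x) = k := by
  obtain ⟨c, h1, h2⟩ := exists_measurable_piecewise (fun n => θ n '' Z)
    (fun n => hZ.image_of_measurable_injOn (hθ n) fun x hx x' hx' h => (hinj x hx x' hx' n n h).1)
    (fun n _ => n.unpair.1) (fun n => measurable_const) (by
      rintro i j hij _ ⟨⟨x, hx, rfl⟩, y, hy, h⟩
      exact (hij (hinj y hy x hx _ _ h).2.symm).elim)
  refine ⟨c, h1, fun x hx k n => ?_⟩
  rw [h2 (Nat.pair k n) ⟨x, hx, rfl⟩]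
  simp

theorem meas_uncurry {P : Type*} [MeasurableSpace P] {θ : ℕ → X → X} (hθ : ∀ n, Measurable (θ n))
    {a : P → ℕ} {b : P → X} (ha : Measurable a) (hb : Measurable b) :
    Measurable fun p => θ (a p) (b p) := by
  have : Measurable fun q : X × ℕ => θ q.2 q.1 := measurable_from_prod_countable_left fun n => hθ n
  exact this.comp (hb.prodMk ha)

end
end ESl

namespace ESl

section
variable {X : Type*}

theorem sub_connRel {G : Set (X × X)} {x y : X} (h : (x, y) ∈ G) : (x, y) ∈ connRel (symmCl G) :=
  Relation.ReflTransGen.single (Or.inl h)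

theorem sub_connRel' {G : Set (X × X)} {x y : X} (h : (x, y) ∈ G) : (y, x) ∈ connRel (symmCl G) :=
  Relation.ReflTransGen.single (Or.inr h)

/-- path induction -/
theorem conn_ind {G E : Set (X × X)} (heq : Equivalence fun x y => (x, y) ∈ E) {Y : Set X}
    (hinv : ∀ x ∈ Y, ∀ y, (x, y) ∈ connRel (symmCl G) → y ∈ Y)
    (h : ∀ x ∈ Y, ∀ y, (x, y) ∈ G → (x, y) ∈ E) {x y : X} (hx : x ∈ Y)
    (hxy : (x, y) ∈ connRel (symmCl G)) : (x, y) ∈ E := by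
  have hxy' : Relation.ReflTransGen (fun a b => (a, b) ∈ symmCl G) x y := hxy
  clear hxy
  induction hxy' with
  | refl => exact heq.refl x
  | @tail b c h1 h2 ih =>
    refine heq.trans ih ?_
    have hb : b ∈ Y := hinv x hx b h1
    rcases h2 with h2 | h2
    · exact h b hb c h2
    · exact heq.symm (h c (hinv b hb c (sub_connRel' h2)) b h2)

theorem conn_mono {G E : Set (X × X)} (heq : Equivalence fun x y => (x, y) ∈ E)
    (h : G ⊆ E) : connRel (symmCl G) ⊆ E := by
  rintro ⟨x, y⟩ hxy
  exact conn_ind (Y := univ) heq (fun _ _ _ _ => trivial) (fun x _ y hxy => h hxy) trivial hxy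

variable [MeasurableSpace X] [StandardBorelSpace X]

/-- the edges to slide -/
def slideM (G H : Set (X × X)) : Set (X × X) :=
  {p | (p ∈ G ∧ p ∉ connRel (symmCl H)) ∧
    ((p.2, p.1) ∉ G ∨ embeddingReal X p.1 < embeddingReal X p.2)}

theorem slideM_meas {G H : Set (X × X)} (hG : MeasurableSet G)
    (hH : MeasurableSet (connRel (symmCl H))) : MeasurableSet (slideM G H) := by
  refine (hG.inter hH.compl).inter (MeasurableSet.union ?_ ?_)
  · exact (measurable_swap hG).compl
  · exact measurableSet_lt ((measurable_embeddingReal X).comp measurable_fst)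
      ((measurable_embeddingReal X).comp measurable_snd)

theorem slideM_asym {G H : Set (X × X)} {x y : X} (h : (x, y) ∈ slideM G H) :
    (y, x) ∉ slideM G H := by
  intro h'
  rcases h.2 with h1 | h1
  · exact h1 h'.1.1
  · rcases h'.2 with h2 | h2
    · exact h2 h.1.1
    · exact lt_asymm h1 h2

theorem slideM_cov {G H : Set (X × X)} (heq : Equivalence fun x y => (x, y) ∈ connRel (symmCl H))
    {x y : X} (h : (x, y) ∈ G)
    (hE : (x, y) ∉ connRel (symmCl H)) : (x, y) ∈ slideM G H ∨ (y, x) ∈ slideM G H := by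
  have hne : x ≠ y := by rintro rfl; exact hE (heq.refl x)
  by_cases h1 : (y, x) ∈ G
  · rcases lt_or_gt_of_ne (fun h => hne ((measurableEmbedding_embeddingReal X).injective h)) with
      h2 | h2
    · exact Or.inl ⟨⟨h, hE⟩, Or.inr h2⟩
    · exact Or.inr ⟨⟨h1, fun h3 => hE (heq.symm h3)⟩, Or.inr h2⟩
  · exact Or.inl ⟨⟨h, hE⟩, Or.inl h1⟩

theorem exists_D {μ : Measure X} {G H : Set (X × X)} (hGm : MeasurableSet G) (hHG : H ⊆ G)
    (hEG : IsCBER (connRel (symmCl G))) (hmcp : MCP μ (connRel (symmCl G)))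
    (hEH : IsCBER (connRel (symmCl H)))
    (hstrict : μ {x | {y | (x, y) ∈ connRel (symmCl H)} ≠ {y | (x, y) ∈ connRel (symmCl G)}}
      ≠ 0) {Y : Set X} {A : ℕ → Set X} {f : ℕ → X → X}
    (g : GenD μ (connRel (symmCl G)) Y A f) :
    ∃ (D : Set X) (ρ : X → X), μ D ≠ 0 ∧ PInj (connRel (symmCl G)) D ρ ∧
      ∀ x ∈ D, (x, ρ x) ∈ slideM G H := by
  have hHE : connRel (symmCl H) ⊆ connRel (symmCl G) :=
    conn_mono hEG.2.1 fun p hp => sub_connRel (hHG hp)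
  let D : ℕ → Set X := fun n => A n ∩ {x | (x, f n x) ∈ slideM G H}
  have hD : ∀ n, MeasurableSet (D n) := fun n => (g.pinj n).mA.inter
    ((measurable_id.prodMk (g.pinj n).mf) (slideM_meas hGm hEH.1))
  by_contra hcon
  have h0 : ∀ n, μ (D n) = 0 := by
    intro n
    by_contra h
    exact hcon ⟨D n, f n, h, (g.pinj n).mono (hD n) inter_subset_left, fun x hx => hx.2⟩
  obtain ⟨Y', hs, hm, hn, hinv, hd⟩ := g.shrink hmcp hEG.2.1 (measure_iUnion_null h0)
  have hnot : ∀ x ∈ Y', ∀ y, (x, y) ∉ slideM G H := by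
    intro x hx y hxy
    obtain ⟨n, h1, h2⟩ := g.cov x (hs hx) y (sub_connRel hxy.1.1)
    refine Set.disjoint_left.1 hd hx (mem_iUnion.2 ⟨n, h1, ?_⟩)
    show (x, f n x) ∈ slideM G H
    rw [h2]; exact hxy
  refine hstrict (measure_mono_null ?_ hn)
  intro x hx hxY
  apply hx
  ext y
  refine ⟨fun h => hHE h, fun h => ?_⟩
  refine conn_ind hEH.2.1 hinv ?_ hxY h
  intro x hx y hxy
  by_contra hE
  rcases slideM_cov hEH.2.1 hxy hE with h | h
  · exact hnot x hx y h
  · exact hnot y (hinv x hx y (sub_connRel hxy)) x h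

/-- abstract sliding data -/
structure SlideData (μ : Measure X) (G H : Set (X × X)) (dIn dOut : X → ℕ∞) (Y : Set X)
    (M : Set (X × X)) (a b : M → X) : Prop where
  mY : MeasurableSet Y
  nY : μ Yᶜ = 0
  inv : ∀ x ∈ Y, ∀ y, (x, y) ∈ connRel (symmCl G) → y ∈ Y
  mM : MeasurableSet M
  sub : M ⊆ slideM G H
  cov : ∀ x ∈ Y, ∀ y, (x, y) ∈ G → (x, y) ∉ connRel (symmCl H) → (x, y) ∈ M ∨ (y, x) ∈ M
  ma : Measurable a
  mb : Measurable b
  ra : ∀ m : M, (m.1.1, a m) ∈ connRel (symmCl H)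
  rb : ∀ m : M, (m.1.2, b m) ∈ connRel (symmCl H)
  inj : Function.Injective fun m => (a m, b m)
  dO : ∀ x ∈ Y, {y | (x, y) ∈ H}.encard + {m | a m = x}.encard = dOut x
  dI : ∀ x ∈ Y, {y | (y, x) ∈ H}.encard + {m | b m = x}.encard = dIn x

theorem encard_fib {M : Type*} {S : Set (X × ℕ)} {φ : M → S} (hφ : Function.Bijective φ) (x : X) :
    {m | (φ m).1.1 = x}.encard = {i : ℕ | (x, i) ∈ S}.encard := by
  have h1 : {i : ℕ | (x, i) ∈ S} = (fun m => (φ m).1.2) '' {m | (φ m).1.1 = x} := by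
    ext i
    constructor
    · intro hi
      obtain ⟨m, hm⟩ := hφ.2 ⟨(x, i), hi⟩
      exact ⟨m, by simp [hm], by simp [hm]⟩
    · rintro ⟨m, rfl, rfl⟩
      exact (φ m).2
  rw [h1, InjOn.encard_image]
  intro m hm m' hm' h
  apply hφ.1
  apply Subtype.ext
  exact Prod.ext (hm.trans hm'.symm) h

theorem slots_meas {Y : Set X} (hY : MeasurableSet Y) {d e : X → ℕ∞} (hd : Measurable d)
    (he : Measurable e) : MeasurableSet {p : X × ℕ | p.1 ∈ Y ∧ d p.1 + p.2 < e p.1} := by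
  refine (measurable_fst hY).inter ?_
  have h1 : Measurable fun p : X × ℕ => ((d p.1, p.2), e p.1) :=
    ((hd.comp measurable_fst).prodMk measurable_snd).prodMk (he.comp measurable_fst)
  have h2 : MeasurableSet {q : (ℕ∞ × ℕ) × ℕ∞ | q.1.1 + q.1.2 < q.2} :=
    MeasurableSet.of_discrete
  exact h1 h2

theorem exists_slideData (μ : Measure X) [SigmaFinite μ]
    (G H : Set (X × X)) (hGmeas : MeasurableSet G) (hHmeas : MeasurableSet H)
    (hHG : H ⊆ G)
    (hEG : IsCBER (connRel (symmCl G)))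
    (hEGmcp : MCP μ (connRel (symmCl G)))
    (hEH : IsCBER (connRel (symmCl H)))
    (hEHmcp : MCP μ (connRel (symmCl H)))
    (hEHerg : ErgodicRel μ (connRel (symmCl H)))
    (hEHIII : IsTypeIII μ (connRel (symmCl H)))
    (hstrict : μ {x | {y | (x, y) ∈ connRel (symmCl H)} ≠ {y | (x, y) ∈ connRel (symmCl G)}}
      ≠ 0)
    (dIn dOut : X → ℕ∞) (hdIn : Measurable dIn) (hdOut : Measurable dOut)
    (hdInLe : ∀ x : X, {y | (y, x) ∈ H}.encard ≤ dIn x)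
    (hdOutLe : ∀ x : X, {y | (x, y) ∈ H}.encard ≤ dOut x)
    (hdInStrict : μ {x | {y | (y, x) ∈ H}.encard < dIn x} ≠ 0)
    (hdOutStrict : μ {x | {y | (x, y) ∈ H}.encard < dOut x} ≠ 0) :
    ∃ Y M a b, SlideData μ G H dIn dOut Y M a b := by
  have hHE : connRel (symmCl H) ⊆ connRel (symmCl G) :=
    conn_mono hEG.2.1 fun p hp => sub_connRel (hHG hp)
  obtain ⟨Y0, A, f, g⟩ := gen μ hEG hEGmcp
  obtain ⟨D, ρ, hD0, hρ, hDM⟩ := exists_D hGmeas hHG hEG hEGmcp hEH hstrict g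
  obtain ⟨ρi, hρim, hρi⟩ := hρ.exists_inv
  obtain ⟨ι, hιm, hι⟩ := index_meas g
  obtain ⟨dO, hdOm, hdO⟩ := deg_meas g hHmeas fun p hp => sub_connRel (hHG hp)
  obtain ⟨dI, hdIm, hdI⟩ := deg_meas g (H := Prod.swap ⁻¹' H) (measurable_swap hHmeas)
    fun p hp => sub_connRel' (hHG hp)
  have hdI : ∀ x ∈ Y0, dI x = {y | (y, x) ∈ H}.encard := hdI
  let A0 : Set X := Y0 ∩ {x | dO x < dOut x}
  let B0 : Set X := Y0 ∩ {x | dI x < dIn x}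
  have hlt : ∀ {d e : X → ℕ∞}, Measurable d → Measurable e → MeasurableSet {x | d x < e x} := by
    intro d e hd he
    have h2 : MeasurableSet {q : ℕ∞ × ℕ∞ | q.1 < q.2} := MeasurableSet.of_discrete
    exact (hd.prodMk he) h2
  have hA0m : MeasurableSet A0 := g.mY.inter (hlt hdOm hdOut)
  have hB0m : MeasurableSet B0 := g.mY.inter (hlt hdIm hdIn)
  have hA0 : μ A0 ≠ 0 := by
    intro h
    refine hdOutStrict (measure_mono_null ?_ (measure_union_null h g.nY))
    intro x hx
    by_cases hY : x ∈ Y0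
    · exact Or.inl ⟨hY, by show dO x < dOut x; rw [hdO x hY]; exact hx⟩
    · exact Or.inr hY
  have hB0 : μ B0 ≠ 0 := by
    intro h
    refine hdInStrict (measure_mono_null ?_ (measure_union_null h g.nY))
    intro x hx
    by_cases hY : x ∈ Y0
    · exact Or.inl ⟨hY, by show dI x < dIn x; rw [hdI x hY]; exact hx⟩
    · exact Or.inr hY
  obtain ⟨ZA, θA, hZA, hZA0, hθA, hθAB, hθAi⟩ := compress μ hEH hEHmcp hEHerg hEHIII hA0m hA0
  obtain ⟨ZB, θB, hZB, hZB0, hθB, hθBB, hθBi⟩ := compress μ hEH hEHmcp hEHerg hEHIII hB0m hB0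
  obtain ⟨ZD, θD, hZD, hZD0, hθD, hθDB, hθDi⟩ := compress μ hEH hEHmcp hEHerg hEHIII hρ.mA hD0
  obtain ⟨cO, hcO, hcOθ⟩ := color_meas hZA hθA hθAi
  obtain ⟨cI, hcI, hcIθ⟩ := color_meas hZB hθB hθBi
  obtain ⟨cD, hcD, hcDθ⟩ := color_meas hZD hθD hθDi
  let C : ℕ → Set X := fun k => θD (Nat.pair k 0) '' ZD
  have hCp : ∀ k, PInj (connRel (symmCl H)) ZD (θD (Nat.pair k 0)) := fun k =>
    ⟨hθD _, hZD, fun x hx y hy h => (hθDi x hx y hy _ _ h).1, fun x hx => (hθDB x hx _).2⟩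
  have hCD : ∀ k, C k ⊆ D := by
    rintro k _ ⟨x, hx, rfl⟩
    exact (hθDB x hx _).1
  have hC0 : ∀ k, μ (C k) ≠ 0 := by
    intro k h
    have h1 : μ ZD = 0 := mcp1 hEHmcp (hCp k).mf hZD (hCp k).gr h fun x hx => ⟨x, hx, rfl⟩
    exact hD0 (measure_mono_null (subset_univ _) (by
      rw [← union_compl_self ZD]; exact measure_union_null h1 hZD0))
  have hρC : ∀ k, PInj (connRel (symmCl G)) (C k) ρ := fun k => hρ.mono (hCp k).image (hCD k)
  have hT0 : ∀ k, μ (ρ '' C k) ≠ 0 := fun k h => hC0 k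
    (mcp1 hEGmcp (hρC k).mf (hρC k).mA (hρC k).gr h fun x hx => ⟨x, hx, rfl⟩)
  choose ZT θT hZT hZT0 hθT hθTB hθTi using fun k =>
    compress μ hEH hEHmcp hEHerg hEHIII (hρC k).image (hT0 k)
  obtain ⟨Y, hYs, hYm, hYn, hYinv, hYd⟩ := g.shrink hEGmcp hEG.2.1 (N := ZAᶜ ∪ ZBᶜ ∪ ZDᶜ ∪ ⋃ k, (ZT k)ᶜ)
    (measure_union_null (measure_union_null (measure_union_null hZA0 hZB0) hZD0)
      (measure_iUnion_null hZT0))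
  have hYA : ∀ x ∈ Y, x ∈ ZA := fun x hx => by
    by_contra h; exact Set.disjoint_left.1 hYd hx (Or.inl (Or.inl (Or.inl h)))
  have hYB : ∀ x ∈ Y, x ∈ ZB := fun x hx => by
    by_contra h; exact Set.disjoint_left.1 hYd hx (Or.inl (Or.inl (Or.inr h)))
  have hYD : ∀ x ∈ Y, x ∈ ZD := fun x hx => by
    by_contra h; exact Set.disjoint_left.1 hYd hx (Or.inl (Or.inr h))
  have hYT : ∀ k, ∀ x ∈ Y, x ∈ ZT k := fun k x hx => by
    by_contra h; exact Set.disjoint_left.1 hYd hx (Or.inr (mem_iUnion.2 ⟨k, h⟩))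
  have hYH : ∀ x ∈ Y, ∀ y, (x, y) ∈ connRel (symmCl H) → y ∈ Y := fun x hx y h =>
    hYinv x hx y (hHE h)
  let M : Set (X × X) := slideM G H ∩ {p | p.1 ∈ Y}
  have hMm : MeasurableSet M := (slideM_meas hGmeas hEH.1).inter (measurable_fst hYm)
  have hM1 : ∀ m : M, m.1.1 ∈ Y := fun m => m.2.2
  have hME : ∀ m : M, (m.1.1, m.1.2) ∈ connRel (symmCl G) := fun m => sub_connRel m.2.1.1.1
  have hM2 : ∀ m : M, m.1.2 ∈ Y := fun m => hYinv _ (hM1 m) _ (hME m)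
  let SO : Set (X × ℕ) := {p | p.1 ∈ Y ∧ dO p.1 + p.2 < dOut p.1}
  let SI : Set (X × ℕ) := {p | p.1 ∈ Y ∧ dI p.1 + p.2 < dIn p.1}
  have hSO : MeasurableSet SO := slots_meas hYm hdOm hdOut
  have hSI : MeasurableSet SI := slots_meas hYm hdIm hdIn
  have : StandardBorelSpace M := hMm.standardBorel
  have : StandardBorelSpace SO := hSO.standardBorel
  have : StandardBorelSpace SI := hSI.standardBorel
  have m1 : Measurable fun m : M => m.1.1 := measurable_fst.comp measurable_subtype_coe
  have m2 : Measurable fun m : M => m.1.2 := measurable_snd.comp measurable_subtype_coe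
  have hpair : ∀ {P : Type _} [MeasurableSpace P] {a b : P → ℕ}, Measurable a → Measurable b →
      Measurable fun p => Nat.pair (a p) (b p) := by
    intro P _ a b ha hb
    exact (measurable_of_countable fun q : ℕ × ℕ => Nat.pair q.1 q.2).comp (ha.prodMk hb)
  -- out side
  have hφ : ∃ φ : M → SO, Measurable φ ∧ Function.Bijective φ ∧
      ∀ m, (m.1.1, (φ m).1.1) ∈ connRel (symmCl H) ∧ cD m.1.1 = cO (φ m).1.1 := by
    let z : M → X := fun m => θA (Nat.pair (cD m.1.1) (ι m.1)) m.1.1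
    have hz : Measurable z := meas_uncurry hθA
      (hpair (hcD.comp m1) (hιm.comp measurable_subtype_coe)) m1
    have hzB : ∀ m, z m ∈ A0 ∧ (m.1.1, z m) ∈ connRel (symmCl H) := fun m =>
      hθAB _ (hYA _ (hM1 m)) _
    have hzS : ∀ m, (z m, 0) ∈ SO := fun m => ⟨hYH _ (hM1 m) _ (hzB m).2, by
      have := (hzB m).1.2
      show dO (z m) + ((0 : ℕ) : ℕ∞) < dOut (z m)
      rw [Nat.cast_zero, add_zero]; exact this⟩
    let e : SO → X := fun s => θD (Nat.pair (cO s.1.1) s.1.2) s.1.1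
    have ms1 : Measurable fun s : SO => s.1.1 := measurable_fst.comp measurable_subtype_coe
    have ms2 : Measurable fun s : SO => s.1.2 := measurable_snd.comp measurable_subtype_coe
    have he : Measurable e := meas_uncurry hθD (hpair (hcO.comp ms1) ms2) ms1
    have heB : ∀ s, e s ∈ D ∧ (s.1.1, e s) ∈ connRel (symmCl H) := fun s =>
      hθDB _ (hYD _ s.2.1) _
    have heM : ∀ s, (e s, ρ (e s)) ∈ M := fun s =>
      ⟨hDM _ (heB s).1, hYH _ s.2.1 _ (heB s).2⟩
    refine sb (W := M) (V := SO) (θ := fun m => ⟨(z m, 0), hzS m⟩) (η := fun s => ⟨(e s, ρ (e s)), heM s⟩)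
      ((hz.prodMk measurable_const).subtype_mk) ((he.prodMk (hρ.mf.comp he)).subtype_mk) ?_ ?_
      (fun m s => (m.1.1, s.1.1) ∈ connRel (symmCl H) ∧ cD m.1.1 = cO s.1.1) ?_ ?_
    · intro m m' h
      have h1 : z m = z m' := congrArg (fun s : SO => s.1.1) h
      obtain ⟨h2, h3⟩ := hθAi _ (hYA _ (hM1 m)) _ (hYA _ (hM1 m')) _ _ h1
      have h4 := (Nat.pair_eq_pair.1 h3).2
      apply Subtype.ext
      refine Prod.ext h2 ?_
      have h5 := hι _ (hYs (hM1 m)) _ (hME m)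
      have h6 := hι _ (hYs (hM1 m')) _ (hME m')
      have h4 : ι (m.1.1, m.1.2) = ι (m'.1.1, m'.1.2) := h4
      rw [← h5, ← h6, h4, h2]
    · intro s s' h
      have h1 : e s = e s' := congrArg (fun s : M => s.1.1) h
      obtain ⟨h2, h3⟩ := hθDi _ (hYD _ s.2.1) _ (hYD _ s'.2.1) _ _ h1
      exact Subtype.ext (Prod.ext h2 (Nat.pair_eq_pair.1 h3).2)
    · intro m
      exact ⟨(hzB m).2, (hcOθ _ (hYA _ (hM1 m)) _ _).symm⟩
    · intro s
      exact ⟨hEH.2.1.symm (heB s).2, hcDθ _ (hYD _ s.2.1) _ _⟩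
  have hψ : ∃ ψ : M → SI, Measurable ψ ∧ Function.Bijective ψ ∧
      ∀ m, (m.1.2, (ψ m).1.1) ∈ connRel (symmCl H) ∧ cD m.1.1 = cI (ψ m).1.1 + (ψ m).1.2 := by
    let z : M → X := fun m => θB (Nat.pair (cD m.1.1) (ι (m.1.2, m.1.1))) m.1.2
    have hz : Measurable z := meas_uncurry hθB
      (hpair (hcD.comp m1) (hιm.comp (m2.prodMk m1))) m2
    have hzB : ∀ m, z m ∈ B0 ∧ (m.1.2, z m) ∈ connRel (symmCl H) := fun m =>
      hθBB _ (hYB _ (hM2 m)) _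
    have hzS : ∀ m, (z m, 0) ∈ SI := fun m => ⟨hYH _ (hM2 m) _ (hzB m).2, by
      have := (hzB m).1.2
      show dI (z m) + ((0 : ℕ) : ℕ∞) < dIn (z m)
      rw [Nat.cast_zero, add_zero]; exact this⟩
    let t : SI → X := fun s => θT (cI s.1.1 + s.1.2) s.1.2 s.1.1
    have ms1 : Measurable fun s : SI => s.1.1 := measurable_fst.comp measurable_subtype_coe
    have ms2 : Measurable fun s : SI => s.1.2 := measurable_snd.comp measurable_subtype_coe
    have ht : Measurable t := by
      have h1 := meas_uncurry (θ := fun n => θT n.unpair.1 n.unpair.2) (fun n => hθT _ _)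
        (hpair ((hcI.comp ms1).add ms2) ms2) ms1
      simpa using h1
    have htB : ∀ s : SI, t s ∈ ρ '' C (cI s.1.1 + s.1.2) ∧ (s.1.1, t s) ∈ connRel (symmCl H) :=
      fun s => hθTB _ _ (hYT _ _ s.2.1) _
    have hte : ∀ s : SI, ρi (t s) ∈ D ∧ ρ (ρi (t s)) = t s ∧
        cD (ρi (t s)) = cI s.1.1 + s.1.2 := by
      intro s
      obtain ⟨_, ⟨w, hw, rfl⟩, h⟩ := (htB s).1
      have h1 := (hθDB w hw (Nat.pair (cI s.1.1 + s.1.2) 0)).1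
      rw [← h, hρi _ h1]
      exact ⟨h1, rfl, hcDθ w hw _ _⟩
    have heM : ∀ s, (ρi (t s), t s) ∈ M := fun s => by
      have h1 := hDM _ (hte s).1
      rw [(hte s).2.1] at h1
      refine ⟨h1, ?_⟩
      have h2 : t s ∈ Y := hYH _ s.2.1 _ (htB s).2
      exact hYinv _ h2 _ (sub_connRel' h1.1.1)
    refine sb (W := M) (V := SI) (θ := fun m => ⟨(z m, 0), hzS m⟩) (η := fun s => ⟨(ρi (t s), t s), heM s⟩)
      ((hz.prodMk measurable_const).subtype_mk) (((hρim.comp ht).prodMk ht).subtype_mk) ?_ ?_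
      (fun m s => (m.1.2, s.1.1) ∈ connRel (symmCl H) ∧ cD m.1.1 = cI s.1.1 + s.1.2) ?_ ?_
    · intro m m' h
      have h1 : z m = z m' := congrArg (fun s : SI => s.1.1) h
      obtain ⟨h2, h3⟩ := hθBi _ (hYB _ (hM2 m)) _ (hYB _ (hM2 m')) _ _ h1
      have h4 := (Nat.pair_eq_pair.1 h3).2
      apply Subtype.ext
      refine Prod.ext ?_ h2
      have h5 := hι _ (hYs (hM2 m)) _ (hEG.2.1.symm (hME m))
      have h6 := hι _ (hYs (hM2 m')) _ (hEG.2.1.symm (hME m'))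
      rw [← h5, ← h6, h4, h2]
    · intro s s' h
      have h1 : t s = t s' := congrArg (fun s : M => s.1.2) h
      have h2 : cI s.1.1 + s.1.2 = cI s'.1.1 + s'.1.2 := by
        rw [← (hte s).2.2, ← (hte s').2.2, h1]
      have h1 : θT (cI s.1.1 + s.1.2) s.1.2 s.1.1 = θT (cI s'.1.1 + s'.1.2) s'.1.2 s'.1.1 := h1
      rw [h2] at h1
      obtain ⟨h3, h4⟩ := hθTi _ _ (hYT _ _ s.2.1) _ (hYT _ _ s'.2.1) _ _ h1
      exact Subtype.ext (Prod.ext h3 h4)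
    · intro m
      exact ⟨(hzB m).2, (hcIθ _ (hYB _ (hM2 m)) _ _).symm⟩
    · intro s
      exact ⟨hEH.2.1.symm (htB s).2, (hte s).2.2⟩
  obtain ⟨φ, hφm, hφb, hφr⟩ := hφ
  obtain ⟨ψ, hψm, hψb, hψr⟩ := hψ
  refine ⟨Y, M, fun m => (φ m).1.1, fun m => (ψ m).1.1, ?_⟩
  refine
    { mY := hYm
      nY := hYn
      inv := hYinv
      mM := hMm
      sub := inter_subset_left
      cov := ?_
      ma := measurable_fst.comp (measurable_subtype_coe.comp hφm)
      mb := measurable_fst.comp (measurable_subtype_coe.comp hψm)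
      ra := fun m => (hφr m).1
      rb := fun m => (hψr m).1
      inj := ?_
      dO := ?_
      dI := ?_ }
  · intro x hx y hxy hE
    rcases slideM_cov hEH.2.1 hxy hE with h | h
    · exact Or.inl ⟨h, hx⟩
    · exact Or.inr ⟨h, hYinv x hx y (sub_connRel hxy)⟩
  · intro m m' h
    obtain ⟨h1, h2⟩ := Prod.mk.inj h
    have h3 := (hφr m).2
    have h4 := (hφr m').2
    have h5 := (hψr m).2
    have h6 := (hψr m').2
    apply hψb.1
    apply Subtype.ext
    refine Prod.ext h2 ?_
    have h7 : cI (ψ m).1.1 + (ψ m).1.2 = cI (ψ m').1.1 + (ψ m').1.2 := by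
      rw [← h5, ← h6, h3, h4, h1]
    rw [h2] at h7
    exact Nat.add_left_cancel h7
  · intro x hx
    have h1 : {i : ℕ | (x, i) ∈ SO} = {i : ℕ | dO x + i < dOut x} := by
      ext i; exact ⟨fun h => h.2, fun h => ⟨hx, h⟩⟩
    rw [encard_fib hφb, h1, ← hdO x (hYs hx)]
    exact encard_slots (by rw [hdO x (hYs hx)]; exact hdOutLe x)
  · intro x hx
    have h1 : {i : ℕ | (x, i) ∈ SI} = {i : ℕ | dI x + i < dIn x} := by
      ext i; exact ⟨fun h => h.2, fun h => ⟨hx, h⟩⟩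
    rw [encard_fib hψb, h1, ← hdI x (hYs hx)]
    exact encard_slots (by rw [hdI x (hYs hx)]; exact hdInLe x)

end
end ESl

namespace ESl

section
variable {X : Type*}

theorem acyc_conn {G : Set (X × X)} (hG : AcyclicGraph (symmCl G)) {s t : X} (hst : (s, t) ∈ G)
    (hne : s ≠ t)
    (h : Relation.ReflTransGen (fun x y => (x, y) ∈ symmCl G ∧ (x, y) ≠ (s, t) ∧ (x, y) ≠ (t, s))
      s t) : False := by
  classical
  let Γ : SimpleGraph X := SimpleGraph.fromRel fun x y =>
    (x, y) ∈ symmCl G ∧ (x, y) ≠ (s, t) ∧ (x, y) ≠ (t, s)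
  have hΓ : ∀ x y, Γ.Adj x y → (x, y) ∈ symmCl G ∧ (x, y) ≠ (s, t) := by
    intro x y h
    obtain ⟨-, h | h⟩ := h
    · exact ⟨h.1, h.2.1⟩
    · refine ⟨h.1.symm, ?_⟩
      intro h1
      apply h.2.2
      rw [Prod.mk.injEq] at h1 ⊢
      exact ⟨h1.2, h1.1⟩
  have hreach : Γ.Reachable s t := by
    clear hst hne
    generalize ht : t = t' at h
    have : ∀ t', Relation.ReflTransGen (fun x y => (x, y) ∈ symmCl G ∧ (x, y) ≠ (s, t) ∧
        (x, y) ≠ (t, s)) s t' → Γ.Reachable s t' := by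
      intro t' h
      induction h with
      | refl => exact SimpleGraph.Reachable.refl _
      | @tail b c h1 h2 ih =>
        by_cases hbc : b = c
        · rw [← hbc]; exact ih
        · exact ih.trans (SimpleGraph.Adj.reachable ⟨hbc, Or.inl h2⟩)
    subst ht
    exact this _ h
  obtain ⟨w⟩ := hreach
  let p := w.toPath
  have hp : p.1.IsPath := p.2
  have hlen : 2 ≤ p.1.length := by
    by_contra hlt
    have h0 : p.1.length ≠ 0 := fun h0 => hne (SimpleGraph.Walk.eq_of_length_eq_zero h0)
    have h1 : p.1.length = 1 := by omega
    have hadj := p.1.adj_getVert_succ (i := 0) (by omega)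
    rw [SimpleGraph.Walk.getVert_zero, zero_add, ← h1, SimpleGraph.Walk.getVert_length] at hadj
    exact (hΓ _ _ hadj).2 rfl
  refine hG (p.1.length + 1) (fun i => p.1.getVert i) (by omega) ?_ ?_
  · intro i hi
    by_cases hil : i = p.1.length
    · subst hil
      simp only [Nat.mod_self, SimpleGraph.Walk.getVert_zero, SimpleGraph.Walk.getVert_length]
      exact Or.inr hst
    · have : (i + 1) % (p.1.length + 1) = i + 1 := Nat.mod_eq_of_lt (by omega)
      simp only [this]
      exact (hΓ _ _ (p.1.adj_getVert_succ (by omega))).1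
  · intro i j hij
    have h1 : (i : ℕ) ≤ p.1.length := Nat.lt_succ_iff.1 i.2
    have h2 : (j : ℕ) ≤ p.1.length := Nat.lt_succ_iff.1 j.2
    exact Fin.ext (hp.getVert_injOn h1 h2 hij)

theorem acyc_slide {G H : Set (X × X)} (hHG : H ⊆ G)
    (heq : Equivalence fun x y => (x, y) ∈ connRel (symmCl H))
    {M : Set (X × X)} {a b : M → X} (hMG : M ⊆ G) (hMH : ∀ p ∈ M, p ∉ connRel (symmCl H))
    (hMa : ∀ x y, (x, y) ∈ M → (y, x) ∉ M)
    (ra : ∀ m : M, (m.1.1, a m) ∈ connRel (symmCl H))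
    (rb : ∀ m : M, (m.1.2, b m) ∈ connRel (symmCl H))
    (hG : AcyclicGraph (symmCl G)) :
    AcyclicGraph (symmCl (H ∪ range fun m => (a m, b m))) := by
  intro n c hn hc hinj
  have hinj' : ∀ i < n, ∀ j < n, c i = c j → i = j := by
    intro i hi j hj h
    have := @hinj ⟨i, hi⟩ ⟨j, hj⟩ h
    exact congrArg Fin.val this
  by_cases hall : ∀ i < n, (c i, c ((i + 1) % n)) ∈ symmCl H
  · exact hG n c hn (fun i hi => (hall i hi).imp (fun h => hHG h) fun h => hHG h) hinj
  push Not at hall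
  obtain ⟨i0, hi0, hne0⟩ := hall
  let d : ℕ → X := fun k => c ((i0 + k) % n)
  have hnpos : 0 < n := by omega
  have hd : ∀ k, (d k, d (k + 1)) ∈ symmCl (H ∪ range fun m => (a m, b m)) := by
    intro k
    have := hc ((i0 + k) % n) (Nat.mod_lt _ hnpos)
    rwa [Nat.mod_add_mod] at this
  have hd0 : d 0 = c i0 := by simp [d, Nat.mod_eq_of_lt hi0]
  have hdn : d n = d 0 := by simp [d]
  have hdi : ∀ k < n, ∀ l < n, d k = d l → k = l := by
    intro k hk l hl h
    have h1 := hinj' _ (Nat.mod_lt _ hnpos) _ (Nat.mod_lt _ hnpos) h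
    have h2 : k ≡ l [MOD n] := Nat.ModEq.add_left_cancel' i0 h1
    have h3 : k % n = l % n := h2
    rwa [Nat.mod_eq_of_lt hk, Nat.mod_eq_of_lt hl] at h3
  have hslid : ∀ x y, (x, y) ∈ symmCl (H ∪ range fun m => (a m, b m)) → (x, y) ∈ symmCl H ∨
      ∃ m, (a m = x ∧ b m = y) ∨ (a m = y ∧ b m = x) := by
    rintro x y ((h | ⟨m, h⟩) | (h | ⟨m, h⟩))
    · exact Or.inl (Or.inl h)
    · exact Or.inr ⟨m, Or.inl (Prod.mk.inj h)⟩
    · exact Or.inl (Or.inr h)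
    · exact Or.inr ⟨m, Or.inr (Prod.mk.inj h)⟩
  obtain ⟨m, hm⟩ : ∃ m, (a m = d 0 ∧ b m = d 1) ∨ (a m = d 1 ∧ b m = d 0) := by
    rcases hslid _ _ (hd 0) with h | h
    · rw [hd0] at h
      exact (hne0 h).elim
    · exact h
  obtain ⟨⟨s, t⟩, hst⟩ := m
  let K : X → X → Prop := fun x y => (x, y) ∈ symmCl G ∧ (x, y) ≠ (s, t) ∧ (x, y) ≠ (t, s)
  have hKs : ∀ x y, K x y → K y x := by
    rintro x y ⟨h1, h2, h3⟩
    refine ⟨h1.symm, ?_, ?_⟩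
    · intro h; apply h3; rw [Prod.mk.injEq] at h ⊢; exact ⟨h.2, h.1⟩
    · intro h; apply h2; rw [Prod.mk.injEq] at h ⊢; exact ⟨h.2, h.1⟩
  have hKsymm : ∀ x y, Relation.ReflTransGen K x y → Relation.ReflTransGen K y x := by
    intro x y h
    induction h with
    | refl => exact Relation.ReflTransGen.refl
    | tail h1 h2 ih => exact Relation.ReflTransGen.head (hKs _ _ h2) ih
  have hHK : ∀ x y, (x, y) ∈ connRel (symmCl H) → Relation.ReflTransGen K x y := by
    intro x y h
    refine Relation.ReflTransGen.mono ?_ _ _ h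
    intro x y hxy
    refine ⟨hxy.imp (fun h => hHG h) fun h => hHG h, ?_, ?_⟩
    · intro h
      have : (x, y) ∈ connRel (symmCl H) := Relation.ReflTransGen.single hxy
      rw [h] at this
      exact hMH _ hst this
    · intro h
      have : (x, y) ∈ connRel (symmCl H) := Relation.ReflTransGen.single hxy
      rw [h] at this
      exact hMH _ hst (heq.symm this)
  have hedge : ∀ k, 0 < k → k < n → Relation.ReflTransGen K (d k) (d (k + 1)) := by
    intro k hk0 hkn
    rcases hslid _ _ (hd k) with h | ⟨m', hm'⟩
    · exact hHK _ _ (Relation.ReflTransGen.single h)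
    · have hab : Relation.ReflTransGen K (a m') (b m') := by
        refine ((hKsymm _ _ (hHK _ _ (ra m'))).trans ?_).trans (hHK _ _ (rb m'))
        refine Relation.ReflTransGen.single ⟨Or.inl (hMG m'.2), ?_, ?_⟩
        · intro h
          have h : m' = ⟨(s, t), hst⟩ := Subtype.ext h
          rw [h] at hm'
          have hk1 : k + 1 < n ∨ k + 1 = n := by omega
          have e1 : d k ≠ d 0 := fun h => by have := hdi k hkn 0 hnpos h; omega
          have e2 : d k = d 1 → d (k + 1) ≠ d 0 := by
            intro h h'
            have := hdi k hkn 1 (by omega) h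
            have := hdi (k + 1) (by omega) 0 hnpos h'
            omega
          rcases hm with hm | hm <;> rcases hm' with hm' | hm'
          · exact e1 (hm'.1.symm.trans hm.1)
          · exact e2 (hm'.2.symm.trans hm.2) (hm'.1.symm.trans hm.1)
          · exact e2 (hm'.1.symm.trans hm.1) (hm'.2.symm.trans hm.2)
          · exact e1 (hm'.2.symm.trans hm.2)
        · intro h
          have h : m'.1 = (t, s) := h
          have := m'.2
          rw [h] at this
          exact hMa _ _ hst this
      rcases hm' with ⟨h1, h2⟩ | ⟨h1, h2⟩
      · rw [← h1, ← h2]; exact hab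
      · rw [← h1, ← h2]; exact hKsymm _ _ hab
  have hpath : ∀ k, k < n → Relation.ReflTransGen K (d 1) (d (k + 1)) := by
    intro k
    induction k with
    | zero => intro _; exact Relation.ReflTransGen.refl
    | succ k ih =>
      intro hk
      exact (ih (by omega)).trans (hedge (k + 1) (by omega) hk)
  have h10 : Relation.ReflTransGen K (d 1) (d 0) := by
    have := hpath (n - 1) (by omega)
    rwa [Nat.sub_add_cancel (by omega), hdn] at this
  have hab : Relation.ReflTransGen K (a ⟨(s, t), hst⟩) (b ⟨(s, t), hst⟩) := by
    rcases hm with ⟨h1, h2⟩ | ⟨h1, h2⟩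
    · rw [h1, h2]; exact hKsymm _ _ h10
    · rw [h1, h2]; exact h10
  refine acyc_conn hG (hMG hst) ?_ (((hHK _ _ (ra ⟨(s, t), hst⟩)).trans hab).trans
    (hKsymm _ _ (hHK _ _ (rb ⟨(s, t), hst⟩))))
  rintro rfl
  exact hMH _ hst (heq.refl _)

variable [MeasurableSpace X] [StandardBorelSpace X]

theorem slide_final {μ : Measure X} {G H : Set (X × X)} (hHm : MeasurableSet H)
    (hGirr : ∀ p ∈ G, p.1 ≠ p.2) (hHG : H ⊆ G)
    (hEG : IsCBER (connRel (symmCl G))) (hEH : IsCBER (connRel (symmCl H)))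
    {dIn dOut : X → ℕ∞} {Y : Set X} {M : Set (X × X)} {a b : M → X}
    (S : SlideData μ G H dIn dOut Y M a b) :
    ∃ G' : Set (X × X), MeasurableSet G' ∧ H ⊆ G' ∧
      (∀ p ∈ G', p.1 ≠ p.2) ∧
      (∀ x : X, {y | (x, y) ∈ G'}.Countable ∧ {y | (y, x) ∈ G'}.Countable) ∧
      (∀ᵐ x ∂μ, ∀ y : X, ((x, y) ∈ connRel (symmCl G') ↔ (x, y) ∈ connRel (symmCl G))) ∧
      (∀ᵐ x ∂μ, {y | (y, x) ∈ G'}.encard = dIn x) ∧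
      (∀ᵐ x ∂μ, {y | (x, y) ∈ G'}.encard = dOut x) ∧
      (AcyclicGraph (symmCl G) → AcyclicGraph (symmCl G')) := by
  have hHE : connRel (symmCl H) ⊆ connRel (symmCl G) :=
    conn_mono hEG.2.1 fun p hp => sub_connRel (hHG hp)
  have : StandardBorelSpace M := S.mM.standardBorel
  have hMH : ∀ p ∈ M, p ∉ connRel (symmCl H) := fun p hp => (S.sub hp).1.2
  have habH : ∀ m, (a m, b m) ∉ connRel (symmCl H) := fun m h =>
    hMH _ m.2 (hEH.2.1.trans (S.ra m) (hEH.2.1.trans h (hEH.2.1.symm (S.rb m))))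
  have habG : ∀ m, (a m, b m) ∈ connRel (symmCl G) := fun m =>
    hEG.2.1.trans (hEG.2.1.symm (hHE (S.ra m))) (hEG.2.1.trans (sub_connRel (S.sub m.2).1.1)
      (hHE (S.rb m)))
  set G' := H ∪ range fun m => (a m, b m) with hG'
  have hGE : G' ⊆ connRel (symmCl G) := by
    rintro p (hp | ⟨m, rfl⟩)
    · exact sub_connRel (hHG hp)
    · exact habG m
  have hY : ∀ᵐ x ∂μ, x ∈ Y := by
    have := measure_eq_zero_iff_ae_notMem.1 S.nY
    filter_upwards [this] with x hx
    by_contra h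
    exact hx h
  have heq' : Equivalence fun x y => (x, y) ∈ connRel (symmCl G') := by
    refine ⟨fun x => Relation.ReflTransGen.refl, ?_, fun h1 h2 => Relation.ReflTransGen.trans h1 h2⟩
    intro x y h0
    have h : Relation.ReflTransGen (fun a b => (a, b) ∈ symmCl G') x y := h0
    clear h0
    show Relation.ReflTransGen (fun a b => (a, b) ∈ symmCl G') y x
    induction h with
    | refl => exact Relation.ReflTransGen.refl
    | tail h1 h2 ih => exact Relation.ReflTransGen.head (Or.symm h2) ih
  have hHG' : connRel (symmCl H) ⊆ connRel (symmCl G') :=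
    conn_mono heq' fun p hp => sub_connRel (Or.inl hp)
  have hMG' : ∀ x y, (x, y) ∈ M → (x, y) ∈ connRel (symmCl G') := fun x y h =>
    heq'.trans (hHG' (S.ra ⟨(x, y), h⟩)) (heq'.trans
      (sub_connRel (Or.inr ⟨⟨(x, y), h⟩, rfl⟩)) (heq'.symm (hHG' (S.rb ⟨(x, y), h⟩))))
  refine ⟨G', ?_, subset_union_left, ?_, ?_, ?_, ?_, ?_, ?_⟩
  · refine hHm.union ?_
    exact ((S.ma.prodMk S.mb).measurableEmbedding S.inj).measurableSet_range
  · rintro p (hp | ⟨m, rfl⟩)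
    · exact hGirr p (hHG hp)
    · intro h
      have h : a m = b m := h
      apply habH m
      rw [h]; exact hEH.2.1.refl _
  · intro x
    refine ⟨(hEG.2.2 x).mono fun y hy => hGE hy, (hEG.2.2 x).mono fun y hy => ?_⟩
    exact hEG.2.1.symm (hGE hy)
  · filter_upwards [hY] with x hx y
    refine ⟨fun h => conn_mono hEG.2.1 hGE h, fun h => ?_⟩
    refine conn_ind heq' S.inv ?_ hx h
    intro x hx y hxy
    by_cases hE : (x, y) ∈ connRel (symmCl H)
    · exact hHG' hE
    · rcases S.cov x hx y hxy hE with h | h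
      · exact hMG' _ _ h
      · exact heq'.symm (hMG' _ _ h)
  · filter_upwards [hY] with x hx
    rw [← S.dI x hx]
    have h1 : {y | (y, x) ∈ G'} = {y | (y, x) ∈ H} ∪ a '' {m | b m = x} := by
      ext y
      constructor
      · rintro (h | ⟨m, h⟩)
        · exact Or.inl h
        · obtain ⟨h1, h2⟩ := Prod.mk.inj h
          exact Or.inr ⟨m, h2, h1⟩
      · rintro (h | ⟨m, rfl, rfl⟩)
        · exact Or.inl h
        · exact Or.inr ⟨m, rfl⟩
    rw [h1, encard_union_eq, InjOn.encard_image]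
    · intro m hm m' hm' h
      exact S.inj (Prod.ext h (Eq.trans hm (Eq.symm hm')))
    · rw [Set.disjoint_left]
      rintro y hy ⟨m, rfl, rfl⟩
      exact habH m (sub_connRel hy)
  · filter_upwards [hY] with x hx
    rw [← S.dO x hx]
    have h1 : {y | (x, y) ∈ G'} = {y | (x, y) ∈ H} ∪ b '' {m | a m = x} := by
      ext y
      constructor
      · rintro (h | ⟨m, h⟩)
        · exact Or.inl h
        · obtain ⟨h1, h2⟩ := Prod.mk.inj h
          exact Or.inr ⟨m, h1, h2⟩
      · rintro (h | ⟨m, rfl, rfl⟩)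
        · exact Or.inl h
        · exact Or.inr ⟨m, rfl⟩
    rw [h1, encard_union_eq, InjOn.encard_image]
    · intro m hm m' hm' h
      exact S.inj (Prod.ext (Eq.trans hm (Eq.symm hm')) h)
    · rw [Set.disjoint_left]
      rintro y hy ⟨m, rfl, rfl⟩
      exact habH m (sub_connRel hy)
  · exact acyc_slide hHG hEH.2.1 (fun p hp => (S.sub hp).1.1) hMH
      (fun x y h h' => slideM_asym (S.sub h) (S.sub h')) S.ra S.rb

end
end ESl

/-- **edge sliding.** Let `G` be a locally countable directed Borel graph whose
connectedness relation is an ergodic mcp type III CBER, and `H ⊆ G` a Borel subgraph whose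
connectedness relation is ergodic mcp type III and differs from that of `G` on a non-null set.
Given Borel `d_i, d_o : X → ℕ ∪ {∞}` dominating the in/out-degrees of `H`, strictly on
non-null sets, there is a directed Borel graph `G' ⊇ H` with the same connected components as
`G` a.e., with in-degrees `d_i` and out-degrees `d_o` a.e.; moreover if the symmetrization of
`G` is acyclic then `G'` can be chosen with acyclic symmetrization. -/
theorem edge_sliding {X : Type*} [MeasurableSpace X] [StandardBorelSpace X]
    (μ : Measure X) [SigmaFinite μ]
    (G H : Set (X × X)) (hGmeas : MeasurableSet G) (hHmeas : MeasurableSet H)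
    (hGirr : ∀ p ∈ G, p.1 ≠ p.2)
    (hGlc : ∀ x : X, {y | (x, y) ∈ G}.Countable ∧ {y | (y, x) ∈ G}.Countable)
    (hHG : H ⊆ G)
    (hEG : IsCBER (connRel (symmCl G)))
    (hEGmcp : MCP μ (connRel (symmCl G)))
    (hEGerg : ErgodicRel μ (connRel (symmCl G)))
    (hEGIII : IsTypeIII μ (connRel (symmCl G)))
    (hEH : IsCBER (connRel (symmCl H)))
    (hEHmcp : MCP μ (connRel (symmCl H)))
    (hEHerg : ErgodicRel μ (connRel (symmCl H)))
    (hEHIII : IsTypeIII μ (connRel (symmCl H)))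
    (hstrict : μ {x | {y | (x, y) ∈ connRel (symmCl H)} ≠ {y | (x, y) ∈ connRel (symmCl G)}}
      ≠ 0)
    (dIn dOut : X → ℕ∞) (hdIn : Measurable dIn) (hdOut : Measurable dOut)
    (hdInLe : ∀ x : X, {y | (y, x) ∈ H}.encard ≤ dIn x)
    (hdOutLe : ∀ x : X, {y | (x, y) ∈ H}.encard ≤ dOut x)
    (hdInStrict : μ {x | {y | (y, x) ∈ H}.encard < dIn x} ≠ 0)
    (hdOutStrict : μ {x | {y | (x, y) ∈ H}.encard < dOut x} ≠ 0) :
    ∃ G' : Set (X × X), MeasurableSet G' ∧ H ⊆ G' ∧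
      (∀ p ∈ G', p.1 ≠ p.2) ∧
      (∀ x : X, {y | (x, y) ∈ G'}.Countable ∧ {y | (y, x) ∈ G'}.Countable) ∧
      (∀ᵐ x ∂μ, ∀ y : X, ((x, y) ∈ connRel (symmCl G') ↔ (x, y) ∈ connRel (symmCl G))) ∧
      (∀ᵐ x ∂μ, {y | (y, x) ∈ G'}.encard = dIn x) ∧
      (∀ᵐ x ∂μ, {y | (x, y) ∈ G'}.encard = dOut x) ∧
      (AcyclicGraph (symmCl G) → AcyclicGraph (symmCl G')) := by
  obtain ⟨Y, M, a, b, S⟩ := ESl.exists_slideData μ G H hGmeas hHmeas hHG hEG hEGmcp hEH hEHmcp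
    hEHerg hEHIII hstrict dIn dOut hdIn hdOut hdInLe hdOutLe hdInStrict hdOutStrict
  exact ESl.slide_final hHmeas hGirr hHG hEG hEH S
end
end

section
/- Let (X, μ, E) be an ergodic mcp CBER with Radon–Nikodym cocycle 𝔴, and let H ⊆ E be an ergodic subrelation such that μ is H-invariant (H is measure-preserving with respect to μ). Let ε > 0 and let 𝒟 ⊆ E − H be a non-null Borel set of directed edges such that 𝔴(y,x) ≥ e^ε for every (y,x) ∈ 𝒟, and such that distinct edges of 𝒟 have pairwise disjoint endpoint sets. Then the subrelation H' ⊆ E generated by H together with the pairs in 𝒟 is an ergodic mcp CBER of type III. -/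
open MeasureTheory Set Filter
open scoped ENNReal ENat Topology

noncomputable section

variable {X : Type*}

namespace LN

def Small {Z X : Type*} [MeasurableSpace Z] (q : Z → X) (S : Set Z) : Prop :=
  ∃ 𝓑 : Set (Set Z), 𝓑.Countable ∧ (∀ B ∈ 𝓑, MeasurableSet B ∧ InjOn q B) ∧ S ⊆ ⋃₀ 𝓑

lemma Small.iUnion {Z X ι : Type*} [MeasurableSpace Z] {q : Z → X} [Countable ι] {S : ι → Set Z}
    (h : ∀ i, Small q (S i)) : Small q (⋃ i, S i) := by
  choose B hc hm hs using h
  refine ⟨⋃ i, B i, countable_iUnion hc, ?_, ?_⟩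
  · intro b hb
    obtain ⟨i, hi⟩ := mem_iUnion.1 hb
    exact hm i b hi
  · intro z hz
    obtain ⟨i, hi⟩ := mem_iUnion.1 hz
    obtain ⟨b, hb, hzb⟩ := hs i hi
    exact ⟨b, mem_iUnion.2 ⟨i, hb⟩, hzb⟩

lemma Small.mono {Z X : Type*} [MeasurableSpace Z] {q : Z → X} {S T : Set Z}
    (h : Small q T) (hST : S ⊆ T) : Small q S := by
  obtain ⟨B, h1, h2, h3⟩ := h
  exact ⟨B, h1, h2, hST.trans h3⟩

lemma Small.empty {Z X : Type*} [MeasurableSpace Z] {q : Z → X} : Small q (∅ : Set Z) :=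
  ⟨∅, countable_empty, by simp, by simp⟩

def Bad {Z X ι : Type*} [MeasurableSpace Z] [MeasurableSpace X] (q : Z → X) (U : ι → Set Z) :
    Prop :=
  ∃ 𝒜 : Set (Set X), 𝒜.Countable ∧
    (∀ A ∈ 𝒜, MeasurableSet A ∧ ∃ i, Small q (U i ∩ q ⁻¹' A)) ∧ ⋂ i, q '' U i ⊆ ⋃₀ 𝒜

lemma Bad.of_comp {Z X ι κ : Type*} [MeasurableSpace Z] [MeasurableSpace X] {q : Z → X}
    {U : ι → Set Z} {e : κ → ι} (he : Function.Surjective e) (h : Bad q (fun k => U (e k))) :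
    Bad q U := by
  obtain ⟨A, h1, h2, h3⟩ := h
  refine ⟨A, h1, fun a ha => ⟨(h2 a ha).1, ?_⟩, ?_⟩
  · obtain ⟨k, hk⟩ := (h2 a ha).2
    exact ⟨e k, hk⟩
  · rwa [he.iInter_comp (fun i => q '' U i)] at h3

lemma ainter {X : Type*} [TopologicalSpace X] [T2Space X] {S T : Set X}
    (hS : AnalyticSet S) (hT : AnalyticSet T) : AnalyticSet (S ∩ T) := by
  have h3 : AnalyticSet (⋂ b : Bool, cond b S T) := by
    refine AnalyticSet.iInter ?_
    rintro (_ | _)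
    · exact hT
    · exact hS
  have : S ∩ T = ⋂ b : Bool, cond b S T := by
    ext x; simp [Set.mem_iInter, Bool.forall_bool, and_comm]
  rwa [this]

lemma nsep {X ι : Type*} [TopologicalSpace X] [PolishSpace X] [MeasurableSpace X] [BorelSpace X]
    (D : ι → Set X) (hD : ∀ i, AnalyticSet (D i)) (s : Finset ι) :
    ∀ T : Set X, AnalyticSet T → (T ∩ ⋂ i ∈ s, D i) = ∅ →
      ∃ C : ι → Set X, (∀ i, MeasurableSet (C i)) ∧ (∀ i, D i ⊆ C i) ∧
        (T ∩ ⋂ i ∈ s, C i) = ∅ := by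
  classical
  induction s using Finset.induction_on with
  | empty =>
    intro T hT h
    exact ⟨fun _ => univ, fun _ => MeasurableSet.univ, fun _ => subset_univ _, by simpa using h⟩
  | insert a s ha ih =>
    intro T hT h
    rw [Finset.set_biInter_insert, ← inter_assoc] at h
    obtain ⟨C, hCm, hC1, hC2⟩ := ih (T ∩ D a) (ainter hT (hD a)) h
    have han : AnalyticSet (T ∩ ⋂ i ∈ s, C i) :=
      ainter hT (Finset.measurableSet_biInter s fun i _ => hCm i).analyticSet
    have hdis : Disjoint (D a) (T ∩ ⋂ i ∈ s, C i) := by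
      rw [Set.disjoint_iff_inter_eq_empty, ← hC2]
      ext x; simp only [mem_inter_iff]; tauto
    obtain ⟨P, hP1, hP2, hPm⟩ := (hD a).measurablySeparable han hdis
    refine ⟨fun i => if i = a then P else C i, ?_, ?_, ?_⟩
    · intro i
      by_cases h : i = a <;> simp [h, hPm, hCm i]
    · intro i
      by_cases h : i = a
      · subst h; simpa using hP1
      · simpa [h] using hC1 i
    · apply eq_empty_of_forall_notMem
      rintro x ⟨hxT, hx⟩
      simp only [mem_iInter] at hx
      have h1 := hx a (by simp)
      simp only [if_true] at h1
      refine disjoint_left.1 hP2 ⟨hxT, mem_iInter₂.2 fun i hi => ?_⟩ h1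
      have h2 := hx i (by simp [hi])
      have hia : i ≠ a := by rintro rfl; exact ha hi
      simpa only [hia, if_false] using h2

lemma exists_nbhd {Z : Type*} [MetricSpace Z] {𝓒 : Set (Set Z)}
    (h𝓒 : TopologicalSpace.IsTopologicalBasis 𝓒) {U : Set Z} (hU : IsOpen U) {z z' : Z}
    (hz : z ∈ U) (hne : z ≠ z') {r : ℝ} (hr : 0 < r) :
    ∃ V ∈ 𝓒, z ∈ V ∧ closure V ⊆ U ∧ (∀ a ∈ V, ∀ b ∈ V, dist a b ≤ r) ∧
      V ⊆ Metric.ball z (dist z z' / 2) := by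
  have hd : 0 < dist z z' := dist_pos.2 hne
  have hn : U ∩ Metric.ball z (min (r/2) (dist z z' / 2)) ∈ 𝓝 z :=
    inter_mem (hU.mem_nhds hz) (Metric.ball_mem_nhds _ (by positivity))
  obtain ⟨V, hV, hzV, hVs⟩ := h𝓒.exists_closure_subset hn
  refine ⟨V, hV, hzV, fun a ha => (hVs ha).1, ?_, ?_⟩
  · intro a ha b hb
    have h1 := (hVs (subset_closure ha)).2
    have h2 := (hVs (subset_closure hb)).2
    rw [Metric.mem_ball] at h1 h2
    have h3 := min_le_left (r/2) (dist z z' / 2)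
    have := dist_triangle_right a b z
    linarith
  · intro a ha
    have h1 := (hVs (subset_closure ha)).2
    rw [Metric.mem_ball] at h1 ⊢
    exact h1.trans_le (min_le_right _ _)

lemma split {Z X ι : Type*} [MetricSpace Z] [CompleteSpace Z] [SecondCountableTopology Z]
    [MeasurableSpace Z] [BorelSpace Z] [TopologicalSpace X] [PolishSpace X] [MeasurableSpace X]
    [BorelSpace X] [Finite ι] {q : Z → X} (hq : Continuous q) {U : ι → Set Z}
    (hU : ∀ i, IsOpen (U i)) (hbad : ¬ Bad q U) {r : ℝ} (hr : 0 < r) :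
    ∃ V : ι → Bool → Set Z, (∀ i b, IsOpen (V i b)) ∧ (∀ i b, closure (V i b) ⊆ U i) ∧
      (∀ i b, ∀ x ∈ V i b, ∀ y ∈ V i b, dist x y ≤ r) ∧
      (∀ i, Disjoint (V i false) (V i true)) ∧ ¬ Bad q (fun p : ι × Bool => V p.1 p.2) := by
  classical
  by_contra hcon
  apply hbad
  obtain ⟨𝓒, h𝓒c, -, h𝓒⟩ := TopologicalSpace.exists_countable_basis Z
  let G : ι → Type _ := fun i => {p : Bool → 𝓒 // (∀ b, closure (p b : Set Z) ⊆ U i) ∧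
    (∀ b, ∀ x ∈ (p b : Set Z), ∀ y ∈ (p b : Set Z), dist x y ≤ r) ∧
    Disjoint (p false : Set Z) (p true : Set Z)}
  have : Countable 𝓒 := h𝓒c.to_subtype
  have hGc : ∀ i, Countable (G i) := fun i => inferInstance
  have hB : ∀ v : (i : ι) → G i, Bad q (fun p : ι × Bool => ((v p.1).1 p.2 : Set Z)) := by
    intro v
    by_contra hv
    exact hcon ⟨fun i b => ((v i).1 b : Set Z), fun i b => h𝓒.isOpen ((v i).1 b).2,
      fun i b => (v i).2.1 b, fun i b => (v i).2.2.1 b, fun i => (v i).2.2.2, hv⟩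
  choose 𝒜 h𝒜c h𝒜 h𝒜cov using hB
  have h𝒜c' : ∀ v, Countable (𝒜 v) := fun v => (h𝒜c v).to_subtype
  let N : ι → Set Z := fun i => ⋃ v : (i : ι) → G i, ⋃ A : 𝒜 v, ⋃ b : Bool,
    if Small q (((v i).1 b : Set Z) ∩ q ⁻¹' A) then ((v i).1 b : Set Z) ∩ q ⁻¹' A else ∅
  have hN : ∀ i, Small q (N i) := by
    intro i
    refine Small.iUnion fun v => Small.iUnion fun A => Small.iUnion fun b => ?_
    split_ifs with h
    · exact h
    · exact Small.empty
  choose 𝓑 h𝓑c h𝓑 h𝓑cov using hN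
  let M : ι → Set Z := fun i => ⋃₀ 𝓑 i
  have hMm : ∀ i, MeasurableSet (M i) := fun i =>
    MeasurableSet.sUnion (h𝓑c i) fun b hb => (h𝓑 i b hb).1
  let D : ι → Set X := fun i =>
    (fun p : Z × Z => q p.1) '' {p | (p.1 ∈ U i \ M i ∧ p.2 ∈ U i \ M i) ∧ p.1 ≠ p.2 ∧ q p.1 = q p.2}
  have hUM : ∀ i, MeasurableSet (U i \ M i) := fun i => (hU i).measurableSet.diff (hMm i)
  have hD : ∀ i, AnalyticSet (D i) := by
    intro i
    refine MeasurableSet.analyticSet_image ?_ (hq.measurable.comp measurable_fst)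
    refine ((measurable_fst (hUM i)).inter (measurable_snd (hUM i))).inter ?_
    refine (measurableSet_eq_fun measurable_fst measurable_snd).compl.inter ?_
    exact measurableSet_eq_fun (hq.measurable.comp measurable_fst)
      (hq.measurable.comp measurable_snd)
  cases nonempty_fintype ι
  obtain ⟨C, hCm, hDC, hC⟩ := nsep D hD Finset.univ univ MeasurableSet.univ.analyticSet (by
    apply eq_empty_of_forall_notMem
    rintro x ⟨-, hx⟩
    simp only [mem_iInter, Finset.mem_univ, true_imp_iff] at hx
    have hx' : ∀ i, ∃ p : Z × Z, ((p.1 ∈ U i \ M i ∧ p.2 ∈ U i \ M i) ∧ p.1 ≠ p.2 ∧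
      q p.1 = q p.2) ∧ q p.1 = x := fun i => by
        obtain ⟨p, hp, hpx⟩ := hx i
        exact ⟨p, hp, hpx⟩
    choose p hp hpx using hx'
    have hv : ∀ i, ∃ v : G i, (p i).1 ∈ (v.1 false : Set Z) ∧ (p i).2 ∈ (v.1 true : Set Z) := by
      intro i
      obtain ⟨V, hV, hzV, hVU, hVd, hVb⟩ := exists_nbhd h𝓒 (hU i) (hp i).1.1.1 (hp i).2.1 hr
      obtain ⟨W, hW, hzW, hWU, hWd, hWb⟩ := exists_nbhd h𝓒 (hU i) (hp i).1.2.1 (hp i).2.1.symm hr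
      refine ⟨⟨fun b => if b then ⟨W, hW⟩ else ⟨V, hV⟩, ?_, ?_, ?_⟩, ?_, ?_⟩
      · rintro (_ | _)
        · simpa using hVU
        · simpa using hWU
      · rintro (_ | _)
        · simpa using hVd
        · simpa using hWd
      · simp only [Bool.false_eq_true, if_false, if_true]
        refine Disjoint.mono hVb hWb (Metric.ball_disjoint_ball ?_)
        rw [dist_comm (p i).2]; linarith
      · simpa using hzV
      · simpa using hzW
    choose v hv1 hv2 using hv
    have hxA : x ∈ ⋃₀ 𝒜 v := by
      apply h𝒜cov v
      refine mem_iInter.2 ?_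
      rintro ⟨i, _ | _⟩
      · exact ⟨_, hv1 i, hpx i⟩
      · exact ⟨_, hv2 i, (hp i).2.2.symm.trans (hpx i)⟩
    obtain ⟨A, hA, hxA⟩ := hxA
    obtain ⟨-, ⟨i, b⟩, hi⟩ := h𝒜 v A hA
    have key : ∀ z, z ∈ ((v i).1 b : Set Z) → q z = x → z ∈ M i := by
      intro z hz hzx
      apply h𝓑cov i
      refine mem_iUnion.2 ⟨v, mem_iUnion.2 ⟨⟨A, hA⟩, mem_iUnion.2 ⟨b, ?_⟩⟩⟩
      rw [if_pos hi]
      exact ⟨hz, by simpa [hzx] using hxA⟩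
    cases b
    · exact (hp i).1.1.2 (key _ (hv1 i) (hpx i))
    · exact (hp i).1.2.2 (key _ (hv2 i) ((hp i).2.2.symm.trans (hpx i))))
  refine ⟨range fun i => (C i)ᶜ, countable_range _, ?_, ?_⟩
  · rintro _ ⟨i, rfl⟩
    refine ⟨(hCm i).compl, i, insert ((U i \ M i) ∩ q ⁻¹' (C i)ᶜ) (𝓑 i), (h𝓑c i).insert _, ?_, ?_⟩
    · rintro B (rfl | hB)
      · refine ⟨(hUM i).inter (hq.measurable (hCm i).compl), ?_⟩
        intro a ha b hb hab
        by_contra hne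
        exact ha.2 (hDC i ⟨(a, b), ⟨⟨ha.1, hb.1⟩, hne, hab⟩, rfl⟩)
      · exact h𝓑 i B hB
    · rintro z ⟨hz, hzC⟩
      by_cases hzM : z ∈ M i
      · obtain ⟨B, hB, hzB⟩ := hzM
        exact ⟨B, Or.inr hB, hzB⟩
      · exact ⟨_, Or.inl rfl, ⟨hz, hzM⟩, hzC⟩
  · intro x _
    by_contra hx
    have : x ∈ univ ∩ ⋂ i ∈ Finset.univ, C i := by
      refine ⟨trivial, mem_iInter₂.2 fun i _ => ?_⟩
      by_contra hi
      exact hx ⟨_, ⟨i, rfl⟩, hi⟩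
    rw [hC] at this
    exact this

end LN

namespace LN

lemma not_countable_cantor : ¬ Countable (ℕ → Bool) := by
  have h2 : Cardinal.mk (ℕ → Bool) = Cardinal.continuum := by simp
  intro h
  have h1 := Cardinal.mk_le_aleph0_iff.2 h
  rw [h2] at h1
  exact absurd h1 (not_le.2 Cardinal.aleph0_lt_continuum)

lemma tree {Z X : Type*} [MetricSpace Z] [CompleteSpace Z] [SecondCountableTopology Z]
    [MeasurableSpace Z] [BorelSpace Z] [TopologicalSpace X] [PolishSpace X] [MeasurableSpace X]
    [BorelSpace X] {q : Z → X} (hq : Continuous q)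
    (hbad : ¬ Bad q (fun _ : Fin 0 → Bool => (univ : Set Z))) :
    ∃ x, ¬ (q ⁻¹' {x}).Countable := by
  classical
  let T : ℕ → Type _ := fun n =>
    {U : (Fin n → Bool) → Set Z // (∀ s, IsOpen (U s)) ∧ ¬ Bad q U}
  have step : ∀ n (U : T n), ∃ U' : T (n+1),
      (∀ s, closure (U'.1 s) ⊆ U.1 (Fin.init s)) ∧
      (∀ s, ∀ x ∈ U'.1 s, ∀ y ∈ U'.1 s, dist x y ≤ (1/2 : ℝ)^n) ∧
      (∀ s s', Fin.init s = Fin.init s' → s (Fin.last n) ≠ s' (Fin.last n) →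
        Disjoint (U'.1 s) (U'.1 s')) := by
    rintro n ⟨U, hU, hb⟩
    obtain ⟨V, h1, h2, h3, h4, h5⟩ := split hq hU hb (r := (1/2:ℝ)^n) (by positivity)
    refine ⟨⟨fun s => V (Fin.init s) (s (Fin.last n)), fun s => h1 _ _, ?_⟩, fun s => h2 _ _,
      fun s => h3 _ _, ?_⟩
    · intro hB
      apply h5
      refine Bad.of_comp (e := fun s : Fin (n+1) → Bool =>
        ((Fin.init s : Fin n → Bool), s (Fin.last n))) ?_ hB
      rintro ⟨a, b⟩
      exact ⟨Fin.snoc (α := fun _ => Bool) a b, by simp⟩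
    · intro s s' hss hne
      show Disjoint (V (Fin.init s) (s (Fin.last n))) (V (Fin.init s') (s' (Fin.last n)))
      rw [← hss]
      generalize s (Fin.last n) = a at *
      generalize s' (Fin.last n) = b at *
      cases a <;> cases b
      · exact absurd rfl hne
      · exact h4 _
      · exact (h4 _).symm
      · exact absurd rfl hne
  choose nxt hn1 hn2 hn3 using step
  let U : (n : ℕ) → T n := fun n => Nat.rec ⟨fun _ => univ, fun _ => isOpen_univ, hbad⟩ nxt n
  have hUs : ∀ n, U (n+1) = nxt n (U n) := fun n => rfl
  have hne : ∀ n, ∃ x, x ∈ ⋂ s, q '' ((U n).1 s) := by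
    intro n
    by_contra h
    apply (U n).2.2
    refine ⟨∅, countable_empty, by simp, ?_⟩
    intro x hx
    exact (h ⟨x, hx⟩).elim
  choose x hx using hne
  have hz : ∀ n s, ∃ z ∈ (U n).1 s, q z = x n := fun n s => by
    obtain ⟨z, hz, h⟩ := mem_iInter.1 (hx n) s
    exact ⟨z, hz, h⟩
  choose z hzU hzx using hz
  let res : (ℕ → Bool) → (n : ℕ) → Fin n → Bool := fun b n i => b i
  have hres : ∀ b n, Fin.init (res b (n+1)) = res b n := fun b n => rfl
  have hmono : ∀ b n m, n ≤ m → (U m).1 (res b m) ⊆ (U n).1 (res b n) := by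
    intro b n m hnm
    induction m, hnm using Nat.le_induction with
    | base => exact Subset.rfl
    | succ m _ ih =>
      refine Subset.trans ?_ ih
      have := hn1 m (U m) (res b (m+1))
      rw [hres] at this
      exact subset_closure.trans this
  have hcau : ∀ b, CauchySeq (fun n => z (n+1) (res b (n+1))) := by
    intro b
    refine cauchySeq_of_le_geometric (1/2) 1 (by norm_num) fun n => ?_
    rw [one_mul]
    exact hn2 n (U n) (res b (n+1)) _ (hzU (n+1) (res b (n+1))) _
      (hmono b (n+1) (n+2) (by omega) (hzU (n+2) (res b (n+2))))
  choose L hL using fun b => cauchySeq_tendsto_of_complete (hcau b)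
  have hLU : ∀ b n, L b ∈ (U n).1 (res b n) := by
    intro b n
    have h1 : L b ∈ closure ((U (n+1)).1 (res b (n+1))) := by
      refine mem_closure_of_tendsto (hL b) ?_
      filter_upwards [eventually_ge_atTop n] with m hm
      exact hmono b (n+1) (m+1) (by omega) (hzU (m+1) (res b (m+1)))
    have := hn1 n (U n) (res b (n+1)) h1
    rwa [hres] at this
  have hqL : ∀ b, Tendsto (fun n => x (n+1)) atTop (𝓝 (q (L b))) := by
    intro b
    have h := (hq.tendsto (L b)).comp (hL b)
    refine h.congr fun n => ?_
    exact hzx _ _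
  have hinj : Function.Injective L := by
    intro b b' hbb
    by_contra hne
    have hex : ∃ n, b n ≠ b' n := by
      by_contra h; push Not at h; exact hne (funext h)
    let n := Nat.find hex
    have hd := hn3 n (U n) (res b (n+1)) (res b' (n+1)) (by
      rw [hres, hres]
      funext i
      have := Nat.find_min hex i.2
      simpa using this) (Nat.find_spec hex)
    refine disjoint_left.1 hd (hLU b (n+1)) ?_
    rw [hbb]
    exact hLU b' (n+1)
  refine ⟨q (L fun _ => false), fun hc => not_countable_cantor ?_⟩
  have : Countable (q ⁻¹' {q (L fun _ => false)}) := hc.to_subtype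
  let F : (ℕ → Bool) → q ⁻¹' {q (L fun _ => false)} := fun b =>
    ⟨L b, tendsto_nhds_unique (hqL b) (hqL _)⟩
  exact Function.Injective.countable (f := F) fun b b' h => hinj (congrArg Subtype.val h)

/-- Lusin--Novikov. -/
theorem lusin_novikov {Z X : Type*} [mZ : MeasurableSpace Z] [StandardBorelSpace Z]
    [MeasurableSpace X] [StandardBorelSpace X] {q : Z → X} (hq : Measurable q)
    (hc : ∀ x, (q ⁻¹' {x}).Countable) :
    ∃ B : ℕ → Set Z, (∀ n, MeasurableSet (B n)) ∧ (∀ n, InjOn q (B n)) ∧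
      Pairwise (fun i j => Disjoint (B i) (B j)) ∧ ⋃ n, B n = univ := by
  have hS : Small q univ := by
    let := upgradeStandardBorel X
    let tZ := upgradeStandardBorel Z
    obtain ⟨t', ht', hcont, hpol⟩ := hq.exists_continuous
    have hb : @BorelSpace Z t' mZ := by
      constructor
      rw [eq_borel_upgradeStandardBorel Z]
      exact (borel_eq_borel_of_le hpol (@UpgradedStandardBorel.toPolishSpace Z tZ) ht').symm
    clear ht'
    clear tZ
    let := TopologicalSpace.upgradeIsCompletelyMetrizable Z
    have hbad : Bad q (fun _ : Fin 0 → Bool => (univ : Set Z)) := by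
      by_contra h
      obtain ⟨x, hx⟩ := tree hcont h
      exact hx (hc x)
    obtain ⟨A, hAc, hA, hcov⟩ := hbad
    have : Countable A := hAc.to_subtype
    refine Small.mono (Small.iUnion (ι := A) (S := fun a => q ⁻¹' a) fun a => ?_) ?_
    · obtain ⟨i, hi⟩ := (hA a a.2).2
      simpa using hi
    · intro z _
      obtain ⟨a, ha, hza⟩ := hcov (show q z ∈ ⋂ i : Fin 0 → Bool, q '' univ from
        mem_iInter.2 fun i => ⟨z, trivial, rfl⟩)
      exact mem_iUnion.2 ⟨⟨a, ha⟩, hza⟩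
  obtain ⟨𝓑, h1, h2, h3⟩ := hS
  obtain ⟨f, hf⟩ := (h1.insert ∅).exists_eq_range ⟨∅, by simp⟩
  have hfB : ∀ n, MeasurableSet (f n) ∧ InjOn q (f n) := by
    intro n
    have : f n ∈ insert ∅ 𝓑 := by rw [hf]; exact ⟨n, rfl⟩
    rcases this with h | h
    · rw [h]; simp
    · exact h2 _ h
  refine ⟨disjointed f, fun n => MeasurableSet.disjointed (fun n => (hfB n).1) n,
    fun n => (hfB n).2.mono (disjointed_subset f n), disjoint_disjointed f, ?_⟩
  rw [iUnion_disjointed]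
  apply eq_univ_of_univ_subset
  intro z hz
  obtain ⟨b, hb, hzb⟩ := h3 hz
  have : b ∈ range f := by rw [← hf]; exact Or.inr hb
  obtain ⟨n, rfl⟩ := this
  exact mem_iUnion.2 ⟨n, hzb⟩

/-- Countable-to-one images of Borel sets are Borel. -/
theorem image_countable_to_one {Z X : Type*} [MeasurableSpace Z] [StandardBorelSpace Z]
    [MeasurableSpace X] [StandardBorelSpace X] {q : Z → X} (hq : Measurable q) {S : Set Z}
    (hS : MeasurableSet S) (hc : ∀ x, (S ∩ q ⁻¹' {x}).Countable) : MeasurableSet (q '' S) := by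
  have := hS.standardBorel
  obtain ⟨B, hBm, hBi, -, hBu⟩ := lusin_novikov (Z := S) (q := fun z => q z)
    (hq.comp measurable_subtype_coe) (fun x => by
      have := (hc x).preimage (f := ((↑) : S → Z)) Subtype.val_injective
      refine this.mono ?_
      intro z hz
      exact ⟨z.2, hz⟩)
  have : q '' S = ⋃ n, (fun z : S => q z) '' B n := by
    rw [← image_iUnion, hBu]
    ext x; simp
  rw [this]
  exact MeasurableSet.iUnion fun n =>
    (hBm n).image_of_measurable_injOn (hq.comp measurable_subtype_coe) (hBi n)

end LN

namespace LN

/-- A Borel set of pairs with countable vertical and horizontal sections is a countable union of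
graphs of Borel partial injections. -/
theorem partial_inj {X : Type*} [MeasurableSpace X] [StandardBorelSpace X] {R : Set (X × X)}
    (hR : MeasurableSet R) (h1 : ∀ x, {y | (x, y) ∈ R}.Countable)
    (h2 : ∀ y, {x | (x, y) ∈ R}.Countable) :
    ∃ G : ℕ × ℕ → Set (X × X), (∀ n, MeasurableSet (G n)) ∧ (∀ n, InjOn Prod.fst (G n)) ∧
      (∀ n, InjOn Prod.snd (G n)) ∧ ⋃ n, G n = R := by
  have := hR.standardBorel
  have e := MeasurableEmbedding.subtype_coe hR
  obtain ⟨B, hBm, hBi, -, hBu⟩ := lusin_novikov (Z := R) (q := fun z => z.1.1)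
    (measurable_fst.comp measurable_subtype_coe) (fun x => by
      refine Set.Countable.mono ?_ (((h1 x).image (fun y => (x, y))).preimage
        (f := ((↑) : R → X × X)) Subtype.val_injective)
      rintro ⟨⟨a, b⟩, hab⟩ (h : a = x)
      subst h
      exact ⟨b, hab, rfl⟩)
  obtain ⟨C, hCm, hCi, -, hCu⟩ := lusin_novikov (Z := R) (q := fun z => z.1.2)
    (measurable_snd.comp measurable_subtype_coe) (fun x => by
      refine Set.Countable.mono ?_ (((h2 x).image (fun y => (y, x))).preimage
        (f := ((↑) : R → X × X)) Subtype.val_injective)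
      rintro ⟨⟨a, b⟩, hab⟩ (h : b = x)
      subst h
      exact ⟨a, hab, rfl⟩)
  refine ⟨fun n => (↑) '' (B n.1 ∩ C n.2), fun n => e.measurableSet_image.2
    ((hBm _).inter (hCm _)), ?_, ?_, ?_⟩
  · rintro n _ ⟨a, ha, rfl⟩ _ ⟨b, hb, rfl⟩ hab
    rw [hBi n.1 ha.1 hb.1 hab]
  · rintro n _ ⟨a, ha, rfl⟩ _ ⟨b, hb, rfl⟩ hab
    rw [hCi n.2 ha.2 hb.2 hab]
  · ext p
    constructor
    · intro hp
      obtain ⟨n, a, -, rfl⟩ := mem_iUnion.1 hp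
      exact a.2
    · intro hp
      have hb : (⟨p, hp⟩ : R) ∈ ⋃ n, B n := by rw [hBu]; trivial
      have hc : (⟨p, hp⟩ : R) ∈ ⋃ n, C n := by rw [hCu]; trivial
      obtain ⟨n, hn⟩ := mem_iUnion.1 hb
      obtain ⟨m, hm⟩ := mem_iUnion.1 hc
      exact mem_iUnion.2 ⟨(n, m), ⟨p, hp⟩, ⟨hn, hm⟩, rfl⟩

theorem measurableSet_comp {X : Type*} [MeasurableSpace X] [StandardBorelSpace X]
    {R S : Set (X × X)} (hR : MeasurableSet R) (hS : MeasurableSet S)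
    (h1 : ∀ x, {y | (x, y) ∈ R}.Countable) :
    MeasurableSet {p : X × X | ∃ y, (p.1, y) ∈ R ∧ (y, p.2) ∈ S} := by
  let T : Set ((X × X) × X) := {t | (t.1.1, t.2) ∈ R ∧ (t.2, t.1.2) ∈ S}
  have hT : MeasurableSet T := by
    refine MeasurableSet.inter ?_ ?_
    · exact ((measurable_fst.comp measurable_fst).prodMk measurable_snd) hR
    · exact (measurable_snd.prodMk (measurable_snd.comp measurable_fst)) hS
  have := image_countable_to_one (q := (Prod.fst : (X × X) × X → X × X)) measurable_fst hT
    (fun p => by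
      refine ((h1 p.1).image (fun y => (p, y))).mono ?_
      rintro ⟨p', y⟩ ⟨h, rfl⟩
      exact ⟨y, h.1, rfl⟩)
  convert this using 1
  ext p
  constructor
  · rintro ⟨y, h⟩
    exact ⟨(p, y), h, rfl⟩
  · rintro ⟨⟨p', y⟩, h, rfl⟩
    exact ⟨y, h⟩

theorem nuL_eq {X : Type*} [MeasurableSpace X] [StandardBorelSpace X] (μ : Measure X)
    {G : Set (X × X)} (hG : MeasurableSet G) (hi : InjOn Prod.fst G) :
    nuL μ G = μ (Prod.fst '' G) := by
  have hm := hG.image_of_measurable_injOn measurable_fst hi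
  rw [nuL, lintL, ← lintegral_indicator_one hm]
  congr 1
  ext x
  by_cases hx : x ∈ Prod.fst '' G
  · rw [indicator_of_mem hx]
    obtain ⟨⟨a, b⟩, h, rfl⟩ := hx
    have : Unique {y : X // (a, y) ∈ G} := ⟨⟨b, h⟩, fun y => Subtype.ext
      (congrArg Prod.snd (hi y.2 h rfl : (a, y.1) = (a, b)))⟩
    simp
  · rw [indicator_of_notMem hx]
    have : IsEmpty {y : X // (x, y) ∈ G} := ⟨fun y => hx ⟨_, y.2, rfl⟩⟩
    simp

theorem lintR_ge {X : Type*} [MeasurableSpace X] [StandardBorelSpace X] (μ : Measure X)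
    {G : Set (X × X)} (hG : MeasurableSet G) (hi : InjOn Prod.snd G) {w : X × X → ℝ≥0∞} {c : ℝ≥0∞}
    (hc : ∀ e ∈ G, c ≤ w e) : c * μ (Prod.snd '' G) ≤ lintR μ w G := by
  have hm := hG.image_of_measurable_injOn measurable_snd hi
  rw [lintR, ← lintegral_indicator_const hm]
  refine lintegral_mono fun x => ?_
  by_cases hx : x ∈ Prod.snd '' G
  · rw [indicator_of_mem hx]
    obtain ⟨⟨a, b⟩, h, rfl⟩ := hx
    refine (hc _ h).trans ?_
    exact ENNReal.le_tsum (f := fun y : {y : X // (y, b) ∈ G} => w (y.1, b)) ⟨a, h⟩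
  · rw [indicator_of_notMem hx]
    exact zero_le

theorem nuR_eq {X : Type*} [MeasurableSpace X] [StandardBorelSpace X] (μ : Measure X)
    {G : Set (X × X)} (hG : MeasurableSet G) (hi : InjOn Prod.snd G) :
    nuR μ G = μ (Prod.snd '' G) := by
  have hm := hG.image_of_measurable_injOn measurable_snd hi
  rw [nuR, lintR, ← lintegral_indicator_one hm]
  congr 1
  ext x
  by_cases hx : x ∈ Prod.snd '' G
  · rw [indicator_of_mem hx]
    obtain ⟨⟨a, b⟩, h, rfl⟩ := hx
    have : Unique {y : X // (y, b) ∈ G} := ⟨⟨a, h⟩, fun y => Subtype.ext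
      (congrArg Prod.fst (hi y.2 h rfl : (y.1, b) = (a, b)))⟩
    simp
  · rw [indicator_of_notMem hx]
    have : IsEmpty {y : X // (y, x) ∈ G} := ⟨fun y => hx ⟨_, y.2, rfl⟩⟩
    simp

/-- An invariant measure gives equal measure to both projections of a partial injection. -/
theorem inv_eq {X : Type*} [MeasurableSpace X] [StandardBorelSpace X] {μ' : Measure X}
    {E G : Set (X × X)} (hinv : InvariantUnder μ' E) (hGE : G ⊆ E)
    (hG : MeasurableSet G) (hi : InjOn Prod.fst G) (hi2 : InjOn Prod.snd G) :
    μ' (Prod.fst '' G) = μ' (Prod.snd '' G) := by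
  have := hG.standardBorel
  have he : MeasurableEmbedding (fun z : G => z.1.1) :=
    Measurable.measurableEmbedding (measurable_fst.comp measurable_subtype_coe)
      (fun a b h => Subtype.ext (hi a.2 b.2 h))
  obtain ⟨f, hf, hfe⟩ := he.exists_measurable_extend (g := fun z : G => z.1.2)
    (measurable_snd.comp measurable_subtype_coe) (fun x => ⟨x⟩)
  have hfe' : ∀ p ∈ G, f p.1 = p.2 := fun p hp => congrFun hfe ⟨p, hp⟩
  have hm := hG.image_of_measurable_injOn measurable_fst hi
  have h := hinv f (Prod.fst '' G) hf hm (by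
      rintro _ ⟨p, hp, rfl⟩ _ ⟨p', hp', rfl⟩ hpp
      rw [hfe' p hp, hfe' p' hp'] at hpp
      rw [hi2 hp hp' hpp]) (by
      rintro _ ⟨p, hp, rfl⟩
      rw [hfe' p hp]
      exact hGE hp)
  have himg : f '' (Prod.fst '' G) = Prod.snd '' G := by
    rw [image_image]
    exact image_congr hfe'
  have h2 := congrArg (fun m => m univ) h
  simpa [Measure.map_apply hf, himg] using h2

theorem const_of {X : Type*} [MeasurableSpace X] {μ : Measure X} {g : X → ℝ≥0∞}
    (h : ∀ c : ℝ≥0∞, μ {x | g x < c} = 0 ∨ μ {x | c ≤ g x} = 0) : ∃ k, ∀ᵐ x ∂μ, g x = k := by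
  let S : Set ℚ := {q | μ {x | g x < ENNReal.ofReal q} = 0}
  refine ⟨⨆ q ∈ S, ENNReal.ofReal (q : ℝ), ?_⟩
  have h1 : ∀ᵐ x ∂μ, ∀ q : ℚ, q ∈ S → ENNReal.ofReal q ≤ g x := by
    rw [ae_all_iff]
    intro q
    by_cases hq : q ∈ S
    · have : ∀ᵐ x ∂μ, ¬ g x < ENNReal.ofReal q := by
        rw [ae_iff]; simpa using (show μ {x | g x < ENNReal.ofReal q} = 0 from hq)
      filter_upwards [this] with x hx _
      exact not_lt.1 hx
    · exact Eventually.of_forall fun x h => absurd h hq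
  have h2 : ∀ᵐ x ∂μ, ∀ q : ℚ, q ∉ S → g x < ENNReal.ofReal q := by
    rw [ae_all_iff]
    intro q
    by_cases hq : q ∈ S
    · exact Eventually.of_forall fun x h => absurd hq h
    · have h3 := (h (ENNReal.ofReal q)).resolve_left hq
      have : ∀ᵐ x ∂μ, ¬ ENNReal.ofReal q ≤ g x := by
        rw [ae_iff]; simpa using h3
      filter_upwards [this] with x hx _
      exact not_le.1 hx
  filter_upwards [h1, h2] with x hx1 hx2
  refine le_antisymm ?_ (iSup₂_le hx1)
  by_contra hlt
  rw [not_le] at hlt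
  obtain ⟨q, hq0, hq1, hq2⟩ := ENNReal.lt_iff_exists_rat_btwn.1 hlt
  have hqS : q ∉ S := fun hqS =>
    absurd (le_iSup₂ (f := fun (q : ℚ) (_ : q ∈ S) => ENNReal.ofReal (q:ℝ)) q hqS)
      (not_le.2 hq1)
  exact absurd (hx2 q hqS) (not_lt.2 hq2.le)

end LN

/-- Let `(X, μ, E)` be an ergodic mcp CBER with cocycle `𝔴`, `H ⊆ E` an
ergodic measure-preserving subrelation, `ε > 0`, and `𝒟 ⊆ E ∖ H` a non-null Borel set of
edges with `𝔴 ≥ e^ε` on `𝒟` and pairwise disjoint endpoints. Then the subrelation generated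
by `H` and `𝒟` is an ergodic mcp type III CBER. -/
theorem generated_subrelation_typeIII {X : Type*} [MeasurableSpace X] [StandardBorelSpace X]
    (μ : Measure X) [SigmaFinite μ]
    (E : Set (X × X)) (hE : IsCBER E) (hmcpE : MCP μ E) (hergE : ErgodicRel μ E)
    (w : X × X → ℝ≥0∞) (hw : IsRNCocycle μ E w)
    (H : Set (X × X)) (hHE : H ⊆ E) (hH : IsCBER H)
    (hergH : ErgodicRel μ H) (hmpH : MPrel μ H)
    (ε : ℝ) (hε : 0 < ε)
    (𝒟 : Set (X × X)) (h𝒟meas : MeasurableSet 𝒟) (h𝒟EH : 𝒟 ⊆ E \ H)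
    (h𝒟nn : nuL μ 𝒟 ≠ 0)
    (h𝒟w : ∀ e ∈ 𝒟, ENNReal.ofReal (Real.exp ε) ≤ w e)
    (h𝒟disj : ∀ e ∈ 𝒟, ∀ e' ∈ 𝒟, e ≠ e' → ({e.1, e.2} ∩ {e'.1, e'.2} : Set X) = ∅) :
    IsCBER {p : X × X | Relation.EqvGen (fun a b => (a, b) ∈ H ∨ (a, b) ∈ 𝒟) p.1 p.2} ∧
    MCP μ {p : X × X | Relation.EqvGen (fun a b => (a, b) ∈ H ∨ (a, b) ∈ 𝒟) p.1 p.2} ∧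
    ErgodicRel μ {p : X × X | Relation.EqvGen (fun a b => (a, b) ∈ H ∨ (a, b) ∈ 𝒟) p.1 p.2} ∧
    IsTypeIII μ {p : X × X | Relation.EqvGen (fun a b => (a, b) ∈ H ∨ (a, b) ∈ 𝒟) p.1 p.2} := by
  have hEeq := hE.2.1
  have hHeq := hH.2.1
  set K : Set (X × X) :=
    {p : X × X | Relation.EqvGen (fun a b => (a, b) ∈ H ∨ (a, b) ∈ 𝒟) p.1 p.2} with hK
  have hHK : H ⊆ K := fun p hp => Relation.EqvGen.rel _ _ (Or.inl hp)
  have hDK : 𝒟 ⊆ K := fun p hp => Relation.EqvGen.rel _ _ (Or.inr hp)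
  have hKE : K ⊆ E := by
    rintro ⟨a, b⟩ hab
    have hab' : Relation.EqvGen (fun a b => (a, b) ∈ H ∨ (a, b) ∈ 𝒟) a b := hab
    clear hab
    induction hab' with
    | rel x y h => exact h.elim (fun h => hHE h) (fun h => (h𝒟EH h).1)
    | refl x => exact hEeq.refl x
    | symm x y _ ih => exact hEeq.symm ih
    | trans x y z _ _ ih1 ih2 => exact hEeq.trans ih1 ih2
  have hcnt : ∀ R ⊆ E, ∀ x, {y | (x, y) ∈ R}.Countable := fun R hR x =>
    (hE.2.2 x).mono fun y hy => hR hy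
  have hcnt' : ∀ R ⊆ E, ∀ y, {x | (x, y) ∈ R}.Countable := fun R hR y =>
    (hE.2.2 y).mono fun x hx => hEeq.symm (hR hx)
  -- Borelness
  have hKm : MeasurableSet K := by
    let S : Set (X × X) := (H ∪ 𝒟) ∪ Prod.swap ⁻¹' 𝒟
    have hSm : MeasurableSet S := (hH.1.union h𝒟meas).union (measurable_swap h𝒟meas)
    have hSK : S ⊆ K := by
      rintro ⟨a, b⟩ ((h | h) | h)
      · exact hHK h
      · exact hDK h
      · exact Relation.EqvGen.symm _ _ (hDK h)
    have hSs : ∀ a b, (a, b) ∈ S → (b, a) ∈ S := by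
      rintro a b ((h | h) | h)
      · exact Or.inl (Or.inl (hHeq.symm h))
      · exact Or.inr h
      · exact Or.inl (Or.inr h)
    let P : ℕ → Set (X × X) := fun n => Nat.rec S
      (fun _ Q => {p : X × X | ∃ y, (p.1, y) ∈ S ∧ (y, p.2) ∈ Q}) n
    have hPm : ∀ n, MeasurableSet (P n) := by
      intro n
      induction n with
      | zero => exact hSm
      | succ n ih => exact LN.measurableSet_comp hSm ih (hcnt S (hSK.trans hKE))
    have hPK : ∀ n, P n ⊆ K := by
      intro n
      induction n with
      | zero => exact hSK
      | succ n ih =>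
        rintro ⟨a, b⟩ ⟨y, h1, h2⟩
        exact Relation.EqvGen.trans a y b (hSK (show (a, y) ∈ S from h1)) (ih h2)
    have hPtrans : ∀ n m a b c, (a, b) ∈ P n → (b, c) ∈ P m → (a, c) ∈ P (n + m + 1) := by
      intro n
      induction n with
      | zero =>
        intro m a b c h1 h2
        rw [Nat.zero_add]
        exact ⟨b, h1, h2⟩
      | succ n ih =>
        rintro m a b c ⟨y, h1, h2⟩ h3
        rw [show n + 1 + m + 1 = (n + m + 1) + 1 by ring]
        exact ⟨y, h1, ih m y b c h2 h3⟩
    have hPsymm : ∀ n a b, (a, b) ∈ P n → ∃ m, (b, a) ∈ P m := by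
      intro n
      induction n with
      | zero => exact fun a b h => ⟨0, hSs a b h⟩
      | succ n ih =>
        rintro a b ⟨y, h1, h2⟩
        obtain ⟨m, hm⟩ := ih y b h2
        exact ⟨m + 0 + 1, hPtrans m 0 b y a hm (hSs _ _ h1)⟩
    have : K = ⋃ n, P n := by
      refine Subset.antisymm ?_ (iUnion_subset hPK)
      rintro ⟨a, b⟩ hab
      have hab' : Relation.EqvGen (fun a b => (a, b) ∈ H ∨ (a, b) ∈ 𝒟) a b := hab
      clear hab
      rw [mem_iUnion]
      induction hab' with
      | rel x y h => exact ⟨0, Or.inl h⟩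
      | refl x => exact ⟨0, Or.inl (Or.inl (hHeq.refl x))⟩
      | symm x y _ ih =>
        obtain ⟨n, hn⟩ := ih
        exact hPsymm n _ _ hn
      | trans x y z _ _ ih1 ih2 =>
        obtain ⟨n, hn⟩ := ih1
        obtain ⟨m, hm⟩ := ih2
        exact ⟨n + m + 1, hPtrans n m _ _ _ hn hm⟩
    rw [this]
    exact MeasurableSet.iUnion hPm
  refine ⟨⟨hKm, ⟨fun x => Relation.EqvGen.refl x, fun h => Relation.EqvGen.symm _ _ h,
    fun h1 h2 => Relation.EqvGen.trans _ _ _ h1 h2⟩, hcnt K hKE⟩,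
    fun A hA hAm => hmcpE A (hA.trans hKE) hAm, ?_, ?_⟩
  · intro A hA hA0
    refine measure_mono_null ?_ (hergH A hA hA0)
    apply compl_subset_compl.2
    rintro x ⟨y, hy, hxy⟩
    exact ⟨y, hy, hHK hxy⟩
  -- type III
  rintro ⟨μ', hσ, ⟨hac, hac'⟩, hinv⟩
  let g := μ'.rnDeriv μ
  have hgm : Measurable g := Measure.measurable_rnDeriv _ _
  have hμ' : μ.withDensity g = μ' := Measure.withDensity_rnDeriv_eq μ' μ hac
  have hconst : ∃ k, ∀ᵐ x ∂μ, g x = k := by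
    apply LN.const_of
    intro c
    by_contra hcon
    push Not at hcon
    obtain ⟨hA0, hB0⟩ := hcon
    set A := {x | g x < c} with hA
    set B := {x | c ≤ g x} with hB
    have hAm : MeasurableSet A := measurableSet_lt hgm measurable_const
    have hBm : MeasurableSet B := measurableSet_le measurable_const hgm
    have hBc := hergH B hBm hB0
    let R := H ∩ A ×ˢ B
    have hRE : R ⊆ E := inter_subset_left.trans hHE
    obtain ⟨G, hGm, hG1, hG2, hGu⟩ := LN.partial_inj (R := R) (hH.1.inter (hAm.prod hBm))
      (hcnt R hRE) (hcnt' R hRE)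
    have hcov : A ⊆ (ESat H B)ᶜ ∪ ⋃ n, Prod.fst '' G n := by
      intro x hx
      by_cases h : x ∈ ESat H B
      · obtain ⟨y, hy, hxy⟩ := h
        have : (x, y) ∈ ⋃ n, G n := by rw [hGu]; exact ⟨hxy, hx, hy⟩
        obtain ⟨n, hn⟩ := mem_iUnion.1 this
        exact Or.inr (mem_iUnion.2 ⟨n, _, hn, rfl⟩)
      · exact Or.inl h
    have hex : ∃ n, μ (Prod.fst '' G n) ≠ 0 := by
      by_contra h
      push Not at h
      exact hA0 (measure_mono_null hcov (measure_union_null hBc (measure_iUnion_null h)))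
    obtain ⟨n, hn⟩ := hex
    obtain ⟨t, htm, hts, ht0, htt⟩ := Measure.exists_subset_measure_lt_top (μ := μ) (r := 0)
      ((hGm n).image_of_measurable_injOn measurable_fst (hG1 n)) (pos_iff_ne_zero.2 hn)
    let G' := G n ∩ Prod.fst ⁻¹' t
    have hG'm : MeasurableSet G' := (hGm n).inter (measurable_fst htm)
    have hG'1 : InjOn Prod.fst G' := (hG1 n).mono inter_subset_left
    have hG'2 : InjOn Prod.snd G' := (hG2 n).mono inter_subset_left
    have hG'R : G' ⊆ R := by
      rw [← hGu]; exact inter_subset_left.trans (subset_iUnion G n)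
    have hft : Prod.fst '' G' = t := by
      refine Subset.antisymm ?_ ?_
      · rintro _ ⟨p, hp, rfl⟩; exact hp.2
      · intro x hx
        obtain ⟨p, hp, rfl⟩ := hts hx
        exact ⟨p, ⟨hp, hx⟩, rfl⟩
    have e1 := hmpH G' (hG'R.trans inter_subset_left) hG'm
    rw [LN.nuL_eq μ hG'm hG'1, LN.nuR_eq μ hG'm hG'2, hft] at e1
    have e2 := LN.inv_eq hinv ((hG'R.trans inter_subset_left).trans hHK) hG'm hG'1 hG'2
    have hsm := hG'm.image_of_measurable_injOn measurable_snd hG'2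
    rw [hft, ← hμ', withDensity_apply _ htm, withDensity_apply _ hsm] at e2
    have htA : t ⊆ A := by
      rw [← hft]; rintro _ ⟨p, hp, rfl⟩; exact (hG'R hp).2.1
    have hsB : Prod.snd '' G' ⊆ B := by
      rintro _ ⟨p, hp, rfl⟩; exact (hG'R hp).2.2
    have hlow : c * μ (Prod.snd '' G') ≤ ∫⁻ x in Prod.snd '' G', g x ∂μ := by
      rw [← setLIntegral_const]
      exact setLIntegral_mono hgm fun x hx => hsB hx
    have hct : c ≠ ∞ := by
      rintro rfl
      apply hB0
      have h6 := Measure.rnDeriv_lt_top μ' μ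
      rw [ae_iff] at h6
      refine measure_mono_null (fun x hx => ?_) h6
      exact not_lt.2 hx
    have hup : ∫⁻ x in t, g x ∂μ < ∫⁻ x in t, c ∂μ := by
      refine setLIntegral_strict_mono htm ht0.ne' measurable_const ?_
        (Eventually.of_forall fun x hx => htA hx)
      refine ne_top_of_le_ne_top (ENNReal.mul_ne_top hct htt.ne) ?_
      rw [← setLIntegral_const]
      exact setLIntegral_mono measurable_const fun x hx => (show g x < c from htA hx).le
    rw [setLIntegral_const, e2, e1] at hup
    exact absurd hup (not_lt.2 hlow)
  obtain ⟨k, hk⟩ := hconst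
  have hμk : ∀ s, MeasurableSet s → μ' s = k * μ s := by
    intro s hs
    rw [← hμ', withDensity_congr_ae hk, withDensity_const, Measure.smul_apply, smul_eq_mul]
  have hD1 : InjOn Prod.fst 𝒟 := by
    intro e he e' he' hee
    by_contra hne
    have := h𝒟disj e he e' he' hne
    have h3 : e.1 ∈ ({e.1, e.2} ∩ {e'.1, e'.2} : Set X) := ⟨by simp, by simp [hee]⟩
    rw [this] at h3
    exact h3
  have hD2 : InjOn Prod.snd 𝒟 := by
    intro e he e' he' hee
    by_contra hne
    have := h𝒟disj e he e' he' hne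
    have h3 : e.2 ∈ ({e.1, e.2} ∩ {e'.1, e'.2} : Set X) := ⟨by simp, by simp [hee]⟩
    rw [this] at h3
    exact h3
  rw [LN.nuL_eq μ h𝒟meas hD1] at h𝒟nn
  obtain ⟨t, htm, hts, ht0, htt⟩ := Measure.exists_subset_measure_lt_top (μ := μ) (r := 0)
    (h𝒟meas.image_of_measurable_injOn measurable_fst hD1) (pos_iff_ne_zero.2 h𝒟nn)
  have hμ0 : μ ≠ 0 := by rintro rfl; simp at ht0
  have hk0 : k ≠ 0 := by
    rintro rfl
    have h1 : μ' univ = 0 := by rw [hμk _ MeasurableSet.univ, zero_mul]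
    have h2 := hac' h1
    exact hμ0 (Measure.measure_univ_eq_zero.1 h2)
  have hkt : k ≠ ∞ := by
    have : NeBot (ae μ) := ae_neBot.2 hμ0
    obtain ⟨x, hx1, hx2⟩ := (hk.and (Measure.rnDeriv_lt_top μ' μ)).exists
    rw [← hx1]
    exact hx2.ne
  let G' := 𝒟 ∩ Prod.fst ⁻¹' t
  have hG'm : MeasurableSet G' := h𝒟meas.inter (measurable_fst htm)
  have hG'1 : InjOn Prod.fst G' := hD1.mono inter_subset_left
  have hG'2 : InjOn Prod.snd G' := hD2.mono inter_subset_left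
  have hft : Prod.fst '' G' = t := by
    refine Subset.antisymm ?_ ?_
    · rintro _ ⟨p, hp, rfl⟩; exact hp.2
    · intro x hx
      obtain ⟨p, hp, rfl⟩ := hts hx
      exact ⟨p, ⟨hp, hx⟩, rfl⟩
  have e2 := LN.inv_eq hinv (inter_subset_left.trans hDK : G' ⊆ K) hG'm hG'1 hG'2
  have hsm := hG'm.image_of_measurable_injOn measurable_snd hG'2
  rw [hft, hμk _ htm, hμk _ hsm, ENNReal.mul_right_inj hk0 hkt] at e2
  have e3 := hw.2.2.2.2 G' (fun p hp => (h𝒟EH hp.1).1) hG'm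
  have e4 := LN.lintR_ge μ hG'm hG'2 (w := w) (c := ENNReal.ofReal (Real.exp ε))
    (fun e he => h𝒟w e he.1)
  rw [← e3, LN.nuL_eq μ hG'm hG'1, hft, ← e2] at e4
  have h1 : (1 : ℝ≥0∞) < ENNReal.ofReal (Real.exp ε) := by
    rw [ENNReal.one_lt_ofReal]
    exact Real.one_lt_exp_iff.2 hε
  have h5 : 1 * μ t < ENNReal.ofReal (Real.exp ε) * μ t :=
    ENNReal.mul_lt_mul_left ht0.ne' htt.ne h1
  rw [one_mul] at h5
  exact absurd h5 (not_lt.2 e4)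
end
end
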